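/- Let P_n be a graph sampled uniformly at random from 𝒫_n. Then there exist c > 0 and n₀ such that for all n ≥ n₀, with probability at least 1 − e^{−cn} the graph P_n satisfies: for every set S ⊆ {1,…,n} with |S| < δ(P_n), the graph obtained from P_n by deleting the vertices of S is connected (equivalently, the vertex connectivity κ(P_n) equals the minimum degree δ(P_n)). -/

import Mathlib

open scoped Classical
open Filter

noncomputable section

/-- A finite simple graph is perfect if every induced subgraph has chromatic number
equal to clique number. -/
def IsPerfect {V : Type*} (G : SimpleGraph V) : Prop :=
  ∀ s : Set V, (G.induce s).chromaticNumber = ((G.induce s).cliqueNum : ℕ∞)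

/-- `(G, C)` is a unipolar arrangement: `C` is a clique (the central clique) and every
connected component of the subgraph induced on the complement of `C` is a clique. -/
def IsUnipolarArrangement {V : Type*} (G : SimpleGraph V) (C : Set V) : Prop :=
  G.IsClique C ∧
    ∀ u v : (Cᶜ : Set V), (G.induce Cᶜ).Reachable u v → u ≠ v → (G.induce Cᶜ).Adj u v

def IsUnipolar {V : Type*} (G : SimpleGraph V) : Prop :=
  ∃ C : Set V, IsUnipolarArrangement G C

def IsCoUnipolar {V : Type*} (G : SimpleGraph V) : Prop := IsUnipolar Gᶜ

def IsGenSplit {V : Type*} (G : SimpleGraph V) : Prop := IsUnipolar G ∨ IsCoUnipolar G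

/-- the `m`-th Bell number: the number of partitions of an `m`-element set. -/
def bell (m : ℕ) : ℕ := Nat.card (Finpartition (Finset.univ : Finset (Fin m)))

/-- `ℓ_{n,k} = C(n,k) · 2^{k(n-k)} · B_{n-k}` -/
def ell (n k : ℕ) : ℕ := Nat.choose n k * 2 ^ (k * (n - k)) * bell (n - k)

/-- `𝓛_n = Σ_{k=0}^n ℓ_{n,k}` -/
def scrL (n : ℕ) : ℕ := ∑ k ∈ Finset.range (n + 1), ell n k

/-- the number of perfect graphs on `{1,…,n}` -/
def perfectCount (n : ℕ) : ℕ := Nat.card {G : SimpleGraph (Fin n) // IsPerfect G}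

/-- independence number -/
def indepNum {V : Type*} (G : SimpleGraph V) : ℕ := Gᶜ.cliqueNum

/-! ### Counting -/

/-- The number of elements satisfying `p`, as a real number. -/
def cnt {α : Type*} (p : α → Prop) : ℝ := (Set.ncard {x | p x} : ℝ)

section Counting
variable {α β ι κ lam : Type*}

lemma cnt_nonneg (p : α → Prop) : 0 ≤ cnt p := Nat.cast_nonneg _

lemma cnt_inj_le [Finite β] {p : α → Prop} {q : β → Prop} (f : α → β)
    (hf : ∀ x, p x → q (f x)) (hi : ∀ x y, p x → p y → f x = f y → x = y) :
    cnt p ≤ cnt q := by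
  unfold cnt
  exact_mod_cast Set.ncard_le_ncard_of_injOn f hf (fun x hx y hy h => hi x y hx hy h)

lemma cnt_mono [Finite α] {p q : α → Prop} (h : ∀ x, p x → q x) : cnt p ≤ cnt q :=
  cnt_inj_le id h (fun _ _ _ _ h => h)

lemma cnt_or_le (p q : α → Prop) : cnt (fun x => p x ∨ q x) ≤ cnt p + cnt q := by
  unfold cnt
  exact_mod_cast Set.ncard_union_le {x | p x} {x | q x}

lemma cnt_true : cnt (fun _ : α => True) = Nat.card α := by
  simp [cnt, Set.ncard_univ]

lemma cnt_le_card [Finite α] (p : α → Prop) : cnt p ≤ Nat.card α := by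
  rw [← cnt_true]; exact cnt_mono fun _ _ => trivial

lemma cnt_eq_card_subtype (p : α → Prop) : cnt p = Nat.card {x // p x} := by
  rfl

lemma cnt_exists_le [Finite α] [Finite ι] {p : α → Prop} (I : ι → Prop) (q : ι → α → Prop)
    {K M : ℝ} (hM : 0 ≤ M) (hK : cnt I ≤ K) (h : ∀ x, p x → ∃ i, I i ∧ q i x)
    (hq : ∀ i, I i → cnt (q i) ≤ M) : cnt p ≤ K * M := by
  classical
  have := Fintype.ofFinite α
  have := Fintype.ofFinite ι
  have h1 : cnt p ≤ ∑ i ∈ Finset.univ.filter I, cnt (q i) := by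
    have e : ∀ p : α → Prop, cnt p = ((Finset.univ.filter p).card : ℝ) := by
      intro p; unfold cnt; rw [Set.ncard_eq_toFinset_card']; congr 2; ext; simp
    simp only [e]
    have : Finset.univ.filter p ⊆ (Finset.univ.filter I).biUnion
        (fun i => Finset.univ.filter (q i)) := by
      intro x hx
      obtain ⟨i, hi, hqi⟩ := h x (by simpa using hx)
      simp only [Finset.mem_biUnion, Finset.mem_filter, Finset.mem_univ, true_and]
      exact ⟨i, hi, hqi⟩
    exact_mod_cast (Finset.card_le_card this).trans Finset.card_biUnion_le
  have h2 : ∑ i ∈ Finset.univ.filter I, cnt (q i) ≤ cnt I * M := by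
    have e : cnt I = ((Finset.univ.filter I).card : ℝ) := by
      unfold cnt; rw [Set.ncard_eq_toFinset_card']; congr 2; ext; simp
    rw [e, ← nsmul_eq_mul]
    exact Finset.sum_le_card_nsmul _ _ _ (fun i hi => hq i (by simpa using hi))
  exact h1.trans (h2.trans (mul_le_mul_of_nonneg_right hK hM))

lemma cnt_prod [Finite α] [Finite β] (p : α → Prop) (q : β → Prop) :
    cnt (fun x : α × β => p x.1 ∧ q x.2) = cnt p * cnt q := by
  unfold cnt
  rw [← Nat.cast_mul, ← Set.ncard_prod]; rfl

lemma cnt_pi [Fintype ι] (p : ι → α → Prop) :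
    cnt (fun g : ι → α => ∀ i, p i (g i)) = ∏ i, cnt (p i) := by
  simp only [cnt_eq_card_subtype]
  rw [← Nat.cast_prod, ← Nat.card_pi]
  congr 1
  exact Nat.card_congr
    { toFun := fun g i => ⟨g.1 i, g.2 i⟩
      invFun := fun g => ⟨fun i => (g i).1, fun i => (g i).2⟩
      left_inv := fun g => rfl
      right_inv := fun g => rfl }

lemma cnt_pi_le [Fintype ι] [Finite α] (p : ι → α → Prop) {M : ℝ}
    (h : ∀ i, cnt (p i) ≤ M) :
    cnt (fun g : ι → α => ∀ i, p i (g i)) ≤ M ^ Fintype.card ι := by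
  rw [cnt_pi]
  exact (Finset.prod_le_prod (fun i _ => cnt_nonneg _) (fun i _ => h i)).trans (by simp)

lemma cnt_fun_prop [Fintype ι] : cnt (fun _ : ι → Prop => True) = 2 ^ Fintype.card ι := by
  rw [cnt_true, Nat.card_eq_fintype_card, Fintype.card_fun, Fintype.card_prop]; push_cast; rfl

/-- Functions avoiding one pattern on each of a family of disjoint cells. -/
lemma cnt_avoid_cells [Fintype ι] [Fintype κ] [Fintype lam] (c : κ × lam → ι)
    (hc : Function.Injective c) (σ : lam → Prop) :
    cnt (fun g : ι → Prop => ∀ i, ¬ ∀ l, (g (c (i, l)) ↔ σ l)) *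
      2 ^ (Fintype.card lam * Fintype.card κ)
      ≤ 2 ^ Fintype.card ι * (2 ^ Fintype.card lam - 1) ^ Fintype.card κ := by
  have hcard : Fintype.card {x : ι // x ∉ Set.range c} =
      Fintype.card ι - Fintype.card κ * Fintype.card lam := by
    rw [Fintype.card_subtype_compl (fun x => x ∈ Set.range c)]
    congr 1
    rw [← Fintype.card_prod]
    exact (Fintype.card_congr (Equiv.ofInjective c hc)).symm
  have hle : Fintype.card κ * Fintype.card lam ≤ Fintype.card ι := by
    rw [← Fintype.card_prod]; exact Fintype.card_le_of_injective c hc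
  have h1 : cnt (fun g : ι → Prop => ∀ i, ¬ ∀ l, (g (c (i, l)) ↔ σ l)) ≤
      cnt (fun x : (κ → lam → Prop) × ({x : ι // x ∉ Set.range c} → Prop) =>
        (∀ i, x.1 i ≠ σ) ∧ True) := by
    refine cnt_inj_le (fun g => (fun i l => g (c (i, l)), fun x => g x.1)) ?_ ?_
    · intro g hg
      refine ⟨fun i h => hg i fun l => ?_, trivial⟩
      have := congrFun h l
      simpa using this
    · intro g g' _ _ h
      simp only [Prod.mk.injEq] at h
      funext x
      by_cases hx : x ∈ Set.range c
      · obtain ⟨⟨i, l⟩, rfl⟩ := hx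
        exact congrFun (congrFun h.1 i) l
      · exact congrFun h.2 ⟨x, hx⟩
  have h2 : cnt (fun g : lam → Prop => g ≠ σ) = 2 ^ Fintype.card lam - 1 := by
    have : ({x : lam → Prop | x ≠ σ}) = {σ}ᶜ := rfl
    unfold cnt
    rw [this, Set.ncard_compl, Set.ncard_singleton, Nat.card_eq_fintype_card, Fintype.card_fun,
      Fintype.card_prop, Nat.cast_sub Nat.one_le_two_pow]
    push_cast; rfl
  rw [cnt_prod (fun x : κ → lam → Prop => ∀ i, x i ≠ σ) (fun _ => True), cnt_fun_prop,
    cnt_pi (fun (_ : κ) (x : lam → Prop) => x ≠ σ), h2, hcard] at h1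
  simp only [Finset.prod_const, Finset.card_univ] at h1
  calc _ ≤ ((2 ^ Fintype.card lam - 1) ^ Fintype.card κ *
      2 ^ (Fintype.card ι - Fintype.card κ * Fintype.card lam)) *
        2 ^ (Fintype.card lam * Fintype.card κ) :=
        mul_le_mul_of_nonneg_right h1 (by positivity)
    _ = 2 ^ Fintype.card ι * (2 ^ Fintype.card lam - 1) ^ Fintype.card κ := by
        rw [mul_assoc, ← pow_add, mul_comm (Fintype.card lam), Nat.sub_add_cancel hle, mul_comm]

lemma pow_ratio_le (l k : ℕ) (hl : l ≤ 6) :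
    ((2 : ℝ) ^ l - 1) ^ k * 2 ^ ((k : ℝ) / 50) ≤ 2 ^ (l * k) := by
  have key : ((2 : ℝ) ^ l - 1) * 2 ^ ((1 : ℝ) / 50) ≤ 2 ^ l := by
    have h : (2 : ℝ) ^ ((1 : ℝ) / 50) ≤ 64 / 63 := by
      have := Real.rpow_le_rpow (z := 1 / 50) (by positivity)
          (show (2 : ℝ) ≤ (64 / 63) ^ 50 by norm_num)
        (by norm_num)
      refine this.trans (le_of_eq ?_)
      rw [← Real.rpow_natCast, ← Real.rpow_mul (by norm_num)]; norm_num
    have h2 : (2 : ℝ) ^ l ≤ 64 := by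
      calc (2 : ℝ) ^ l ≤ 2 ^ 6 := pow_le_pow_right₀ (by norm_num) hl
        _ = 64 := by norm_num
    have h3 : (1 : ℝ) ≤ 2 ^ l := one_le_pow₀ (by norm_num)
    nlinarith
  have : (2 : ℝ) ^ ((k : ℝ) / 50) = (2 ^ ((1 : ℝ) / 50)) ^ k := by
    rw [← Real.rpow_natCast, ← Real.rpow_mul (by norm_num)]; ring_nf
  rw [this, ← mul_pow, pow_mul]
  exact pow_le_pow_left₀ (mul_nonneg
    (by linarith [one_le_pow₀ (M₀ := ℝ) (a := 2) (n := l) (by norm_num)]) (by positivity)) key k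

lemma cnt_avoid_grid [Fintype ι] [Fintype κ] {a b r p : ℕ} (hab : a * b ≤ 6)
    (e : Fin r × Fin a → ι) (he : Function.Injective e)
    (f : Fin p × Fin b → κ) (hf : Function.Injective f) (σ : Fin a → Fin b → Prop) :
    cnt (fun g : ι → κ → Prop => ∀ i j, ¬ ∀ k l, (g (e (i, k)) (f (j, l)) ↔ σ k l))
      ≤ 2 ^ ((Fintype.card ι * Fintype.card κ : ℕ) - (r * p : ℝ) / 50) := by
  have h1 : cnt (fun g : ι → κ → Prop => ∀ i j, ¬ ∀ k l, (g (e (i, k)) (f (j, l)) ↔ σ k l)) ≤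
      cnt (fun g : ι × κ → Prop => ∀ i : Fin r × Fin p, ¬ ∀ l : Fin a × Fin b,
        (g ((fun x : (Fin r × Fin p) × (Fin a × Fin b) => (e (x.1.1, x.2.1), f (x.1.2, x.2.2)))
          (i, l)) ↔ σ l.1 l.2)) := by
    refine cnt_inj_le (fun g x => g x.1 x.2) ?_ ?_
    · intro g hg i h
      exact hg i.1 i.2 fun k l => h (k, l)
    · intro g g' _ _ h
      funext x y
      exact congrFun h (x, y)
  have h2 := cnt_avoid_cells (ι := ι × κ) (κ := Fin r × Fin p) (lam := Fin a × Fin b)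
    (fun x : (Fin r × Fin p) × (Fin a × Fin b) => (e (x.1.1, x.2.1), f (x.1.2, x.2.2)))
    (by
      rintro ⟨⟨i, j⟩, k, l⟩ ⟨⟨i', j'⟩, k', l'⟩ h
      simp only [Prod.mk.injEq] at h
      have h1 := he h.1
      have h2 := hf h.2
      simp only [Prod.mk.injEq] at h1 h2 ⊢
      tauto) (fun l => σ l.1 l.2)
  simp only [Fintype.card_prod, Fintype.card_fin] at h2
  have h3 := pow_ratio_le (a * b) (r * p) hab
  rw [Real.rpow_sub (by norm_num), Real.rpow_natCast, le_div_iff₀ (by positivity)]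
  have hp : (0 : ℝ) < 2 ^ (a * b * (r * p)) := by positivity
  refine (mul_le_mul_of_nonneg_right h1 (by positivity)).trans ?_
  refine le_of_mul_le_mul_right ?_ hp
  push_cast at h3
  set C := cnt (fun g : ι × κ → Prop => ∀ i : Fin r × Fin p, ¬ ∀ l : Fin a × Fin b,
        (g ((fun x : (Fin r × Fin p) × (Fin a × Fin b) => (e (x.1.1, x.2.1), f (x.1.2, x.2.2)))
          (i, l)) ↔ σ l.1 l.2))
  set E := (2 : ℝ) ^ ((r * p : ℝ) / 50)
  have hE : 0 < E := by positivity
  calc C * E * 2 ^ (a * b * (r * p)) = (C * 2 ^ (a * b * (r * p))) * E := by ring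
    _ ≤ (2 ^ (Fintype.card ι * Fintype.card κ) * (2 ^ (a * b) - 1) ^ (r * p)) * E :=
        mul_le_mul_of_nonneg_right h2 hE.le
    _ = 2 ^ (Fintype.card ι * Fintype.card κ) * ((2 ^ (a * b) - 1) ^ (r * p) * E) := by ring
    _ ≤ _ := mul_le_mul_of_nonneg_left h3 (by positivity)

end Counting

/-! ### A hereditary class containing the perfect graphs -/

section Classes
variable {V W : Type*}

/-- `a b c d e` is an induced five-cycle. -/
def C5 (G : SimpleGraph V) (a b c d e : V) : Prop :=
  G.Adj a b ∧ G.Adj b c ∧ G.Adj c d ∧ G.Adj d e ∧ G.Adj e a ∧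
    ¬ G.Adj a c ∧ ¬ G.Adj b d ∧ ¬ G.Adj c e ∧ ¬ G.Adj d a ∧ ¬ G.Adj e b

def C5Free (G : SimpleGraph V) : Prop := ∀ a b c d e, ¬ C5 G a b c d e

def Homog (G : SimpleGraph V) (Y : Finset V) : Prop :=
  G.IsClique (Y : Set V) ∨ Gᶜ.IsClique (Y : Set V)

/-- Graphs without induced five-cycles in which every vertex set `X` contains a homogeneous set of
size at least `√|X|`. -/
def Cls (G : SimpleGraph V) : Prop :=
  C5Free G ∧ ∀ X : Finset V, ∃ Y ⊆ X, Homog G Y ∧ X.card ≤ Y.card ^ 2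

lemma Homog.compl {G : SimpleGraph V} {Y : Finset V} (h : Homog G Y) : Homog Gᶜ Y := by
  rcases h with h | h
  · exact Or.inr (by rwa [compl_compl])
  · exact Or.inl h

lemma Homog.subset {G : SimpleGraph V} {Y Z : Finset V} (h : Homog G Y) (hZ : Z ⊆ Y) :
    Homog G Z := by
  rcases h with h | h
  · exact Or.inl (h.subset (by exact_mod_cast hZ))
  · exact Or.inr (h.subset (by exact_mod_cast hZ))

lemma C5.ne {G : SimpleGraph V} {a b c d e : V} (h : C5 G a b c d e) :
    a ≠ c ∧ b ≠ d ∧ c ≠ e ∧ d ≠ a ∧ e ≠ b := by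
  obtain ⟨h1, h2, h3, h4, h5, n1, n2, n3, n4, n5⟩ := h
  refine ⟨?_, ?_, ?_, ?_, ?_⟩ <;> rintro rfl
  · exact n4 h3.symm
  · exact n5 h4.symm
  · exact n1 h5.symm
  · exact n2 h1.symm
  · exact n3 h2.symm

lemma C5.compl {G : SimpleGraph V} {a b c d e : V} (h : C5 G a b c d e) : C5 Gᶜ a c e b d := by
  have hn := h.ne
  obtain ⟨h1, h2, h3, h4, h5, n1, n2, n3, n4, n5⟩ := h
  simp only [C5, SimpleGraph.compl_adj]
  refine ⟨⟨hn.1, n1⟩, ⟨hn.2.2.1, n3⟩, ⟨hn.2.2.2.2, n5⟩, ⟨hn.2.1, n2⟩, ⟨hn.2.2.2.1, n4⟩, ?_, ?_,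
    ?_, ?_, ?_⟩
  · exact fun h => h.2 h5.symm
  · exact fun h => h.2 h2.symm
  · exact fun h => h.2 h4.symm
  · exact fun h => h.2 h1.symm
  · exact fun h => h.2 h3.symm

lemma C5Free.compl {G : SimpleGraph V} (h : C5Free G) : C5Free Gᶜ := by
  intro a b c d e h5
  have := h5.compl
  rw [compl_compl] at this
  exact h _ _ _ _ _ this

lemma Cls.compl {G : SimpleGraph V} (h : Cls G) : Cls Gᶜ := by
  refine ⟨h.1.compl, fun X => ?_⟩
  obtain ⟨Y, h1, h2, h3⟩ := h.2 X
  exact ⟨Y, h1, h2.compl, h3⟩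

lemma Cls.comap {G : SimpleGraph V} (h : Cls G) (f : W ↪ V) : Cls (G.comap f) := by
  refine ⟨fun a b c d e h5 => h.1 (f a) (f b) (f c) (f d) (f e) h5, fun X => ?_⟩
  obtain ⟨Y, h1, h2, h3⟩ := h.2 (X.map f)
  obtain ⟨Z, hZ, rfl⟩ := Finset.subset_map_iff.1 h1
  refine ⟨Z, hZ, ?_, by simpa using h3⟩
  rcases h2 with h2 | h2
  · refine Or.inl fun x hx y hy hxy => ?_
    exact h2 (by simpa using hx) (by simpa using hy) (f.injective.ne hxy)
  · refine Or.inr fun x hx y hy hxy => ?_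
    have := h2 (x := f x) (by simpa using hx) (y := f y) (by simpa using hy) (f.injective.ne hxy)
    rw [SimpleGraph.compl_adj] at this ⊢
    exact ⟨hxy, this.2⟩

lemma IsPerfect.c5Free {G : SimpleGraph V} (h : IsPerfect G) : C5Free G := by
  intro a b c d e h5
  set s : Set V := {a, b, c, d, e} with hs
  have hfin : Finite s := by rw [hs]; exact Set.Finite.to_subtype (by simp)
  have hle : (G.induce s).cliqueNum ≤ 2 := by
    obtain ⟨t, ht⟩ := (G.induce s).exists_isNClique_cliqueNum
    by_contra! hlt
    rw [← ht.2, Finset.two_lt_card] at hlt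
    obtain ⟨x, hx, y, hy, z, hz, hxy, hxz, hyz⟩ := hlt
    have a1 : G.Adj x y := ht.1 hx hy hxy
    have a2 : G.Adj x z := ht.1 hx hz hxz
    have a3 : G.Adj y z := ht.1 hy hz hyz
    obtain ⟨x, hx'⟩ := x
    obtain ⟨y, hy'⟩ := y
    obtain ⟨z, hz'⟩ := z
    clear hx hy hz ht hxy hxz hyz
    simp only [hs, Set.mem_insert_iff, Set.mem_singleton_iff] at hx' hy' hz'
    obtain ⟨h1, h2, h3, h4, h5, n1, n2, n3, n4, n5⟩ := h5
    have sy := fun u v => G.adj_comm u v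
    have ir := fun u => G.irrefl (v := u)
    have m1 : ¬ G.Adj c a := fun h => n1 h.symm
    have m2 : ¬ G.Adj d b := fun h => n2 h.symm
    have m3 : ¬ G.Adj e c := fun h => n3 h.symm
    have m4 : ¬ G.Adj a d := fun h => n4 h.symm
    have m5 : ¬ G.Adj b e := fun h => n5 h.symm
    simp only at a1 a2 a3
    rcases hx' with rfl | rfl | rfl | rfl | rfl <;> rcases hy' with rfl | rfl | rfl | rfl | rfl <;>
      first
      | exact absurd a1 (ir _)
      | exact absurd a1 (by assumption)
      | (rcases hz' with rfl | rfl | rfl | rfl | rfl <;>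
          first
          | exact absurd a2 (ir _)
          | exact absurd a3 (ir _)
          | exact absurd a2 (by assumption)
          | exact absurd a3 (by assumption))
  have hc : (G.induce s).Colorable 2 := by
    rw [← SimpleGraph.chromaticNumber_le_iff_colorable, h s]
    exact_mod_cast hle
  obtain ⟨C⟩ := hc
  obtain ⟨h1, h2, h3, h4, h5, -⟩ := h5
  have v1 := C.valid (v := ⟨a, by simp [hs]⟩) (w := ⟨b, by simp [hs]⟩) h1
  have v2 := C.valid (v := ⟨b, by simp [hs]⟩) (w := ⟨c, by simp [hs]⟩) h2
  have v3 := C.valid (v := ⟨c, by simp [hs]⟩) (w := ⟨d, by simp [hs]⟩) h3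
  have v4 := C.valid (v := ⟨d, by simp [hs]⟩) (w := ⟨e, by simp [hs]⟩) h4
  have v5 := C.valid (v := ⟨e, by simp [hs]⟩) (w := ⟨a, by simp [hs]⟩) h5
  omega

lemma IsPerfect.cls {G : SimpleGraph V} (h : IsPerfect G) : Cls G := by
  refine ⟨h.c5Free, fun X => ?_⟩
  have hX := h (X : Set V)
  set H := G.induce (X : Set V) with hH
  have hcol : H.Colorable H.cliqueNum := by
    rw [← SimpleGraph.chromaticNumber_le_iff_colorable, hX]
  obtain ⟨C⟩ := hcol
  obtain ⟨t, ht⟩ := H.exists_isNClique_cliqueNum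
  by_cases hle : X.card ≤ H.cliqueNum ^ 2
  · refine ⟨t.map (Function.Embedding.subtype _), ?_, Or.inl ?_, ?_⟩
    · intro x hx
      simp only [Finset.mem_map, Function.Embedding.subtype_apply] at hx
      obtain ⟨y, -, rfl⟩ := hx
      exact y.2
    · intro x hx y hy hxy
      simp only [Finset.coe_map, Function.Embedding.subtype_apply, Set.mem_image] at hx hy
      obtain ⟨x, hx, rfl⟩ := hx
      obtain ⟨y, hy, rfl⟩ := hy
      exact ht.1 hx hy (fun h => hxy (by rw [h]))
    · rw [Finset.card_map, ht.2]; exact hle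
  · push Not at hle
    have hpos : 0 < X.card := by omega
    obtain ⟨x₀, hx₀⟩ := Finset.card_pos.1 hpos
    obtain ⟨i, -, hi⟩ := Finset.exists_max_image Finset.univ
      (fun i : Fin H.cliqueNum => (Finset.univ.filter fun x => C x = i).card) ⟨C ⟨x₀, hx₀⟩, by simp⟩
    have hsum : X.card ≤ H.cliqueNum * (Finset.univ.filter fun x => C x = i).card := by
      have h1 := Finset.card_eq_sum_card_fiberwise (s := Finset.univ) (t := Finset.univ)
        (f := fun x => C x) (fun _ _ => by simp)
      have h2 := Finset.sum_le_card_nsmul Finset.univ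
        (fun i : Fin H.cliqueNum => (Finset.univ.filter fun x => C x = i).card) _ hi
      rw [← h1] at h2
      simpa using h2
    have hXc : X.card ≤ (Finset.univ.filter fun x => C x = i).card ^ 2 := by
      have : H.cliqueNum ≤ (Finset.univ.filter fun x => C x = i).card := by
        by_contra! hlt
        nlinarith
      nlinarith
    refine ⟨(Finset.univ.filter fun x => C x = i).map (Function.Embedding.subtype _), ?_,
      Or.inr ?_, ?_⟩
    · intro x hx
      simp only [Finset.mem_map, Function.Embedding.subtype_apply] at hx
      obtain ⟨y, -, rfl⟩ := hx
      exact y.2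
    · intro x hx y hy hxy
      simp only [Finset.coe_map, Function.Embedding.subtype_apply, Set.mem_image] at hx hy
      obtain ⟨x, hx, rfl⟩ := hx
      obtain ⟨y, hy, rfl⟩ := hy
      rw [SimpleGraph.compl_adj]
      refine ⟨hxy, fun hadj => C.valid (v := x) (w := y) hadj ?_⟩
      simp at hx hy
      rw [hx, hy]
    · rwa [Finset.card_map]

end Classes

/-! ### Unipolar graphs -/

section Unipolar
variable {V W : Type*}

lemma isUnipolarArrangement_iff {G : SimpleGraph V} {C : Set V} :
    IsUnipolarArrangement G C ↔ G.IsClique C ∧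
      ∀ x y z, x ∉ C → y ∉ C → z ∉ C → G.Adj x y → G.Adj y z → x ≠ z → G.Adj x z := by
  refine and_congr_right fun _ => ⟨fun h x y z hx hy hz hxy hyz hxz => ?_, fun h u v huv hne => ?_⟩
  · have a1 : (G.induce Cᶜ).Adj ⟨x, hx⟩ ⟨y, hy⟩ := hxy
    have a2 : (G.induce Cᶜ).Adj ⟨y, hy⟩ ⟨z, hz⟩ := hyz
    exact h ⟨x, hx⟩ ⟨z, hz⟩ (a1.reachable.trans a2.reachable) (by simpa using hxz)
  · obtain ⟨p⟩ := huv
    induction p with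
    | nil => exact absurd rfl hne
    | @cons u v w huv p ih =>
      by_cases hvw : v = w
      · subst hvw; exact huv
      · exact h u v w u.2 v.2 w.2 huv (ih hvw) (fun h => hne (Subtype.ext h))

lemma IsUnipolar.comap {G : SimpleGraph V} (h : IsUnipolar G) (f : W ↪ V) :
    IsUnipolar (G.comap f) := by
  obtain ⟨C, hC⟩ := h
  rw [isUnipolarArrangement_iff] at hC
  refine ⟨f ⁻¹' C, isUnipolarArrangement_iff.2
    ⟨fun x hx y hy hxy => ?_, fun x y z hx hy hz hxy hyz hxz => ?_⟩⟩
  · exact hC.1 hx hy (f.injective.ne hxy)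
  · exact hC.2 (f x) (f y) (f z) hx hy hz hxy hyz (f.injective.ne hxz)

/-- Hall's theorem colours one clique outside the centre. -/
lemma exists_injective_part_colouring [Finite V] {G : SimpleGraph V} {C Q : Finset V}
    (hC : G.IsClique (C : Set V)) (hQ : G.IsClique (Q : Set V)) (hCQ : Disjoint C Q)
    {k : ℕ} (hk : G.cliqueNum ≤ k) (φ : V → Fin k) (hφ : Set.InjOn φ C) :
    ∃ g : Q → Fin k, Function.Injective g ∧ ∀ q : Q, ∀ c ∈ C, G.Adj q c → g q ≠ φ c := by
  have := Fintype.ofFinite V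
  let t : Q → Finset (Fin k) := fun q => ((C.filter fun c => G.Adj q c).image φ)ᶜ
  obtain ⟨g, hg, hgt⟩ := (Finset.all_card_le_biUnion_card_iff_exists_injective t).1 (by
    intro X
    let D := C.filter fun c => ∀ q ∈ X, G.Adj q c
    have hsub : (D.image φ)ᶜ ⊆ X.biUnion t ∨ X = ∅ := by
      rcases X.eq_empty_or_nonempty with rfl | ⟨q₀, hq₀⟩
      · exact Or.inr rfl
      left
      intro i hi
      rw [Finset.mem_biUnion]
      by_contra! hcon
      have hall : ∀ q ∈ X, ∃ c ∈ C, G.Adj q c ∧ φ c = i := by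
        intro q hq
        have := hcon q hq
        simp only [t, Finset.mem_compl, not_not, Finset.mem_image, Finset.mem_filter] at this
        obtain ⟨c, ⟨h1, h2⟩, h3⟩ := this
        exact ⟨c, h1, h2, h3⟩
      obtain ⟨c, hc, -, hci⟩ := hall q₀ hq₀
      rw [Finset.mem_compl] at hi
      refine hi (Finset.mem_image.2 ⟨c, Finset.mem_filter.2 ⟨hc, fun q hq => ?_⟩, hci⟩)
      obtain ⟨c', hc', hqc', hci'⟩ := hall q hq
      rwa [hφ hc hc' (hci.trans hci'.symm)]
    rcases hsub with hsub | rfl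
    swap
    · simp
    refine le_trans ?_ (Finset.card_le_card hsub)
    rw [Finset.card_compl, Finset.card_image_of_injOn
      (hφ.mono (by exact_mod_cast Finset.filter_subset _ C)), Fintype.card_fin]
    have hcl : G.IsClique ((X.map (Function.Embedding.subtype _) ∪ D : Finset V) : Set V) := by
      intro x hx y hy hxy
      simp only [Finset.coe_union, Finset.coe_map, Function.Embedding.subtype_apply, Set.mem_union,
        Set.mem_image, Finset.mem_coe] at hx hy
      rcases hx with ⟨x, hx, rfl⟩ | hx <;> rcases hy with ⟨y, hy, rfl⟩ | hy
      · exact hQ x.2 y.2 hxy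
      · exact (Finset.mem_filter.1 hy).2 x hx
      · exact ((Finset.mem_filter.1 hx).2 y hy).symm
      · exact hC (Finset.mem_filter.1 hx).1 (Finset.mem_filter.1 hy).1 hxy
    have hcard := hcl.card_le_cliqueNum
    rw [Finset.card_union_of_disjoint, Finset.card_map] at hcard
    · omega
    · rw [Finset.disjoint_left]
      intro x hx hxD
      simp only [Finset.mem_map, Function.Embedding.subtype_apply] at hx
      obtain ⟨x, -, rfl⟩ := hx
      exact Finset.disjoint_left.1 hCQ (Finset.mem_filter.1 hxD).1 x.2)
  refine ⟨g, hg, fun q c hc hqc h => ?_⟩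
  have := hgt q
  simp only [t, Finset.mem_compl, Finset.mem_image, Finset.mem_filter] at this
  exact this ⟨c, ⟨hc, hqc⟩, h.symm⟩

lemma IsUnipolar.colorable [Finite V] {G : SimpleGraph V} (h : IsUnipolar G) :
    G.Colorable G.cliqueNum := by
  have := Fintype.ofFinite V
  obtain ⟨C', hC'⟩ := h
  rw [isUnipolarArrangement_iff] at hC'
  obtain ⟨C, rfl⟩ : ∃ C : Finset V, C' = C := ⟨C'.toFinset, by simp⟩
  obtain ⟨hC, hP⟩ := hC'
  simp only [Finset.mem_coe] at hP
  obtain ⟨φ, hφ⟩ : ∃ φ : V → Fin G.cliqueNum, Set.InjOn φ C := by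
    have hle := hC.card_le_cliqueNum
    rcases C.eq_empty_or_nonempty with rfl | ⟨c, hc⟩
    · rcases isEmpty_or_nonempty V with hV | ⟨⟨v⟩⟩
      · exact ⟨fun v => isEmptyElim v, by simp⟩
      · have : G.IsClique (({v} : Finset V) : Set V) := by simp
        have h1 := this.card_le_cliqueNum
        rw [Finset.card_singleton] at h1
        exact ⟨fun _ => ⟨0, h1⟩, by simp⟩
    · have e : (C : Type _) ↪ Fin G.cliqueNum := by
        refine (Function.Embedding.nonempty_of_card_le ?_).some
        simpa using hle
      refine ⟨fun v => if hv : v ∈ C then e ⟨v, hv⟩ else e ⟨c, hc⟩, fun x hx y hy hxy => ?_⟩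
      simp only [Finset.mem_coe] at hx hy
      simp only [hx, hy, dif_pos] at hxy
      simpa using e.injective hxy
  let r : Setoid V :=
    { r := fun u v => u = v ∨ (u ∉ C ∧ v ∉ C ∧ G.Adj u v)
      iseqv := by
        refine ⟨fun _ => Or.inl rfl, ?_, ?_⟩
        · rintro x y (rfl | ⟨h1, h2, h3⟩)
          · exact Or.inl rfl
          · exact Or.inr ⟨h2, h1, h3.symm⟩
        · rintro x y z (rfl | ⟨h1, h2, h3⟩) (rfl | ⟨h4, h5, h6⟩)
          · exact Or.inl rfl
          · exact Or.inr ⟨h4, h5, h6⟩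
          · exact Or.inr ⟨h1, h2, h3⟩
          · by_cases hxz : x = z
            · exact Or.inl hxz
            · exact Or.inr ⟨h1, h5, hP x y z h1 h2 h5 h3 h6 hxz⟩ }
  let P : Quotient r → Finset V := fun q => Finset.univ.filter fun v => v ∉ C ∧ ⟦v⟧ = q
  have hPc : ∀ q, G.IsClique (P q : Set V) := by
    intro q x hx y hy hxy
    simp only [P, Finset.coe_filter, Finset.mem_univ, true_and, Set.mem_ofPred_eq] at hx hy
    rcases Quotient.exact (hx.2.trans hy.2.symm) with h | h
    · exact absurd h hxy
    · exact h.2.2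
  have hPd : ∀ q, Disjoint C (P q) := by
    intro q
    rw [Finset.disjoint_left]
    intro x hx hxP
    exact (Finset.mem_filter.1 hxP).2.1 hx
  choose g hg hgC using fun q => exists_injective_part_colouring hC (hPc q) (hPd q) le_rfl φ hφ
  have hmem : ∀ v, v ∉ C → v ∈ P ⟦v⟧ := fun v hv => by simp [P, hv]
  let col : V → Fin G.cliqueNum := fun v => if hv : v ∈ C then φ v else g ⟦v⟧ ⟨v, hmem v hv⟩
  refine ⟨SimpleGraph.Coloring.mk col ?_⟩
  intro v w hvw
  by_cases hv : v ∈ C <;> by_cases hw : w ∈ C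
  · simp only [col, hv, hw, dif_pos]
    exact fun h => hvw.ne (hφ hv hw h)
  · simp only [col, hv, hw, dif_pos, dif_neg, not_false_iff]
    exact (hgC _ ⟨w, hmem w hw⟩ v hv hvw.symm).symm
  · simp only [col, hv, hw, dif_pos, dif_neg, not_false_iff]
    exact hgC _ ⟨v, hmem v hv⟩ w hw hvw
  · simp only [col, hv, hw, dif_neg, not_false_iff]
    have hq : (⟦v⟧ : Quotient r) = ⟦w⟧ := Quotient.sound (Or.inr ⟨hv, hw, hvw⟩)
    have : ∀ (q : Quotient r) (h1 : v ∈ P q) (h2 : w ∈ P q), g q ⟨v, h1⟩ ≠ g q ⟨w, h2⟩ :=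
      fun q h1 h2 h => hvw.ne (by simpa using hg q h)
    have key := this ⟦v⟧ (hmem v hv) (hq ▸ hmem w hw)
    have e : ∀ (q q' : Quotient r) (h : q = q') (h1 : w ∈ P q) (h2 : w ∈ P q'),
        g q ⟨w, h1⟩ = g q' ⟨w, h2⟩ := by
      rintro q _ rfl _ _; rfl
    rwa [e _ _ hq _ (hmem w hw)] at key

lemma IsUnipolar.isPerfect [Finite V] {G : SimpleGraph V} (h : IsUnipolar G) : IsPerfect G := by
  intro s
  have h1 : IsUnipolar (G.induce s) := h.comap (Function.Embedding.subtype _)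
  refine le_antisymm (SimpleGraph.chromaticNumber_le_iff_colorable.2 h1.colorable) ?_
  exact SimpleGraph.cliqueNum_le_chromaticNumber

end Unipolar

/-- The number of graphs on `Fin n` in the class `Cls`. -/
def numCls (n : ℕ) : ℝ := cnt fun G : SimpleGraph (Fin n) => Cls G

/-- The number of unipolar graphs on `Fin n`. -/
def numUni (n : ℕ) : ℝ := cnt fun G : SimpleGraph (Fin n) => IsUnipolar G

lemma cnt_compl {V : Type*} [Finite V] (p : SimpleGraph V → Prop) :
    cnt (fun G => p Gᶜ) ≤ cnt p :=
  cnt_inj_le (fun G => Gᶜ) (fun _ h => h) (fun _ _ _ _ h => compl_injective h)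

lemma cnt_coUnipolar_le (n : ℕ) :
    cnt (fun G : SimpleGraph (Fin n) => IsCoUnipolar G) ≤ numUni n := cnt_compl _

lemma numUni_le_perfectCount (n : ℕ) : numUni n ≤ perfectCount n :=
  cnt_mono fun _ h => h.isPerfect

lemma one_le_numUni (n : ℕ) : 1 ≤ numUni n := by
  have : IsUnipolar (⊥ : SimpleGraph (Fin n)) :=
    ⟨∅, isUnipolarArrangement_iff.2 ⟨by simp, fun x y z _ _ _ h => by simp at h⟩⟩
  unfold numUni cnt
  have h : 0 < {G : SimpleGraph (Fin n) | IsUnipolar G}.ncard :=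
    (Set.ncard_pos (Set.toFinite _)).2 ⟨_, this⟩
  exact_mod_cast h

/-- Adding a vertex with neighbourhood `S` to a graph on `Fin n`. -/
def addVertex {n : ℕ} (G : SimpleGraph (Fin n)) (S : Set (Fin n)) : SimpleGraph (Fin (n + 1)) :=
  SimpleGraph.fromRel fun u v => (∃ x y, u = x.castSucc ∧ v = y.castSucc ∧ G.Adj x y) ∨
    (u = Fin.last n ∧ ∃ x ∈ S, v = x.castSucc)

lemma addVertex_adj_castSucc {n : ℕ} (G : SimpleGraph (Fin n)) (S : Set (Fin n)) (x y : Fin n) :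
    (addVertex G S).Adj x.castSucc y.castSucc ↔ G.Adj x y := by
  simp only [addVertex, SimpleGraph.fromRel_adj, Fin.castSucc_inj]
  have h1 : ∀ z : Fin n, z.castSucc ≠ Fin.last n := fun z => (Fin.castSucc_lt_last z).ne
  simp [h1]
  constructor
  · rintro ⟨-, h | h⟩
    · exact h
    · exact h.symm
  · exact fun h => ⟨h.ne, Or.inl h⟩

lemma addVertex_adj_last {n : ℕ} (G : SimpleGraph (Fin n)) (S : Set (Fin n)) (x : Fin n) :
    (addVertex G S).Adj (Fin.last n) x.castSucc ↔ x ∈ S := by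
  have h1 : ∀ z : Fin n, z.castSucc ≠ Fin.last n := fun z => (Fin.castSucc_lt_last z).ne
  simp [addVertex, SimpleGraph.fromRel_adj, h1, fun z => (h1 z).symm]

lemma addVertex_unipolar_of_subset {n : ℕ} {G : SimpleGraph (Fin n)} {C S : Set (Fin n)}
    (hC : IsUnipolarArrangement G C) (hS : S ⊆ C) : IsUnipolar (addVertex G S) := by
  rw [isUnipolarArrangement_iff] at hC
  have hl : ∀ x, x ∉ C → ¬ (addVertex G S).Adj (Fin.last n) x.castSucc := fun x hx h =>
    hx (hS ((addVertex_adj_last _ _ _).1 h))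
  refine ⟨Fin.castSucc '' C, isUnipolarArrangement_iff.2 ⟨?_, ?_⟩⟩
  · rintro _ ⟨x, hx, rfl⟩ _ ⟨y, hy, rfl⟩ hxy
    exact (addVertex_adj_castSucc _ _ _ _).2 (hC.1 hx hy (fun h => hxy (by rw [h])))
  · have hc : ∀ x : Fin n, x.castSucc ∉ Fin.castSucc '' C → x ∉ C := fun x h hx => h ⟨x, hx, rfl⟩
    intro x y z hx hy hz hxy hyz hxz
    induction x using Fin.lastCases with
    | last =>
      induction y using Fin.lastCases with
      | last => exact absurd hxy (SimpleGraph.irrefl _)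
      | cast y => exact absurd hxy (hl y (hc y hy))
    | cast x =>
      induction y using Fin.lastCases with
      | last => exact absurd hxy.symm (hl x (hc x hx))
      | cast y =>
        induction z using Fin.lastCases with
        | last => exact absurd hyz.symm (hl y (hc y hy))
        | cast z =>
          rw [addVertex_adj_castSucc] at *
          exact hC.2 x y z (hc x hx) (hc y hy) (hc z hz) hxy hyz (fun h => hxz (by rw [h]))

lemma addVertex_unipolar_of_superset {n : ℕ} {G : SimpleGraph (Fin n)} {C S : Set (Fin n)}
    (hC : IsUnipolarArrangement G C) (hS : C ⊆ S) : IsUnipolar (addVertex G S) := by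
  rw [isUnipolarArrangement_iff] at hC
  have hl : ∀ x ∈ C, (addVertex G S).Adj (Fin.last n) x.castSucc := fun x hx =>
    (addVertex_adj_last _ _ _).2 (hS hx)
  refine ⟨insert (Fin.last n) (Fin.castSucc '' C), isUnipolarArrangement_iff.2 ⟨?_, ?_⟩⟩
  · rintro _ (rfl | ⟨x, hx, rfl⟩) _ (rfl | ⟨y, hy, rfl⟩) hxy
    · exact absurd rfl hxy
    · exact hl y hy
    · exact (hl x hx).symm
    · exact (addVertex_adj_castSucc _ _ _ _).2 (hC.1 hx hy (fun h => hxy (by rw [h])))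
  · have hc : ∀ x : Fin (n + 1), x ∉ insert (Fin.last n) (Fin.castSucc '' C) →
        ∃ y, x = y.castSucc ∧ y ∉ C := by
      intro x hx
      induction x using Fin.lastCases with
      | last => exact absurd (Or.inl rfl) hx
      | cast x => exact ⟨x, rfl, fun h => hx (Or.inr ⟨x, h, rfl⟩)⟩
    intro x y z hx hy hz hxy hyz hxz
    obtain ⟨x, rfl, hx'⟩ := hc x hx
    obtain ⟨y, rfl, hy'⟩ := hc y hy
    obtain ⟨z, rfl, hz'⟩ := hc z hz
    rw [addVertex_adj_castSucc] at *
    exact hC.2 x y z hx' hy' hz' hxy hyz (fun h => hxz (by rw [h]))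

lemma numUni_succ_ge (n : ℕ) : 2 ^ ((n : ℝ) / 2) * numUni n ≤ numUni (n + 1) := by
  classical
  let ctr : SimpleGraph (Fin n) → Finset (Fin n) := fun G =>
    if h : IsUnipolar G then h.choose.toFinset else ∅
  have hctr : ∀ G, IsUnipolar G → IsUnipolarArrangement G (ctr G : Set (Fin n)) := by
    intro G h
    have := h.choose_spec
    simpa [ctr, h] using this
  have hb : ∀ G : SimpleGraph (Fin n), IsUnipolar G →
      2 ^ ((n : ℝ) / 2) ≤ cnt fun S : Finset (Fin n) => IsUnipolar (addVertex G S) := by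
    intro G h
    have key : ∀ k : ℕ, n ≤ 2 * k → (2 : ℝ) ^ ((n : ℝ) / 2) ≤ 2 ^ k := by
      intro k hk
      rw [← Real.rpow_natCast]
      refine Real.rpow_le_rpow_of_exponent_le (by norm_num) ?_
      have : (n : ℝ) ≤ 2 * k := by exact_mod_cast hk
      linarith
    have hpow : ∀ A : Finset (Fin n), cnt (fun S : Finset (Fin n) => S ⊆ A) = 2 ^ A.card := by
      intro A
      have : {S : Finset (Fin n) | S ⊆ A} = (A.powerset : Set (Finset (Fin n))) := by ext; simp
      rw [cnt, this, Set.ncard_coe_finset, Finset.card_powerset]; push_cast; rfl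
    by_cases hc : n ≤ 2 * (ctr G).card
    · refine (key _ hc).trans ?_
      rw [← hpow]
      exact cnt_mono fun S hS => addVertex_unipolar_of_subset (hctr G h) (by exact_mod_cast hS)
    · have hc2 : n ≤ 2 * ((ctr G)ᶜ).card := by
        rw [Finset.card_compl, Fintype.card_fin]; omega
      refine (key _ hc2).trans ?_
      rw [← hpow]
      refine cnt_inj_le (fun S => Sᶜ) (fun S hS => ?_) (fun _ _ _ _ h => compl_injective h)
      refine addVertex_unipolar_of_superset (hctr G h) ?_
      have : ctr G ⊆ Sᶜ := by
        intro x hx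
        rw [Finset.mem_compl]
        exact fun h => Finset.mem_compl.1 (hS h) hx
      exact_mod_cast this
  have h1 : cnt (fun x : SimpleGraph (Fin n) × Finset (Fin n) =>
      IsUnipolar x.1 ∧ IsUnipolar (addVertex x.1 x.2)) ≤ numUni (n + 1) := by
    refine cnt_inj_le (fun x => addVertex x.1 x.2) (fun x hx => hx.2) ?_
    rintro ⟨G, S⟩ ⟨G', S'⟩ - - h
    simp only [Prod.mk.injEq]
    simp only at h
    constructor
    · ext x y
      rw [← addVertex_adj_castSucc G S, h, addVertex_adj_castSucc]
    · ext x
      have := addVertex_adj_last G S x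
      rw [h, addVertex_adj_last] at this
      simpa using this.symm
  refine le_trans ?_ h1
  have e1 : ∀ {β : Type} [Fintype β] (p : β → Prop), cnt p = ∑ x, if p x then (1 : ℝ) else 0 := by
    intro β _ p
    rw [Finset.sum_boole, cnt, Set.ncard_eq_toFinset_card']; congr 2; ext; simp
  have := Fintype.ofFinite (SimpleGraph (Fin n))
  rw [e1, Fintype.sum_prod_type, numUni, e1, Finset.mul_sum]
  refine Finset.sum_le_sum fun G _ => ?_
  by_cases h : IsUnipolar G
  · have := hb G h
    rw [e1] at this
    simpa [h] using this
  · simp [h]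

lemma numUni_add_ge (n k : ℕ) : 2 ^ ((k : ℝ) * n / 2) * numUni n ≤ numUni (n + k) := by
  induction k with
  | zero => simp
  | succ k ih =>
    refine le_trans ?_ (numUni_succ_ge (n + k))
    have h1 : (2 : ℝ) ^ (((k + 1 : ℕ) : ℝ) * n / 2) ≤
        2 ^ (((n + k : ℕ) : ℝ) / 2) * 2 ^ ((k : ℝ) * n / 2) := by
      rw [← Real.rpow_add (by norm_num)]
      refine Real.rpow_le_rpow_of_exponent_le (by norm_num) ?_
      push_cast
      nlinarith [(Nat.cast_nonneg k : (0 : ℝ) ≤ k)]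
    calc _ ≤ 2 ^ (((n + k : ℕ) : ℝ) / 2) * 2 ^ ((k : ℝ) * n / 2) * numUni n :=
          mul_le_mul_of_nonneg_right h1 (cnt_nonneg _)
      _ = 2 ^ (((n + k : ℕ) : ℝ) / 2) * (2 ^ ((k : ℝ) * n / 2) * numUni n) := by ring
      _ ≤ _ := mul_le_mul_of_nonneg_left ih (by positivity)

section Lower
variable {α β γ : Type*}

/-- The unipolar graph with centre `α` whose side cliques are the fibres of `Sum.elim id f`. -/
def uniGraph (f : γ → β) (g : α → β ⊕ γ → Prop) : SimpleGraph (α ⊕ (β ⊕ γ)) where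
  Adj u v := match u, v with
    | .inl x, .inl y => x ≠ y
    | .inl x, .inr v => g x v
    | .inr v, .inl x => g x v
    | .inr v, .inr w => v ≠ w ∧ Sum.elim id f v = Sum.elim id f w
  symm := ⟨by
    rintro (x | v) (y | w) h
    · exact h.symm
    · exact h
    · exact h
    · exact ⟨h.1.symm, h.2.symm⟩⟩
  loopless := ⟨by
    rintro (x | v) h
    · exact h rfl
    · exact h.1 rfl⟩

lemma uniGraph_unipolar (f : γ → β) (g : α → β ⊕ γ → Prop) : IsUnipolar (uniGraph f g) := by
  refine ⟨Set.range Sum.inl, isUnipolarArrangement_iff.2 ⟨?_, ?_⟩⟩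
  · rintro _ ⟨x, rfl⟩ _ ⟨y, rfl⟩ hxy
    exact fun h => hxy (by rw [h])
  · rintro (x | x) (y | y) (z | z) hx hy hz hxy hyz hxz
    all_goals first
      | exact absurd ⟨_, rfl⟩ hx
      | exact absurd ⟨_, rfl⟩ hy
      | exact absurd ⟨_, rfl⟩ hz
      | skip
    exact ⟨fun h => hxz (by rw [h]), hxy.2.trans hyz.2⟩

lemma uniGraph_injective {f f' : γ → β} {g g' : α → β ⊕ γ → Prop}
    (h : uniGraph f g = uniGraph f' g') : f = f' ∧ g = g' := by
  constructor
  · funext c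
    have h1 : (uniGraph f g).Adj (.inr (.inl (f c))) (.inr (.inr c)) := ⟨by simp, rfl⟩
    rw [h] at h1
    exact h1.2
  · funext x v
    have h1 : (uniGraph f g).Adj (.inl x) (.inr v) = (uniGraph f' g').Adj (.inl x) (.inr v) := by
      rw [h]
    exact h1

end Lower

lemma numUni_ge (a j q : ℕ) :
    (j : ℝ) ^ q * 2 ^ (a * (j + q)) ≤ numUni (a + (j + q)) := by
  have e : Fin (a + (j + q)) ≃ Fin a ⊕ (Fin j ⊕ Fin q) :=
    finSumFinEquiv.symm.trans (Equiv.sumCongr (Equiv.refl _) finSumFinEquiv.symm)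
  have h1 : cnt (fun _ : (Fin q → Fin j) × (Fin a → Fin j ⊕ Fin q → Prop) => True) ≤
      numUni (a + (j + q)) := by
    refine cnt_inj_le (fun x => (uniGraph x.1 x.2).comap e.toEmbedding)
      (fun x _ => (uniGraph_unipolar x.1 x.2).comap _) ?_
    rintro ⟨f, g⟩ ⟨f', g'⟩ - - h
    have : uniGraph f g = uniGraph f' g' := by
      ext x y
      have := congrArg (fun G => SimpleGraph.Adj G (e.symm x) (e.symm y)) h
      simpa using this
    obtain ⟨rfl, rfl⟩ := uniGraph_injective this
    rfl
  refine le_trans (le_of_eq ?_) h1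
  rw [cnt_true, Nat.card_eq_fintype_card]
  rw [mul_comm a, pow_mul]
  simp

/-! ### Deleting a bounded vertex set -/

/-- `G` and `G'` agree on all pairs not crossing the boundary of `Q`. -/
def Agree {V : Type*} (Q : Finset V) (G G' : SimpleGraph V) : Prop :=
  ∀ u v, (u ∈ Q ↔ v ∈ Q) → (G.Adj u v ↔ G'.Adj u v)

lemma cnt_agree_le {n k : ℕ} (D : Finset (Fin n) → SimpleGraph (Fin n) → Prop) {M : ℝ} (hM : 0 ≤ M)
    (h : ∀ (Q : Finset (Fin n)) G₀, Q.card = k → Cls G₀ → D Q G₀ →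
      cnt (fun G => Cls G ∧ D Q G ∧ Agree Q G₀ G) ≤ M) :
    cnt (fun G => Cls G ∧ ∃ Q : Finset (Fin n), Q.card = k ∧ D Q G) ≤
      (n : ℝ) ^ k * (2 ^ k ^ 2 * numCls (n - k) * M) := by
  have hcard : cnt (fun Q : Finset (Fin n) => Q.card = k) ≤ (n : ℝ) ^ k := by
    have e : {Q : Finset (Fin n) | Q.card = k} =
        ((Finset.powersetCard k Finset.univ : Finset (Finset (Fin n))) : Set (Finset (Fin n))) := by
      ext; simp
    rw [cnt, e, Set.ncard_coe_finset, Finset.card_powersetCard, Finset.card_univ, Fintype.card_fin]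
    exact_mod_cast Nat.choose_le_pow n k
  refine cnt_exists_le (fun Q : Finset (Fin n) => Q.card = k) (fun Q G => Cls G ∧ D Q G) ?_
    hcard ?_ ?_
  · have : 0 ≤ numCls (n - k) := cnt_nonneg _
    positivity
  · rintro G ⟨hG, Q, hQ, hD⟩
    exact ⟨Q, hQ, hG, hD⟩
  · intro Q hQ
    have hc : Fintype.card {x // x ∉ Q} = n - k := by
      rw [Fintype.card_subtype_compl (fun x => x ∈ Q)]; simp [hQ]
    let φ : Fin (n - k) ≃ {x // x ∉ Q} := (Fintype.equivFinOfCardEq hc).symm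
    let ψ : Fin (n - k) ↪ Fin n := φ.toEmbedding.trans (Function.Embedding.subtype _)
    have hψ : ∀ x, x ∉ Q → ∃ y, ψ y = x := fun x hx => ⟨φ.symm ⟨x, hx⟩, by simp [ψ]⟩
    have hI : cnt (fun x : (Q → Q → Prop) × SimpleGraph (Fin (n - k)) => True ∧ Cls x.2) ≤
        2 ^ k ^ 2 * numCls (n - k) := by
      rw [cnt_prod (fun _ : Q → Q → Prop => True) (fun G : SimpleGraph (Fin (n - k)) => Cls G),
        cnt_true,
        Nat.card_eq_fintype_card]
      refine le_of_eq ?_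
      congr 1
      simp [hQ, sq, pow_mul]
    refine cnt_exists_le _ (fun x G => (Cls G ∧ D Q G) ∧
      ((fun u v : Q => G.Adj u v), G.comap ψ) = x) hM hI ?_ ?_
    · rintro G hG
      exact ⟨_, ⟨trivial, hG.1.comap ψ⟩, hG, rfl⟩
    · rintro x -
      by_cases hex : ∃ G₀ : SimpleGraph (Fin n), (Cls G₀ ∧ D Q G₀) ∧
          ((fun u v : Q => G₀.Adj u v), G₀.comap ψ) = x
      · obtain ⟨G₀, hG₀, rfl⟩ := hex
        refine le_trans (cnt_mono ?_) (h Q G₀ hQ hG₀.1 hG₀.2)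
        rintro G ⟨hG, hx⟩
        refine ⟨hG.1, hG.2, fun u v huv => ?_⟩
        simp only [Prod.mk.injEq] at hx
        by_cases hu : u ∈ Q
        · have := congrFun (congrFun hx.1 ⟨u, hu⟩) ⟨v, huv.1 hu⟩
          exact iff_of_eq this.symm
        · obtain ⟨u, rfl⟩ := hψ u hu
          obtain ⟨v, rfl⟩ := hψ v (fun hv => hu (huv.2 hv))
          have := congrArg (fun H => SimpleGraph.Adj H u v) hx.2
          simpa using this.symm
      · push Not at hex
        have : {G : SimpleGraph (Fin n) | (Cls G ∧ D Q G) ∧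
          ((fun u v : Q => G.Adj u v), G.comap ψ) = x} = ∅ := by
          ext G
          simp only [Set.mem_ofPred_eq, Set.mem_empty_iff_false, iff_false, not_and]
          exact fun hG => hex G hG
        rw [cnt, this]
        simpa using hM

/-! ### Packings, generic pairs, induced paths -/

section Basic
variable {V : Type*}

/-- There are `r` disjoint `k`-tuples in `U` satisfying `R`. -/
def Pack (U : Finset V) (k : ℕ) (R : (Fin k → V) → Prop) (r : ℕ) : Prop :=
  ∃ e : Fin r × Fin k → V, Function.Injective e ∧ (∀ x, e x ∈ U) ∧ ∀ i, R fun l => e (i, l)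

lemma Pack.imp {U U' : Finset V} {k r : ℕ} {R R' : (Fin k → V) → Prop} (h : Pack U k R r)
    (hU : U ⊆ U') (hR : ∀ t, Function.Injective t → (∀ l, t l ∈ U) → R t → R' t) :
    Pack U' k R' r := by
  obtain ⟨e, he, hm, hr⟩ := h
  refine ⟨e, he, fun x => hU (hm x), fun i => hR _ (fun l l' hl => ?_) (fun l => hm _) (hr i)⟩
  simpa using he hl

lemma Pack.sub {U Q : Finset V} {k r : ℕ} {R : (Fin k → V) → Prop} (h : Pack U k R r) :
    Pack (U \ Q) k R (r - Q.card) := by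
  obtain ⟨e, he, hm, hr⟩ := h
  let B : Finset (Fin r) := Finset.univ.filter fun i => ∃ l, e (i, l) ∈ Q
  have hB : B.card ≤ Q.card := by
    have hl : ∀ i : B, ∃ l, e (i.1, l) ∈ Q := fun i => (Finset.mem_filter.1 i.2).2
    choose l hl using hl
    have : Fintype.card B ≤ Fintype.card Q :=
      Fintype.card_le_of_injective (fun i => (⟨e (i.1, l i), hl i⟩ : Q)) (by
        intro i j hij
        have := he (Subtype.mk.inj hij)
        exact Subtype.ext (Prod.mk.inj this).1)
    simpa using this
  have hc : r - Q.card ≤ Fintype.card (Bᶜ : Finset (Fin r)) := by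
    rw [Fintype.card_coe, Finset.card_compl, Fintype.card_fin]; omega
  obtain ⟨φ⟩ : Nonempty (Fin (r - Q.card) ↪ (Bᶜ : Finset (Fin r))) :=
    Function.Embedding.nonempty_of_card_le (by simpa using hc)
  refine ⟨fun x => e ((φ x.1).1, x.2), ?_, ?_, fun i => hr (φ i).1⟩
  · rintro ⟨i, l⟩ ⟨j, m⟩ h
    have := Prod.mk.inj (he h)
    have h1 : φ i = φ j := Subtype.ext this.1
    exact Prod.ext (φ.injective h1) this.2
  · rintro ⟨i, l⟩
    refine Finset.mem_sdiff.2 ⟨hm _, fun hq => ?_⟩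
    exact Finset.mem_compl.1 (φ i).2 (Finset.mem_filter.2 ⟨Finset.mem_univ _, l, hq⟩)

lemma exists_of_not_pack {U : Finset V} {k r : ℕ} {R : (Fin k → V) → Prop} (h : ¬ Pack U k R r) :
    ∃ Z ⊆ U, Z.card ≤ k * r ∧
      ∀ t : Fin k → V, Function.Injective t → (∀ l, t l ∈ U \ Z) → ¬ R t := by
  suffices H : ∀ r, Pack U k R r ∨ ∃ Z ⊆ U, Z.card ≤ k * r ∧
      ∀ t : Fin k → V, Function.Injective t → (∀ l, t l ∈ U \ Z) → ¬ R t from (H r).resolve_left h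
  intro r
  induction r with
  | zero =>
    left
    exact ⟨fun x => x.1.elim0, fun x => x.1.elim0, fun x => x.1.elim0, fun i => i.elim0⟩
  | succ r ih =>
    rcases ih with ⟨e, he, hm, hR⟩ | ⟨Z, hZ, hc, ht⟩
    swap
    · exact Or.inr ⟨Z, hZ, hc.trans (Nat.mul_le_mul_left _ (Nat.le_succ _)), ht⟩
    by_cases hex : ∃ t : Fin k → V, Function.Injective t ∧
      (∀ l, t l ∈ U \ Finset.univ.image e) ∧ R t
    · left
      obtain ⟨t, ht, htm, hRt⟩ := hex
      have hne : ∀ x l, e x ≠ t l := fun x l h =>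
        (Finset.mem_sdiff.1 (htm l)).2 (Finset.mem_image.2 ⟨x, Finset.mem_univ _, h⟩)
      refine ⟨fun x => Fin.lastCases (motive := fun _ => V) (t x.2) (fun i => e (i, x.2)) x.1,
        ?_, ?_, ?_⟩
      · rintro ⟨i, l⟩ ⟨j, m⟩ h
        induction i using Fin.lastCases <;> induction j using Fin.lastCases <;>
          simp only [Fin.lastCases_last, Fin.lastCases_castSucc] at h
        · rw [ht h]
        · exact absurd h.symm (hne _ _)
        · exact absurd h (hne _ _)
        · have := Prod.mk.inj (he h)
          rw [this.1, this.2]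
      · rintro ⟨i, l⟩
        induction i using Fin.lastCases <;> simp only [Fin.lastCases_last, Fin.lastCases_castSucc]
        · exact (Finset.mem_sdiff.1 (htm l)).1
        · exact hm _
      · intro i
        induction i using Fin.lastCases <;> simp only [Fin.lastCases_last, Fin.lastCases_castSucc]
        · exact hRt
        · exact hR _
    · right
      push Not at hex
      refine ⟨Finset.univ.image e, ?_, ?_, hex⟩
      · intro x hx
        obtain ⟨y, -, rfl⟩ := Finset.mem_image.1 hx
        exact hm y
      · refine Finset.card_image_le.trans ?_
        simp only [Finset.card_univ, Fintype.card_prod, Fintype.card_fin]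
        nlinarith

lemma pack_of_card {U : Finset V} {k r : ℕ} (h : r * k ≤ U.card) :
    Pack U k (fun _ => True) r := by
  obtain ⟨φ⟩ : Nonempty (Fin r × Fin k ↪ U) :=
    Function.Embedding.nonempty_of_card_le (by simpa using h)
  exact ⟨fun x => φ x, fun x y hxy => φ.injective (Subtype.ext hxy), fun x => (φ x).2,
    fun _ => trivial⟩

lemma pack_pair {P N : Finset V} {r : ℕ} (hd : Disjoint P N) (hP : r ≤ P.card) (hN : r ≤ N.card) :
    Pack (P ∪ N) 2 (fun t => t 0 ∈ P ∧ t 1 ∈ N) r := by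
  obtain ⟨φ⟩ : Nonempty (Fin r ↪ P) := Function.Embedding.nonempty_of_card_le (by simpa using hP)
  obtain ⟨ψ⟩ : Nonempty (Fin r ↪ N) := Function.Embedding.nonempty_of_card_le (by simpa using hN)
  have hne : ∀ i j, (φ i : V) ≠ ψ j := fun i j h =>
    Finset.disjoint_left.1 hd (φ i).2 (h ▸ (ψ j).2)
  refine ⟨fun x => if x.2 = 0 then φ x.1 else ψ x.1, ?_, ?_, fun i => ⟨by simp, by simp⟩⟩
  · rintro ⟨i, l⟩ ⟨j, m⟩ h
    fin_cases l <;> fin_cases m <;> simp at h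
    · rw [h]
    · exact absurd h (hne _ _)
    · exact absurd h.symm (hne _ _)
    · rw [h]
  · rintro ⟨i, l⟩
    fin_cases l <;> simp

/-- Every pattern occurs between any `r` disjoint `a`-tuples in `U₁` and any `r` disjoint
`b`-tuples in `U₂`. -/
def Gen (G : SimpleGraph V) (U₁ U₂ : Finset V) (a b r : ℕ) : Prop :=
  ∀ (e : Fin r × Fin a → V) (f : Fin r × Fin b → V), Function.Injective e → Function.Injective f →
    (∀ x, e x ∈ U₁) → (∀ x, f x ∈ U₂) → ∀ σ : Fin a → Fin b → Prop,
      ∃ i j, ∀ k l, G.Adj (e (i, k)) (f (j, l)) ↔ σ k l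

lemma Gen.mono {G : SimpleGraph V} {U₁ U₂ U₁' U₂' : Finset V} {a b r : ℕ} (h : Gen G U₁ U₂ a b r)
    (h1 : U₁' ⊆ U₁) (h2 : U₂' ⊆ U₂) : Gen G U₁' U₂' a b r :=
  fun e f he hf he' hf' => h e f he hf (fun x => h1 (he' x)) (fun x => h2 (hf' x))

lemma Gen.symm {G : SimpleGraph V} {U₁ U₂ : Finset V} {a b r : ℕ} (h : Gen G U₁ U₂ a b r) :
    Gen G U₂ U₁ b a r := by
  intro e f he hf he' hf' σ
  obtain ⟨i, j, hij⟩ := h f e hf he hf' he' (fun k l => σ l k)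
  exact ⟨j, i, fun k l => by rw [G.adj_comm]; exact hij l k⟩

lemma Gen.compl {G : SimpleGraph V} {U₁ U₂ : Finset V} {a b r : ℕ} (h : Gen G U₁ U₂ a b r)
    (hd : Disjoint U₁ U₂) : Gen Gᶜ U₁ U₂ a b r := by
  intro e f he hf he' hf' σ
  obtain ⟨i, j, hij⟩ := h e f he hf he' hf' (fun k l => ¬ σ k l)
  refine ⟨i, j, fun k l => ?_⟩
  have hne : e (i, k) ≠ f (j, l) := fun h => Finset.disjoint_left.1 hd (he' _) (h ▸ hf' _)
  rw [SimpleGraph.compl_adj, hij]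
  simp [hne]

lemma Gen.exists_pattern {G : SimpleGraph V} {U₁ U₂ : Finset V} {a b r : ℕ}
    (h : Gen G U₁ U₂ a b r) {R₁ : (Fin a → V) → Prop} {R₂ : (Fin b → V) → Prop}
    (h1 : Pack U₁ a R₁ r) (h2 : Pack U₂ b R₂ r) (σ : Fin a → Fin b → Prop) :
    ∃ s t, R₁ s ∧ R₂ t ∧ (∀ k, s k ∈ U₁) ∧ (∀ l, t l ∈ U₂) ∧
      Function.Injective s ∧ Function.Injective t ∧ ∀ k l, G.Adj (s k) (t l) ↔ σ k l := by
  obtain ⟨e, he, hem, hR1⟩ := h1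
  obtain ⟨f, hf, hfm, hR2⟩ := h2
  obtain ⟨i, j, hij⟩ := h e f he hf hem hfm σ
  exact ⟨_, _, hR1 i, hR2 j, fun k => hem _, fun l => hfm _, fun k k' h => by simpa using he h,
    fun k k' h => by simpa using hf h, hij⟩

def IsP3 (G : SimpleGraph V) (x y z : V) : Prop :=
  G.Adj x y ∧ G.Adj y z ∧ x ≠ z ∧ ¬ G.Adj x z

def P3Free (G : SimpleGraph V) (T : Finset V) : Prop :=
  ∀ x ∈ T, ∀ y ∈ T, ∀ z ∈ T, ¬ IsP3 G x y z

lemma P3Free.mono {G : SimpleGraph V} {T T' : Finset V} (h : P3Free G T) (hT : T' ⊆ T) :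
    P3Free G T' := fun x hx y hy z hz => h x (hT hx) y (hT hy) z (hT hz)

lemma P3Free.adj {G : SimpleGraph V} {T : Finset V} (h : P3Free G T) {x y z : V} (hx : x ∈ T)
    (hy : y ∈ T) (hz : z ∈ T) (hxy : G.Adj x y) (hyz : G.Adj y z) (hxz : x ≠ z) : G.Adj x z := by
  by_contra hn
  exact h x hx y hy z hz ⟨hxy, hyz, hxz, hn⟩

lemma IsP3.ne {G : SimpleGraph V} {x y z : V} (h : IsP3 G x y z) : x ≠ y ∧ y ≠ z ∧ x ≠ z :=
  ⟨h.1.ne, h.2.1.ne, h.2.2.1⟩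

lemma P3Free.of_not_pack {G : SimpleGraph V} {U : Finset V} {r : ℕ}
    (h : ¬ Pack U 3 (fun t => IsP3 G (t 0) (t 1) (t 2)) r) :
    ∃ Z ⊆ U, Z.card ≤ 3 * r ∧ P3Free G (U \ Z) := by
  obtain ⟨Z, hZ, hc, ht⟩ := exists_of_not_pack h
  refine ⟨Z, hZ, hc, fun x hx y hy z hz hP => ?_⟩
  refine ht ![x, y, z] ?_ ?_ hP
  · have := hP.ne
    intro i j hij
    fin_cases i <;> fin_cases j <;> simp_all
  · intro l
    fin_cases l <;> assumption

lemma clique_of_not_pack {G : SimpleGraph V} {U : Finset V} {r : ℕ}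
    (h : ¬ Pack U 2 (fun t => ¬ G.Adj (t 0) (t 1)) r) :
    ∃ Z ⊆ U, Z.card ≤ 2 * r ∧ G.IsClique ((U \ Z : Finset V) : Set V) := by
  obtain ⟨Z, hZ, hc, ht⟩ := exists_of_not_pack h
  refine ⟨Z, hZ, hc, fun x hx y hy hxy => ?_⟩
  by_contra hn
  refine ht ![x, y] ?_ ?_ hn
  · intro i j hij
    fin_cases i <;> fin_cases j <;> simp_all
  · intro l
    fin_cases l <;> assumption

lemma stable_of_not_pack {G : SimpleGraph V} {U : Finset V} {r : ℕ}
    (h : ¬ Pack U 2 (fun t => G.Adj (t 0) (t 1)) r) :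
    ∃ Z ⊆ U, Z.card ≤ 2 * r ∧ Gᶜ.IsClique ((U \ Z : Finset V) : Set V) := by
  obtain ⟨Z, hZ, hc, ht⟩ := exists_of_not_pack h
  refine ⟨Z, hZ, hc, fun x hx y hy hxy => ?_⟩
  rw [SimpleGraph.compl_adj]
  refine ⟨hxy, fun hn => ?_⟩
  refine ht ![x, y] ?_ ?_ hn
  · intro i j hij
    fin_cases i <;> fin_cases j <;> simp_all
  · intro l
    fin_cases l <;> assumption

lemma IsP3.c5 {G : SimpleGraph V} {x y z p q : V} (h : IsP3 G x y z) (hpq : G.Adj p q)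
    (h1 : G.Adj z p) (h2 : G.Adj x q) (h3 : ¬ G.Adj x p) (h4 : ¬ G.Adj y p) (h5 : ¬ G.Adj y q)
    (h6 : ¬ G.Adj z q) : C5 G x y z p q :=
  ⟨h.1, h.2.1, h1, hpq, h2.symm, h.2.2.2, h4, h6, fun h => h3 h.symm, fun h => h5 h.symm⟩

/-- The pattern between a path and an edge (or a co-path and a non-edge) creating a five-cycle. -/
def pathPattern : Fin 3 → Fin 2 → Prop := fun i j => (i = 2 ∧ j = 0) ∨ (i = 0 ∧ j = 1)

lemma IsP3.c5_of_pattern {G : SimpleGraph V} {s : Fin 3 → V} {t : Fin 2 → V}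
    (h : IsP3 G (s 0) (s 1) (s 2)) (hpq : G.Adj (t 0) (t 1))
    (hst : ∀ k l, G.Adj (s k) (t l) ↔ pathPattern k l) : ¬ C5Free G := by
  intro hf
  refine hf _ _ _ _ _ (h.c5 hpq ?_ ?_ ?_ ?_ ?_ ?_) <;> rw [hst] <;> simp [pathPattern]

end Basic

section SetCounts
variable {V : Type*}

lemma cnt_powerset (A : Finset V) : cnt (fun S : Finset V => S ⊆ A) = 2 ^ A.card := by
  have : {S : Finset V | S ⊆ A} = (A.powerset : Set (Finset V)) := by ext; simp
  rw [cnt, this, Set.ncard_coe_finset, Finset.card_powerset]; push_cast; rfl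

/-- `S` contains almost all or almost none of `U`. -/
def NearConst (U S : Finset V) (k : ℕ) : Prop := (U ∩ S).card ≤ k ∨ (U \ S).card ≤ k

variable [Fintype V]

lemma cnt_finset : cnt (fun _ : Finset V => True) = 2 ^ Fintype.card V := by
  have := cnt_powerset (Finset.univ : Finset V)
  simpa using this

lemma cnt_small_le_pow (x : ℝ) (hx : 0 < x) (hx1 : x ≤ 1) (k : ℕ) :
    cnt (fun S : Finset V => S.card ≤ k) * x ^ k ≤ (x + 1) ^ Fintype.card V := by
  have e : cnt (fun S : Finset V => S.card ≤ k) =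
      ((Finset.univ.filter fun S : Finset V => S.card ≤ k).card : ℝ) := by
    rw [cnt, Set.ncard_eq_toFinset_card']; congr 2; ext; simp
  rw [e, ← nsmul_eq_mul, ← Finset.card_univ]
  have h1 := Finset.card_nsmul_le_sum (Finset.univ.filter fun S : Finset V => S.card ≤ k)
    (fun S => x ^ S.card) (x ^ k) (fun S hS =>
      pow_le_pow_of_le_one hx.le hx1 (Finset.mem_filter.1 hS).2)
  refine h1.trans ?_
  have h2 := Finset.sum_pow_mul_eq_add_pow x 1 (Finset.univ : Finset V)
  rw [← h2]
  simp only [one_pow, mul_one, Finset.powerset_univ]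
  exact Finset.sum_le_sum_of_subset_of_nonneg (Finset.filter_subset _ _)
    (fun _ _ _ => by positivity)

/-- An upper bound for the number of subsets of size at most `k` of an `n`-set. -/
def ballBound (q n k : ℕ) : ℝ := 2 ^ ((2 : ℝ) * n / 2 ^ q + q * k)

lemma ballBound_pos (q n k : ℕ) : 0 < ballBound q n k := by unfold ballBound; positivity

lemma one_le_ballBound (q n k : ℕ) : 1 ≤ ballBound q n k :=
  Real.one_le_rpow (by norm_num) (by positivity)

lemma cnt_small_le (q k : ℕ) :
    cnt (fun S : Finset V => S.card ≤ k) ≤ ballBound q (Fintype.card V) k := by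
  have h := cnt_small_le_pow (V := V) ((1 / 2) ^ q) (by positivity)
      (pow_le_one₀ (by norm_num) (by norm_num)) k
  have h1 : ((1 / 2 : ℝ) ^ q + 1) ≤ 2 ^ ((2 : ℝ) / 2 ^ q) := by
    have h2 : (1 / 2 : ℝ) ^ q + 1 ≤ Real.exp ((1 / 2) ^ q) := Real.add_one_le_exp _
    refine h2.trans ?_
    rw [Real.rpow_def_of_pos (by norm_num)]
    refine Real.exp_le_exp.2 ?_
    have : (1 / 2 : ℝ) < Real.log 2 := by have := Real.log_two_gt_d9; linarith
    rw [div_pow, one_pow, mul_div_assoc', div_le_div_iff_of_pos_right (by positivity)]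
    linarith
  have h3 : ((1 / 2 : ℝ) ^ q + 1) ^ Fintype.card V ≤ 2 ^ ((2 : ℝ) * Fintype.card V / 2 ^ q) := by
    refine (pow_le_pow_left₀ (by positivity) h1 _).trans (le_of_eq ?_)
    rw [← Real.rpow_natCast, ← Real.rpow_mul (by norm_num)]
    ring_nf
  have h4 : (0 : ℝ) < ((1 / 2) ^ q) ^ k := by positivity
  have h5 := h.trans h3
  rw [← le_div_iff₀ h4] at h5
  refine h5.trans (le_of_eq ?_)
  unfold ballBound
  rw [Real.rpow_add (by norm_num), div_eq_mul_inv]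
  congr 1
  rw [← pow_mul, ← inv_pow]
  norm_num
  exact_mod_cast (Real.rpow_natCast 2 (q * k)).symm

lemma cnt_ball_le (q k : ℕ) (T : Finset V) :
    cnt (fun S : Finset V => (symmDiff S T).card ≤ k) ≤ ballBound q (Fintype.card V) k := by
  refine le_trans ?_ (cnt_small_le q k)
  exact cnt_inj_le (fun S => symmDiff S T) (fun _ h => h)
    (fun S S' _ _ h => symmDiff_left_injective T h)

lemma cnt_nearConst_le (q k : ℕ) (U X : Finset V) :
    cnt (fun S : Finset V => S ⊆ X ∧ NearConst U S k) ≤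
      2 ^ (X \ U).card * (2 * ballBound q (Fintype.card V) k) := by
  have h0 : cnt (fun S : Finset V => S ⊆ X ∧ NearConst U S k) ≤
      cnt (fun x : Finset V × Finset V => x.1 ⊆ X \ U ∧ (x.2 ⊆ U ∧ NearConst U x.2 k)) := by
    refine cnt_inj_le (fun S => (S \ U, S ∩ U)) ?_ ?_
    · rintro S ⟨hS, hn⟩
      refine ⟨Finset.sdiff_subset_sdiff hS le_rfl, Finset.inter_subset_right, ?_⟩
      have e1 : U ∩ (S ∩ U) = U ∩ S := by grind
      have e2 : U \ (S ∩ U) = U \ S := by grind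
      unfold NearConst at hn ⊢
      rwa [e1, e2]
    · intro S S' _ _ h
      simp only [Prod.mk.injEq] at h
      rw [← Finset.sdiff_union_inter S U, h.1, h.2, Finset.sdiff_union_inter]
  rw [cnt_prod (fun x : Finset V => x ⊆ X \ U) (fun x => x ⊆ U ∧ NearConst U x k),
    cnt_powerset] at h0
  refine h0.trans (mul_le_mul_of_nonneg_left ?_ (by positivity))
  have h1 : cnt (fun S : Finset V => S ⊆ U ∧ NearConst U S k) ≤
      cnt (fun S : Finset V => S.card ≤ k ∨ (symmDiff S U).card ≤ k) := by
    refine cnt_mono fun S hS => ?_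
    rcases hS.2 with h | h
    · left; rwa [Finset.inter_eq_right.2 hS.1] at h
    · right
      have : symmDiff S U = U \ S := by
        rw [symmDiff_def, Finset.sdiff_eq_empty_iff_subset.2 hS.1]; simp
      rwa [this]
  refine h1.trans ((cnt_or_le _ _).trans ?_)
  linarith [cnt_small_le (V := V) q k, cnt_ball_le q k U]

end SetCounts

section RepFunctions
variable {V : Type*} [Fintype V]

/-- Normal form of functions choosing a representative of each part of `T`, the
homogeneous set `Z ⊆ T` being either inside one part or a transversal. -/
def RepFun (T Z : Finset V) (f : V → V) : Prop :=
  (∀ v, v ∉ T → f v = v) ∧ ((∀ v ∈ Z, f v = v) ∨ ∃ z, ∀ v ∈ Z, f v = z)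

lemma cnt_repFun_le (T Z : Finset V) (hZ : Z ⊆ T) [Nonempty V] :
    cnt (RepFun T Z) ≤ 2 * (Fintype.card V : ℝ) ^ (T.card - Z.card + 1) := by
  have hcard : Fintype.card (T \ Z : Finset V) = T.card - Z.card := by
    rw [Fintype.card_coe, Finset.card_sdiff_of_subset hZ]
  have hn : (1 : ℝ) ≤ Fintype.card V := by exact_mod_cast Fintype.card_pos
  have h0 : cnt (RepFun T Z) ≤ cnt (fun f : V → V => (∀ v, v ∉ T → f v = v) ∧ ∀ v ∈ Z, f v = v) +
      cnt (fun f : V → V => (∀ v, v ∉ T → f v = v) ∧ ∃ z, ∀ v ∈ Z, f v = z) := by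
    refine (cnt_mono ?_).trans (cnt_or_le _ _)
    rintro f ⟨h, h' | h'⟩
    · exact Or.inl ⟨h, h'⟩
    · exact Or.inr ⟨h, h'⟩
  have h1 : cnt (fun f : V → V => (∀ v, v ∉ T → f v = v) ∧ ∀ v ∈ Z, f v = v) ≤
      (Fintype.card V : ℝ) ^ (T.card - Z.card) := by
    have : cnt (fun _ : (T \ Z : Finset V) → V => True) =
        (Fintype.card V : ℝ) ^ (T.card - Z.card) := by
      rw [cnt_true, Nat.card_eq_fintype_card, Fintype.card_fun, hcard]; push_cast; rfl
    rw [← this]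
    refine cnt_inj_le (fun f v => f v) (fun _ _ => trivial) ?_
    rintro f g ⟨hf, hf'⟩ ⟨hg, hg'⟩ h
    funext v
    by_cases hv : v ∈ T
    · by_cases hz : v ∈ Z
      · rw [hf' v hz, hg' v hz]
      · exact congrFun h ⟨v, Finset.mem_sdiff.2 ⟨hv, hz⟩⟩
    · rw [hf v hv, hg v hv]
  have h2 : cnt (fun f : V → V => (∀ v, v ∉ T → f v = v) ∧ ∃ z, ∀ v ∈ Z, f v = z) ≤
      (Fintype.card V : ℝ) ^ (T.card - Z.card + 1) := by
    have : cnt (fun _ : V × ((T \ Z : Finset V) → V) => True) =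
        (Fintype.card V : ℝ) ^ (T.card - Z.card + 1) := by
      rw [cnt_true, Nat.card_eq_fintype_card, Fintype.card_prod, Fintype.card_fun, hcard, pow_succ,
        mul_comm]
      push_cast; rfl
    rw [← this]
    refine cnt_inj_le (fun f => (if h : ∃ z, ∀ v ∈ Z, f v = z then h.choose else
      Classical.arbitrary V, fun v => f v))
      (fun _ _ => trivial) ?_
    rintro f g ⟨hf, hf'⟩ ⟨hg, hg'⟩ h
    simp only [hf', hg', dif_pos, Prod.mk.injEq] at h
    funext v
    by_cases hv : v ∈ T
    · by_cases hz : v ∈ Z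
      · rw [hf'.choose_spec v hz, hg'.choose_spec v hz, h.1]
      · exact congrFun h.2 ⟨v, Finset.mem_sdiff.2 ⟨hv, hz⟩⟩
    · rw [hf v hv, hg v hv]
  have h3 : (Fintype.card V : ℝ) ^ (T.card - Z.card) ≤
      (Fintype.card V : ℝ) ^ (T.card - Z.card + 1) :=
    pow_le_pow_right₀ hn (Nat.le_succ _)
  linarith

end RepFunctions

section RepExists
variable {V : Type*}

lemma P3Free.exists_repFun {G : SimpleGraph V} {T Z : Finset V} (h : P3Free G T) (hZ : Z ⊆ T)
    (hh : Homog G Z) :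
    ∃ f, RepFun T Z f ∧ ∀ u ∈ T, ∀ v ∈ T, (G.Adj u v ↔ u ≠ v ∧ f u = f v) := by
  rcases isEmpty_or_nonempty V with hV | hV
  · exact ⟨id, ⟨fun v => isEmptyElim v, Or.inl fun v => isEmptyElim v⟩, fun v => isEmptyElim v⟩
  let c : Finset V → V := fun S => if h : S.Nonempty then h.choose else Classical.arbitrary V
  have hc : ∀ S : Finset V, S.Nonempty → c S ∈ S := fun S hS => by
    simp only [c, hS, dif_pos]; exact hS.choose_spec
  let cls : V → Finset V := fun v => T.filter fun w => w = v ∨ G.Adj v w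
  have hcls : ∀ u ∈ T, ∀ v ∈ T, G.Adj u v → cls u = cls v := by
    have key : ∀ u ∈ T, ∀ v ∈ T, G.Adj u v → cls u ⊆ cls v := by
      intro u hu v hv huv w hw
      simp only [cls, Finset.mem_filter] at hw ⊢
      refine ⟨hw.1, ?_⟩
      by_cases hwv : w = v
      · exact Or.inl hwv
      right
      rcases hw.2 with rfl | hw2
      · exact huv.symm
      · exact h.adj hv hu hw.1 huv.symm hw2 (Ne.symm hwv)
    exact fun u hu v hv huv => (key u hu v hv huv).antisymm (key v hv u hu huv.symm)
  have hself : ∀ v ∈ T, v ∈ cls v := fun v hv => by simp [cls, hv]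
  let g : V → V := fun v => if (cls v ∩ Z).Nonempty then c (cls v ∩ Z) else c (cls v)
  have hg : ∀ v ∈ T, g v ∈ cls v := by
    intro v hv
    simp only [g]
    split_ifs with hn
    · exact (Finset.mem_inter.1 (hc _ hn)).1
    · exact hc _ ⟨v, hself v hv⟩
  refine ⟨fun v => if v ∈ T then g v else v, ⟨fun v hv => by simp [hv], ?_⟩, ?_⟩
  · rcases hh with hh | hh
    · right
      refine ⟨c Z, fun v hv => ?_⟩
      have : cls v ∩ Z = Z := by
        refine Finset.inter_eq_right.2 fun w hw => ?_
        simp only [cls, Finset.mem_filter]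
        refine ⟨hZ hw, ?_⟩
        by_cases hwv : w = v
        · exact Or.inl hwv
        · exact Or.inr (hh hv hw (Ne.symm hwv))
      simp only [hZ hv, if_true, g, this]
      rw [if_pos ⟨v, hv⟩]
    · left
      intro v hv
      have : cls v ∩ Z = {v} := by
        ext w
        simp only [cls, Finset.mem_inter, Finset.mem_filter, Finset.mem_singleton]
        constructor
        · rintro ⟨⟨-, h1 | h1⟩, h2⟩
          · exact h1
          · by_contra hne
            have := hh hv h2 (Ne.symm hne)
            rw [SimpleGraph.compl_adj] at this
            exact this.2 h1
        · rintro rfl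
          exact ⟨⟨hZ hv, Or.inl rfl⟩, hv⟩
      simp only [hZ hv, if_true, g, this]
      rw [if_pos ⟨v, by simp⟩]
      simpa using hc {v} ⟨v, by simp⟩
  · intro u hu v hv
    simp only [hu, hv, if_true]
    constructor
    · intro huv
      refine ⟨huv.ne, ?_⟩
      simp only [g, hcls u hu v hv huv]
    · rintro ⟨hne, huv⟩
      have h1 := hg u hu
      have h2 := hg v hv
      rw [← huv] at h2
      simp only [cls, Finset.mem_filter] at h1 h2
      rcases h1 with ⟨h0, h1 | h1⟩ <;> rcases h2 with ⟨-, h2 | h2⟩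
      · exact absurd (h1.symm.trans h2) hne
      · rw [h1] at h2; exact h2.symm
      · rw [h2] at h1; exact h1
      · exact h.adj hu h0 hv h1 h2.symm hne

end RepExists

section Fibres

/-- Neighbours of `q` in `S`. -/
def nb {V : Type*} (G : SimpleGraph V) (q : V) (S : Finset V) : Finset V := S.filter (G.Adj q)

lemma mem_nb {V : Type*} {G : SimpleGraph V} {q v : V} {S : Finset V} :
    v ∈ nb G q S ↔ v ∈ S ∧ G.Adj q v := Finset.mem_filter

lemma nb_subset {V : Type*} (G : SimpleGraph V) (q : V) (S : Finset V) : nb G q S ⊆ S :=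
  Finset.filter_subset _ _

lemma Agree.ext {V : Type*} {Q : Finset V} {G₀ G G' : SimpleGraph V} (h : Agree Q G₀ G)
    (h' : Agree Q G₀ G') (hc : ∀ q ∈ Q, ∀ v, v ∉ Q → (G.Adj q v ↔ G'.Adj q v)) : G = G' := by
  ext u v
  by_cases hu : u ∈ Q <;> by_cases hv : v ∈ Q
  · exact (h u v (by simp [hu, hv])).symm.trans (h' u v (by simp [hu, hv]))
  · exact hc u hu v hv
  · rw [G.adj_comm, G'.adj_comm]; exact hc v hv u hu
  · exact (h u v (by simp [hu, hv])).symm.trans (h' u v (by simp [hu, hv]))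

lemma cnt_fibre_le {V : Type*} [Fintype V] (Q S₁ S₂ : Finset V)
    (hcov : ∀ v, v ∉ Q → v ∈ S₁ ∨ v ∈ S₂)
    (G₀ : SimpleGraph V) (F : Finset V → Prop) (R : (Q → S₂ → Prop) → Prop) :
    cnt (fun G => Agree Q G₀ G ∧ (∀ q ∈ Q, F (nb G q S₁)) ∧ R (fun q v => G.Adj q v)) ≤
      cnt F ^ Q.card * cnt R := by
  have h1 : cnt (fun G => Agree Q G₀ G ∧ (∀ q ∈ Q, F (nb G q S₁)) ∧ R (fun q v => G.Adj q v)) ≤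
      cnt (fun x : (Q → Finset V) × (Q → S₂ → Prop) => (∀ q, F (x.1 q)) ∧ R x.2) := by
    refine cnt_inj_le (fun G => (fun q => nb G q S₁, fun q v => G.Adj q v)) ?_ ?_
    · rintro G ⟨-, h1, h2⟩
      exact ⟨fun q => h1 q q.2, h2⟩
    · rintro G G' ⟨h1, -⟩ ⟨h2, -⟩ h
      simp only [Prod.mk.injEq] at h
      refine h1.ext h2 fun q hq v hv => ?_
      rcases hcov v hv with hv1 | hv2
      · have := congrFun h.1 ⟨q, hq⟩
        have := Finset.ext_iff.1 this v
        simpa [mem_nb, hv1] using this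
      · exact iff_of_eq (congrFun (congrFun h.2 ⟨q, hq⟩) ⟨v, hv2⟩)
  rw [cnt_prod (fun x : Q → Finset V => ∀ q, F (x q)) R] at h1
  refine h1.trans (mul_le_mul_of_nonneg_right ?_ (cnt_nonneg _))
  simpa using cnt_pi_le (fun (_ : Q) => F) (fun _ => le_rfl)

end Fibres

/-! ### Template bipartite patterns and shattered sets -/

/-- Every `2 × 2` pattern appears in `H` on any `s` disjoint row pairs and `s` disjoint column
pairs. -/
def Generic {ι κ : Type*} (s : ℕ) (H : ι → κ → Prop) : Prop :=
  ∀ (e : Fin s × Fin 2 → ι) (f : Fin s × Fin 2 → κ), Function.Injective e → Function.Injective f →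
    ∀ σ : Fin 2 → Fin 2 → Prop, ∃ i j, ∀ k l, H (e (i, k)) (f (j, l)) ↔ σ k l

lemma exists_generic (k : ℕ) (hk : 1 ≤ k) :
    ∃ H : Fin (2 ^ k) → Fin ((2 ^ k) ^ 2) → Prop, Generic (400 * k) H := by
  by_contra hcon
  push Not at hcon
  set t := 2 ^ k with ht
  set s := 400 * k with hs
  have h := cnt_exists_le (p := fun _ : Fin t → Fin (t ^ 2) → Prop => True)
    (fun x : ((Fin s × Fin 2 → Fin t) × (Fin s × Fin 2 → Fin (t ^ 2))) × (Fin 2 → Fin 2 → Prop) =>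
      Function.Injective x.1.1 ∧ Function.Injective x.1.2)
    (fun x g => ∀ i j, ¬ ∀ k l, (g (x.1.1 (i, k)) (x.1.2 (j, l)) ↔ x.2 k l))
    (K := 2 ^ (6 * k * s + 4)) (M := 2 ^ (((t * t ^ 2 : ℕ) : ℝ) - (s * s : ℝ) / 50)) (by positivity)
    ?_ ?_ ?_
  · have e0 : cnt (fun _ : Fin t → Fin (t ^ 2) → Prop => True) = 2 ^ ((t * t ^ 2 : ℕ) : ℝ) := by
      rw [cnt_true, Nat.card_eq_fintype_card, Fintype.card_fun, Fintype.card_fun, Fintype.card_prop,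
        Fintype.card_fin, Fintype.card_fin, Real.rpow_natCast, ← pow_mul, mul_comm]
      push_cast; rfl
    rw [e0, ← Real.rpow_natCast, ← Real.rpow_add (by norm_num),
      Real.rpow_le_rpow_left_iff (by norm_num)] at h
    rw [hs] at h
    push_cast at h
    have hk' : (1 : ℝ) ≤ k := by exact_mod_cast hk
    nlinarith
  · refine (cnt_le_card _).trans (le_of_eq ?_)
    rw [Nat.card_eq_fintype_card]
    simp only [Fintype.card_prod, Fintype.card_fun, Fintype.card_prop, Fintype.card_fin]
    rw [ht]
    push_cast
    simp only [← pow_mul, ← pow_add]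
    rw [show (16:ℝ) = 2 ^ 4 by norm_num, ← pow_add]
    congr 1
    ring
  · intro g _
    have := hcon g
    simp only [Generic] at this
    push Not at this
    obtain ⟨e, f, he, hf, σ, h⟩ := this
    refine ⟨((e, f), σ), ⟨he, hf⟩, fun i j hij => ?_⟩
    obtain ⟨k, l, hkl⟩ := h i j
    have := hij k l
    tauto
  · rintro ⟨⟨e, f⟩, σ⟩ ⟨he, hf⟩
    have := cnt_avoid_grid (by norm_num) e he f hf σ
    simpa using this

lemma sum_pow_le (m k : ℕ) (hm : 1 ≤ m) : ∑ i ∈ Finset.range k, m ^ i ≤ (m + 1) ^ k := by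
  induction k with
  | zero => simp
  | succ k ih =>
    rw [Finset.sum_range_succ, pow_succ, mul_add, mul_one]
    have : m ^ k ≤ (m + 1) ^ k * m :=
      (Nat.pow_le_pow_left (Nat.le_succ m) k).trans (Nat.le_mul_of_pos_right _ hm)
    omega

lemma exists_shatters {V : Type*} {X : Finset V} {F : Finset (Finset V)} (hF : ∀ u ∈ F, u ⊆ X)
    (hX : 1 ≤ X.card) {M : ℕ} (h : (X.card + 1) ^ M < F.card) :
    ∃ S ⊆ X, S.card = M ∧ F.Shatters S := by
  by_contra hcon
  push Not at hcon
  have h1 := F.card_le_card_shatterer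
  have hsub : F.shatterer ⊆ (Finset.range M).biUnion fun i => X.powersetCard i := by
    intro S hS
    have hS' := Finset.mem_shatterer.1 hS
    obtain ⟨u, hu, hSu⟩ := hS'.exists_superset
    have hSX := hSu.trans (hF u hu)
    simp only [Finset.mem_biUnion, Finset.mem_range, Finset.mem_powersetCard]
    refine ⟨S.card, ?_, hSX, rfl⟩
    by_contra hlt
    obtain ⟨S', hS'S, hc⟩ := Finset.exists_subset_card_eq (not_lt.1 hlt)
    exact hcon S' (hS'S.trans hSX) hc (hS'.mono_right hS'S)
  have h2 := (Finset.card_le_card hsub).trans Finset.card_biUnion_le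
  simp only [Finset.card_powersetCard] at h2
  have h3 : ∑ i ∈ Finset.range M, X.card.choose i ≤ ∑ i ∈ Finset.range M, X.card ^ i :=
    Finset.sum_le_sum fun i _ => Nat.choose_le_pow _ _
  have := sum_pow_le X.card M hX
  omega

variable {V : Type*} [Fintype V]

lemma exists_homog_gen {G : SimpleGraph V} (hG : Cls G) {t s : ℕ} {H : Fin t → Fin (t ^ 2) → Prop}
    (hH : Generic s H) {X : Finset V} (hX : Homog G X) (hX1 : 1 ≤ X.card)
    (htr : (X.card + 1) ^ (t + t ^ 2) < ((Finset.univ \ X).image fun v => nb G v X).card) :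
    ∃ A B : Finset V, Disjoint A B ∧ A.card = t ∧ B.card = t ∧ Homog G A ∧ Homog G B ∧
      Gen G A B 2 2 s := by
  obtain ⟨S, hSX, hS, hsh⟩ := exists_shatters (X := X)
    (by intro u hu; obtain ⟨v, -, rfl⟩ := Finset.mem_image.1 hu; exact nb_subset _ _ _) hX1 htr
  obtain ⟨φ⟩ : Nonempty (Fin t ⊕ Fin (t ^ 2) ≃ S) := Fintype.card_eq.1 (by simp [hS])
  have hv : ∀ j : Fin (t ^ 2), ∃ v, v ∉ X ∧ (∀ i, G.Adj v (φ (.inl i)) ↔ H i j) ∧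
      ∀ j', G.Adj v (φ (.inr j')) ↔ j' = j := by
    intro j
    let P : Finset V := (Finset.univ.filter fun x : Fin t ⊕ Fin (t ^ 2) =>
      Sum.elim (fun i => H i j) (fun j' => j' = j) x).image fun x => (φ x : V)
    have hφ : Function.Injective fun x => (φ x : V) := Subtype.val_injective.comp φ.injective
    have hP : P ⊆ S := by
      intro x hx
      obtain ⟨y, -, rfl⟩ := Finset.mem_image.1 hx
      exact (φ y).2
    obtain ⟨u, hu, hSu⟩ := hsh hP
    obtain ⟨v, hv, rfl⟩ := Finset.mem_image.1 hu
    have key : ∀ x, G.Adj v (φ x) ↔ Sum.elim (fun i => H i j) (fun j' => j' = j) x := by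
      intro x
      have h1 : (φ x : V) ∈ P ↔ Sum.elim (fun i => H i j) (fun j' => j' = j) x := by
        constructor
        · intro h
          obtain ⟨y, hy, hyx⟩ := Finset.mem_image.1 h
          rw [← hφ hyx]
          exact (Finset.mem_filter.1 hy).2
        · exact fun h => Finset.mem_image.2 ⟨x, Finset.mem_filter.2 ⟨Finset.mem_univ _, h⟩, rfl⟩
      rw [← h1, ← hSu, Finset.mem_inter, mem_nb]
      exact ⟨fun h => ⟨(φ x).2, hSX (φ x).2, h⟩, fun h => h.2.2⟩
    exact ⟨v, (Finset.mem_sdiff.1 hv).2, fun i => key _, fun j' => key _⟩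
  choose v hvX hvH hvE using hv
  have hvinj : Function.Injective v := fun j j' h => by
    have := (hvE j j).2 rfl
    rw [h] at this
    exact (hvE j' j).1 this
  obtain ⟨Y, hY, hYh, hYc⟩ := hG.2 (Finset.univ.image v)
  rw [Finset.card_image_of_injective _ hvinj, Finset.card_univ, Fintype.card_fin] at hYc
  obtain ⟨B, hBY, hB⟩ := Finset.exists_subset_card_eq (s := Y) (n := t)
    (by by_contra hlt; nlinarith)
  have hAi : Function.Injective fun i : Fin t => (φ (.inl i) : V) :=
    Subtype.val_injective.comp (φ.injective.comp Sum.inl_injective)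
  refine ⟨Finset.univ.image fun i : Fin t => (φ (.inl i) : V), B, ?_, ?_, hB, hX.subset ?_,
    hYh.subset hBY, ?_⟩
  · rw [Finset.disjoint_left]
    intro a ha hb
    obtain ⟨i, -, rfl⟩ := Finset.mem_image.1 ha
    obtain ⟨j, -, hj⟩ := Finset.mem_image.1 (hY (hBY hb))
    exact hvX j (hj ▸ hSX (φ _).2)
  · rw [Finset.card_image_of_injective _ hAi, Finset.card_univ, Fintype.card_fin]
  · intro x hx
    obtain ⟨i, -, rfl⟩ := Finset.mem_image.1 hx
    exact hSX (φ _).2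
  · intro e f he hf heA hfB σ
    have h1 : ∀ x, ∃ i, (φ (.inl i) : V) = e x := fun x => by
      obtain ⟨i, -, hi⟩ := Finset.mem_image.1 (heA x)
      exact ⟨i, hi⟩
    have h2 : ∀ x, ∃ j, v j = f x := fun x => by
      obtain ⟨j, -, hj⟩ := Finset.mem_image.1 (hY (hBY (hfB x)))
      exact ⟨j, hj⟩
    choose e' he' using h1
    choose f' hf' using h2
    obtain ⟨i, j, hij⟩ := hH e' f' (fun x y h => he (by rw [← he', ← he', h]))
      (fun x y h => hf (by rw [← hf', ← hf', h])) σ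
    refine ⟨i, j, fun k l => ?_⟩
    rw [← he', ← hf', G.adj_comm, hvH, hij]

/-! ### Vertices against a generic pair, and the resulting decomposition -/

section Decomposition
variable {V : Type*}

lemma nb_compl {G : SimpleGraph V} {c : V} {A : Finset V} (hc : c ∉ A) :
    nb Gᶜ c A = A \ nb G c A := by
  ext v
  simp only [mem_nb, Finset.mem_sdiff, SimpleGraph.compl_adj]
  constructor
  · rintro ⟨h1, h2, h3⟩
    exact ⟨h1, fun h => h3 h.2⟩
  · rintro ⟨h1, h2⟩
    exact ⟨h1, fun h => hc (h ▸ h1), fun h => h2 ⟨h1, h⟩⟩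

lemma nearConst_nb_compl {G : SimpleGraph V} {c : V} {A : Finset V} {k : ℕ} (hc : c ∉ A) :
    NearConst A (nb Gᶜ c A) k ↔ NearConst A (nb G c A) k := by
  rw [nb_compl hc, NearConst, NearConst, or_comm]
  have h := nb_subset G c A
  have h1 : A \ (A \ nb G c A) = A ∩ nb G c A := by grind
  have h2 : A ∩ (A \ nb G c A) = A \ nb G c A := by grind
  rw [h1, h2]

lemma nearConst_of_isClique {G : SimpleGraph V} {A B : Finset V} {s : ℕ}
    (hA : G.IsClique (A : Set V)) (hB : Homog G B) (hgen : Gen G A B 2 2 s) (hf : C5Free G) {c : V} :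
    NearConst A (nb G c A) (2 * s) ∨ NearConst B (nb G c B) (2 * s) := by
  by_contra hcon
  simp only [NearConst, not_or, not_le] at hcon
  obtain ⟨⟨hA1, hA2⟩, hB1, hB2⟩ := hcon
  rw [Finset.inter_eq_right.2 (nb_subset _ _ _)] at hA1 hB1
  rcases hB with hB | hB
  · obtain ⟨a, b, ha, hb, ham, hbm, hai, hbi, hp⟩ := (hgen.mono
      (Finset.union_subset (nb_subset G c A) Finset.sdiff_subset)
      (Finset.union_subset (nb_subset G c B) Finset.sdiff_subset)).exists_pattern
      (pack_pair (Finset.disjoint_sdiff) (by omega) (by omega))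
      (pack_pair (Finset.disjoint_sdiff) (by omega) (by omega)) (fun k l => k = 1 ∧ l = 1)
    simp only [mem_nb, Finset.mem_sdiff, not_and] at ha hb
    refine hf c (a 0) (a 1) (b 1) (b 0) ⟨ha.1.2, hA ha.1.1 ha.2.1 (hai.ne (by simp)),
      (hp _ _).2 (by simp), hB hb.2.1 hb.1.1 (hbi.ne (by simp)), hb.1.2.symm, ha.2.2 ha.2.1,
      fun h => by simpa using (hp _ _).1 h, fun h => by simpa using (hp _ _).1 h,
      fun h => hb.2.2 hb.2.1 h.symm, fun h => by simpa using (hp _ _).1 h.symm⟩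
  · obtain ⟨a, b, -, -, ham, hbm, hai, hbi, hp⟩ := (hgen.mono
      (Finset.sdiff_subset (s := A) (t := nb G c A)) (nb_subset G c B)).exists_pattern
      (pack_of_card (by omega)) (pack_of_card (by omega)) (fun k l => k = l)
    simp only [mem_nb, Finset.mem_sdiff, not_and] at ham hbm
    have hBn := hB (hbm 0).1 (hbm 1).1 (hbi.ne (by simp))
    rw [SimpleGraph.compl_adj] at hBn
    refine hf c (b 0) (a 0) (a 1) (b 1) ⟨(hbm 0).2, ((hp _ _).2 rfl).symm,
      hA (ham 0).1 (ham 1).1 (hai.ne (by simp)), (hp _ _).2 rfl, (hbm 1).2.symm,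
      (ham 0).2 (ham 0).1, fun h => by simpa using (hp _ _).1 h.symm,
      fun h => by simpa using (hp _ _).1 h, fun h => (ham 1).2 (ham 1).1 h.symm,
      fun h => hBn.2 h.symm⟩

lemma nearConst_or {G : SimpleGraph V} {A B : Finset V} {s : ℕ} (hd : Disjoint A B)
    (hA : Homog G A) (hB : Homog G B) (hgen : Gen G A B 2 2 s) (hf : C5Free G) {c : V}
    (hcA : c ∉ A) (hcB : c ∉ B) :
    NearConst A (nb G c A) (2 * s) ∨ NearConst B (nb G c B) (2 * s) := by
  rcases hA with hA | hA
  · exact nearConst_of_isClique hA hB hgen hf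
  · have := nearConst_of_isClique hA hB.compl (hgen.compl hd) hf.compl (c := c)
    rwa [nearConst_nb_compl hcA, nearConst_nb_compl hcB] at this

def ParFree (G : SimpleGraph V) (U : Finset V) : Prop := P3Free G U ∨ P3Free Gᶜ U

lemma ParFree.mono {G : SimpleGraph V} {U U' : Finset V} (h : ParFree G U) (hU : U' ⊆ U) :
    ParFree G U' :=
  h.imp (fun h => h.mono hU) (fun h => h.mono hU)

variable [Fintype V]

/-- The event that a generic pair has many paths of length two on one side. -/
def PairDef (t k r : ℕ) (Q : Finset V) (G : SimpleGraph V) : Prop :=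
  ∃ A B : Finset V, A ∪ B = Q ∧ Disjoint A B ∧ A.card = t ∧ B.card = t ∧ G.IsClique (B : Set V) ∧
    (∀ c, c ∉ Q → NearConst A (nb G c A) k ∨ NearConst B (nb G c B) k) ∧
    Pack (Qᶜ.filter fun c => NearConst A (nb G c A) k) 3 (fun x => IsP3 G (x 0) (x 1) (x 2)) r

lemma part_of_not_pairDef {G : SimpleGraph V} {A B : Finset V} {t k r : ℕ} (hd : Disjoint A B)
    (hA : A.card = t) (hB : B.card = t) (hBh : Homog G B)
    (hn : ∀ c, c ∉ A ∪ B → NearConst A (nb G c A) k ∨ NearConst B (nb G c B) k)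
    (h1 : ¬ PairDef t k r (A ∪ B) G) (h2 : ¬ PairDef t k r (A ∪ B) Gᶜ) :
    ∃ Z, Z.card ≤ 3 * r ∧ ParFree G ((A ∪ B)ᶜ.filter (fun c => NearConst A (nb G c A) k) \ Z) := by
  have key : ∀ G : SimpleGraph V, G.IsClique (B : Set V) →
      (∀ c, c ∉ A ∪ B → NearConst A (nb G c A) k ∨ NearConst B (nb G c B) k) →
      ¬ PairDef t k r (A ∪ B) G → ∃ Z, Z.card ≤ 3 * r ∧
        P3Free G ((A ∪ B)ᶜ.filter (fun c => NearConst A (nb G c A) k) \ Z) := by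
    intro G hB' hn h
    obtain ⟨Z, -, hZ, hp⟩ := P3Free.of_not_pack (fun hp => h ⟨A, B, rfl, hd, hA, hB, hB', hn, hp⟩)
    exact ⟨Z, hZ, hp⟩
  rcases hBh with hBh | hBh
  · obtain ⟨Z, hZ, hp⟩ := key G hBh hn h1
    exact ⟨Z, hZ, Or.inl hp⟩
  · obtain ⟨Z, hZ, hp⟩ := key Gᶜ hBh (fun c hc => by
      rw [nearConst_nb_compl (by grind), nearConst_nb_compl (by grind)]; exact hn c hc) h2
    refine ⟨Z, hZ, Or.inr ?_⟩
    convert hp using 2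
    refine Finset.filter_congr fun c hc => ?_
    rw [nearConst_nb_compl]
    simp at hc
    exact hc.1

theorem exists_parts {G : SimpleGraph V} (hG : Cls G) {t s r m : ℕ}
    {H : Fin t → Fin (t ^ 2) → Prop} (hH : Generic s H) (hm : 1 ≤ m) (hV : m ^ 2 ≤ Fintype.card V)
    (h1 : ∀ Q : Finset V, Q.card = m → Homog G Q →
      (m + 1) ^ (t + t ^ 2) < ((Finset.univ \ Q).image fun v => nb G v Q).card)
    (h2 : ∀ Q : Finset V, Q.card = 2 * t → ¬ PairDef t (2 * s) r Q G ∧ ¬ PairDef t (2 * s) r Q Gᶜ) :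
    ∃ U₁ U₂ : Finset V, Disjoint U₁ U₂ ∧ ParFree G U₁ ∧ ParFree G U₂ ∧
      (U₁ ∪ U₂)ᶜ.card ≤ 2 * t + 6 * r := by
  obtain ⟨Y, -, hYh, hYc⟩ := hG.2 Finset.univ
  rw [Finset.card_univ] at hYc
  obtain ⟨X, hXY, hX⟩ := Finset.exists_subset_card_eq (s := Y) (n := m)
    (by by_contra hlt; nlinarith)
  obtain ⟨A, B, hd, hA, hB, hAh, hBh, hgen⟩ := exists_homog_gen hG hH (hYh.subset hXY) (by omega)
    (by rw [hX]; exact h1 X hX (hYh.subset hXY))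
  have hn : ∀ c, c ∉ A ∪ B → NearConst A (nb G c A) (2 * s) ∨ NearConst B (nb G c B) (2 * s) :=
    fun c hc => nearConst_or hd hAh hBh hgen hG.1 (by grind) (by grind)
  have hQ : (A ∪ B).card = 2 * t := by rw [Finset.card_union_of_disjoint hd]; omega
  obtain ⟨Z₁, hZ₁, hp₁⟩ := part_of_not_pairDef hd hA hB hBh hn (h2 _ hQ).1 (h2 _ hQ).2
  obtain ⟨Z₂, hZ₂, hp₂⟩ := part_of_not_pairDef hd.symm hB hA hAh
    (fun c hc => (hn c (by rwa [Finset.union_comm])).symm)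
    (by rw [Finset.union_comm]; exact (h2 _ hQ).1) (by rw [Finset.union_comm]; exact (h2 _ hQ).2)
  set N₁ := (A ∪ B)ᶜ.filter fun c => NearConst A (nb G c A) (2 * s)
  set N₂ := (B ∪ A)ᶜ.filter fun c => NearConst B (nb G c B) (2 * s)
  refine ⟨N₁ \ Z₁, (N₂ \ Z₂) \ N₁, ?_, hp₁, hp₂.mono Finset.sdiff_subset, ?_⟩
  · rw [Finset.disjoint_left]; grind
  · have hsub : (N₁ \ Z₁ ∪ (N₂ \ Z₂) \ N₁)ᶜ ⊆ (A ∪ B) ∪ (Z₁ ∪ Z₂) := by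
      intro c hc
      by_contra hcn
      simp only [Finset.mem_union, not_or] at hcn
      have := hn c (by grind)
      simp only [N₁, N₂, Finset.mem_compl, Finset.mem_union, Finset.mem_sdiff, Finset.mem_filter]
        at hc
      tauto
    have h3 := Finset.card_le_card hsub
    have h4 := Finset.card_union_le (A ∪ B) (Z₁ ∪ Z₂)
    have h5 := Finset.card_union_le Z₁ Z₂
    omega

end Decomposition

/-! ### Counting graphs with few traces, or with many paths against a generic pair -/

section PairCounting
variable {V : Type*}

lemma NearConst.subtype {A S : Finset V} {k : ℕ} {p : V → Prop} (h : NearConst A S k)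
    (hp : ∀ v ∈ A, v ∈ S ↔ p v) :
    NearConst (Finset.univ : Finset A) (Finset.univ.filter fun v : A => p v) k := by
  refine h.imp (fun h => ?_) (fun h => ?_)
  · refine le_trans ?_ h
    rw [← Finset.card_map (Function.Embedding.subtype _)]
    refine Finset.card_le_card fun v hv => ?_
    obtain ⟨⟨w, hw⟩, hv', rfl⟩ := Finset.mem_map.1 hv
    simp only [Finset.univ_inter, Finset.mem_filter, Finset.mem_univ, true_and] at hv'
    exact Finset.mem_inter.2 ⟨hw, (hp w hw).2 hv'⟩
  · refine le_trans ?_ h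
    rw [← Finset.card_map (Function.Embedding.subtype _)]
    refine Finset.card_le_card fun v hv => ?_
    obtain ⟨⟨w, hw⟩, hv', rfl⟩ := Finset.mem_map.1 hv
    simp only [Finset.mem_sdiff, Finset.mem_filter, Finset.mem_univ, true_and] at hv'
    exact Finset.mem_sdiff.2 ⟨hw, fun h => hv' ((hp w hw).1 h)⟩

variable [Fintype V]

def FewTraces (L : ℕ) (Q : Finset V) (G : SimpleGraph V) : Prop :=
  ((Finset.univ \ Q).image fun v => nb G v Q).card ≤ L

lemma cnt_traces_le (Q : Finset V) (G₀ : SimpleGraph V) (L : ℕ) (hL : 1 ≤ L) :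
    cnt (fun G => FewTraces L Q G ∧ Agree Q G₀ G) ≤
      2 ^ 2 ^ Q.card * (L : ℝ) ^ Fintype.card V := by
  refine cnt_exists_le (fun F : Finset (Finset V) => F ⊆ Q.powerset ∧ F.card ≤ L)
    (fun F G => Agree Q G₀ G ∧ ∀ v : (Qᶜ : Finset V), nb G v Q ∈ F) (by positivity) ?_ ?_ ?_
  · refine (cnt_mono fun F hF => hF.1).trans ?_
    rw [cnt_powerset, Finset.card_powerset]
  · rintro G ⟨h1, h2⟩
    refine ⟨_, ⟨?_, h1⟩, h2, fun v => Finset.mem_image_of_mem _ (by simp)⟩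
    intro u hu
    obtain ⟨v, -, rfl⟩ := Finset.mem_image.1 hu
    exact Finset.mem_powerset.2 (nb_subset _ _ _)
  · rintro F ⟨-, hF⟩
    have h1 : cnt (fun G => Agree Q G₀ G ∧ ∀ v : (Qᶜ : Finset V), nb G v Q ∈ F) ≤
        cnt (fun g : (Qᶜ : Finset V) → Finset V => ∀ v, g v ∈ F) := by
      refine cnt_inj_le (fun G v => nb G v Q) (fun G hG => hG.2) ?_
      intro G G' hG hG' h
      refine hG.1.ext hG'.1 fun q hq v hv => ?_
      have := congrFun h ⟨v, by simpa using hv⟩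
      simp only at this
      have h2 := Finset.ext_iff.1 this q
      simp only [mem_nb, hq, true_and] at h2
      rw [G.adj_comm, G'.adj_comm, h2]
    refine h1.trans ((cnt_pi_le (M := L) _ fun v => ?_).trans ?_)
    · have : {S : Finset V | S ∈ F} = (F : Set (Finset V)) := rfl
      rw [cnt, this, Set.ncard_coe_finset]
      exact_mod_cast hF
    · refine pow_le_pow_right₀ (by exact_mod_cast hL) ?_
      rw [Fintype.card_coe]
      exact Finset.card_le_univ _

lemma cnt_nearConst_univ_le (q k : ℕ) :
    cnt (fun S : Finset V => NearConst Finset.univ S k) ≤ 2 * ballBound q (Fintype.card V) k := by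
  have := cnt_nearConst_le q k (Finset.univ : Finset V) Finset.univ
  simpa using this

lemma cnt_pair_fixed_le (q : ℕ) {t k r : ℕ} (G₀ : SimpleGraph V) {A B N : Finset V}
    (hA : A.card = t) (hB : B.card = t) (hd : Disjoint A B) (hN : N ⊆ (A ∪ B)ᶜ)
    (hBc : G₀.IsClique (B : Set V)) (hp : Pack N 3 (fun x => IsP3 G₀ (x 0) (x 1) (x 2)) r) :
    cnt (fun G => C5Free G ∧ Agree (A ∪ B) G₀ G ∧ (∀ c ∈ N, NearConst A (nb G c A) k) ∧
      ∀ c ∈ (A ∪ B)ᶜ \ N, NearConst B (nb G c B) k) ≤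
      (2 * ballBound q t k) ^ Fintype.card V *
        2 ^ ((t * (Fintype.card V - 2 * t) : ℕ) - (r * (t / 2 : ℕ) : ℝ) / 50) := by
  obtain ⟨e, he, hem, hR⟩ := hp
  obtain ⟨f, hf, hfm, -⟩ := pack_of_card (U := B) (k := 2) (r := t / 2) (by omega)
  set N' := (A ∪ B)ᶜ \ N with hN'
  have hcardQ : (A ∪ B).card = 2 * t := by rw [Finset.card_union_of_disjoint hd]; omega
  have hcard : N.card + N'.card = Fintype.card V - 2 * t := by
    rw [hN', ← hcardQ, ← Finset.card_compl, add_comm, Finset.card_sdiff_add_card_eq_card hN]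
  let e' : Fin r × Fin 3 → N := fun x => ⟨e x, hem x⟩
  let f' : Fin (t / 2) × Fin 2 → B := fun x => ⟨f x, hfm x⟩
  have he' : Function.Injective e' := fun x y h => he (congrArg Subtype.val h)
  have hf' : Function.Injective f' := fun x y h => hf (congrArg Subtype.val h)
  have hdisj : ∀ v ∈ N, v ∉ A ∧ v ∉ B := fun v hv => by
    have := hN hv
    simpa using this
  have h1 : cnt (fun G => C5Free G ∧ Agree (A ∪ B) G₀ G ∧ (∀ c ∈ N, NearConst A (nb G c A) k) ∧
      ∀ c ∈ N', NearConst B (nb G c B) k) ≤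
      cnt (fun x : ((N → Finset A) × (N' → Finset B)) × ((N → B → Prop) × (N' → A → Prop)) =>
        ((∀ c, NearConst Finset.univ (x.1.1 c) k) ∧ (∀ c, NearConst Finset.univ (x.1.2 c) k)) ∧
        ((∀ i j, ¬ ∀ a b, (x.2.1 (e' (i, a)) (f' (j, b)) ↔ pathPattern a b)) ∧ True)) := by
    refine cnt_inj_le (fun G => ((fun c => Finset.univ.filter fun v : A => G.Adj c v,
      fun c => Finset.univ.filter fun v : B => G.Adj c v),
      (fun c b => G.Adj c b, fun c a => G.Adj c a))) ?_ ?_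
    · rintro G ⟨h5, hag, hnA, hnB⟩
      refine ⟨⟨fun c => (hnA c c.2).subtype ?_, fun c => (hnB c c.2).subtype ?_⟩, ?_, trivial⟩
      · intro v hv; rw [mem_nb]; exact ⟨fun h => h.2, fun h => ⟨hv, h⟩⟩
      · intro v hv; rw [mem_nb]; exact ⟨fun h => h.2, fun h => ⟨hv, h⟩⟩
      · intro i j hij
        have hout : ∀ u ∈ N, ∀ v ∈ N, (G.Adj u v ↔ G₀.Adj u v) := fun u hu v hv => by
          refine (hag u v ?_).symm
          have := hdisj u hu; have := hdisj v hv
          grind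
        refine IsP3.c5_of_pattern (s := fun a => e (i, a)) (t := fun b => f (j, b)) ?_ ?_ hij h5
        · have := hR i
          simp only [IsP3] at this ⊢
          rwa [hout _ (hem _) _ (hem _), hout _ (hem _) _ (hem _), hout _ (hem _) _ (hem _)]
        · rw [← hag _ _ (by simp [hfm])]
          exact hBc (hfm _) (hfm _) (hf.ne (by simp))
    · rintro G G' ⟨-, hG, -⟩ ⟨-, hG', -⟩ h
      simp only [Prod.mk.injEq] at h
      obtain ⟨⟨h1, h2⟩, h3, h4⟩ := h
      refine hG.ext hG' fun q hq v hv => ?_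
      rw [G.adj_comm, G'.adj_comm]
      rcases Finset.mem_union.1 hq with hqA | hqB
      · by_cases hvN : v ∈ N
        · have := Finset.ext_iff.1 (congrFun h1 ⟨v, hvN⟩) ⟨q, hqA⟩
          simpa using this
        · exact iff_of_eq (congrFun (congrFun h4 ⟨v, by simp [N', hvN]; simpa using hv⟩) ⟨q, hqA⟩)
      · by_cases hvN : v ∈ N
        · exact iff_of_eq (congrFun (congrFun h3 ⟨v, hvN⟩) ⟨q, hqB⟩)
        · have := Finset.ext_iff.1 (congrFun h2 ⟨v, by simp [N', hvN]; simpa using hv⟩) ⟨q, hqB⟩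
          simpa using this
  have hb := one_le_ballBound q t k
  have e1 := cnt_prod (fun x : (N → Finset A) × (N' → Finset B) =>
      (∀ c, NearConst Finset.univ (x.1 c) k) ∧ ∀ c, NearConst Finset.univ (x.2 c) k)
    (fun y : (N → B → Prop) × (N' → A → Prop) =>
      (∀ i j, ¬ ∀ a b, (y.1 (e' (i, a)) (f' (j, b)) ↔ pathPattern a b)) ∧ True)
  have e2 := cnt_prod (fun x : N → Finset A => ∀ c, NearConst Finset.univ (x c) k)
    (fun x : N' → Finset B => ∀ c, NearConst Finset.univ (x c) k)
  have e3 := cnt_prod (fun y : N → B → Prop =>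
    ∀ i j, ¬ ∀ a b, (y (e' (i, a)) (f' (j, b)) ↔ pathPattern a b)) (fun _ : N' → A → Prop => True)
  refine (h1.trans_eq e1).trans ?_
  rw [e2, e3]
  refine mul_le_mul ?_ ?_ (mul_nonneg (cnt_nonneg _) (cnt_nonneg _)) (by positivity)
  · have hA' := cnt_nearConst_univ_le (V := A) q k
    have hB' := cnt_nearConst_univ_le (V := B) q k
    rw [Fintype.card_coe, hA] at hA'
    rw [Fintype.card_coe, hB] at hB'
    calc _ ≤ (2 * ballBound q t k) ^ N.card * (2 * ballBound q t k) ^ N'.card := by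
          refine mul_le_mul ?_ ?_ (cnt_nonneg _) (by positivity)
          · exact (cnt_pi_le _ fun _ => hA').trans (by rw [Fintype.card_coe])
          · exact (cnt_pi_le _ fun _ => hB').trans (by rw [Fintype.card_coe])
      _ ≤ _ := by
          rw [← pow_add]
          exact pow_le_pow_right₀ (by linarith) (by omega)
  · have hg := cnt_avoid_grid (by norm_num) e' he' f' hf' pathPattern
    rw [Fintype.card_coe, Fintype.card_coe, hB] at hg
    have hfree : cnt (fun _ : N' → A → Prop => True) = 2 ^ ((N'.card * t : ℕ) : ℝ) := by
      rw [cnt_true, Nat.card_eq_fintype_card, Fintype.card_fun, Fintype.card_fun, Fintype.card_prop,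
        Fintype.card_coe, Fintype.card_coe, hA, Real.rpow_natCast, ← pow_mul, mul_comm]
      push_cast; rfl
    rw [hfree]
    refine (mul_le_mul_of_nonneg_right hg (by positivity)).trans (le_of_eq ?_)
    rw [← Real.rpow_add (by norm_num), ← hcard]
    congr 1
    push_cast
    ring

lemma cnt_pairDef_fibre_le (q : ℕ) {t k r : ℕ} (Q : Finset V) (hQ : Q.card = 2 * t)
    (G₀ : SimpleGraph V) :
    cnt (fun G => Cls G ∧ PairDef t k r Q G ∧ Agree Q G₀ G) ≤
      (2 ^ (2 * t) * 2 ^ Fintype.card V) * ((2 * ballBound q t k) ^ Fintype.card V *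
        2 ^ ((t * (Fintype.card V - 2 * t) : ℕ) - (r * (t / 2 : ℕ) : ℝ) / 50)) := by
  have hb := ballBound_pos q t k
  refine cnt_exists_le (fun x : Finset V × Finset V => (x.1 ⊆ Q ∧ True) ∧
      (Q \ x.1).card = t ∧ x.1.card = t ∧ G₀.IsClique ((Q \ x.1 : Finset V) : Set V) ∧ x.2 ⊆ Qᶜ ∧
      Pack x.2 3 (fun y => IsP3 G₀ (y 0) (y 1) (y 2)) r)
    (fun x G => C5Free G ∧ Agree Q G₀ G ∧ (∀ c ∈ x.2, NearConst x.1 (nb G c x.1) k) ∧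
      ∀ c ∈ Qᶜ \ x.2, NearConst (Q \ x.1) (nb G c (Q \ x.1)) k) (by positivity) ?_ ?_ ?_
  · refine (cnt_mono fun x hx => hx.1).trans ?_
    rw [cnt_prod (fun A => A ⊆ Q) (fun _ => True), cnt_powerset, cnt_finset, hQ]
  · rintro G ⟨hG, ⟨A, B, rfl, hd, hA, hB, hBc, hn, hp⟩, hag⟩
    have hBe : (A ∪ B) \ A = B := Finset.union_sdiff_cancel_left hd
    refine ⟨⟨A, (A ∪ B)ᶜ.filter fun c => NearConst A (nb G c A) k⟩,
      ⟨⟨Finset.subset_union_left, trivial⟩, ?_, hA, ?_, Finset.filter_subset _ _, hp.imp le_rfl ?_⟩,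
      hG.1, hag, fun c hc => (Finset.mem_filter.1 hc).2, fun c hc => ?_⟩
    · rwa [hBe]
    · rw [hBe]
      intro u hu v hv huv
      have hu' : u ∈ B := hu
      have hv' : v ∈ B := hv
      exact (hag _ _ (by simp [hu', hv'])).2 (hBc hu hv huv)
    · intro x _ hx h
      have hout : ∀ i j, (G.Adj (x i) (x j) ↔ G₀.Adj (x i) (x j)) := fun i j => by
        refine (hag _ _ ?_).symm
        have h1 := Finset.mem_compl.1 (Finset.mem_filter.1 (hx i)).1
        have h2 := Finset.mem_compl.1 (Finset.mem_filter.1 (hx j)).1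
        simp only [h1, h2]
      simpa only [IsP3, hout] using h
    · simp only
      rw [hBe]
      simp only [Finset.mem_sdiff, Finset.mem_filter, Finset.mem_compl] at hc
      exact (hn c hc.1).resolve_left fun h => hc.2 ⟨hc.1, h⟩
  · rintro ⟨A, N⟩ ⟨⟨hAQ, -⟩, hB, hA, hBc, hN, hp⟩
    simp only at hAQ hB hA hBc hN hp
    have hu : A ∪ (Q \ A) = Q := by grind
    have := cnt_pair_fixed_le (k := k) q G₀ hA hB Finset.disjoint_sdiff (by rwa [hu]) hBc hp
    simpa only [hu] using this

end PairCounting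

lemma cnt_fewTraces_le {n m L : ℕ} (hL : 1 ≤ L) :
    cnt (fun G : SimpleGraph (Fin n) => Cls G ∧ ∃ Q : Finset (Fin n), Q.card = m ∧
      FewTraces L Q G) ≤
      (n : ℝ) ^ m * (2 ^ m ^ 2 * numCls (n - m) * (2 ^ 2 ^ m * (L : ℝ) ^ n)) := by
  refine cnt_agree_le (fun Q G => FewTraces L Q G)
    (by positivity) fun Q G₀ hQ _ _ => ?_
  have := cnt_traces_le Q G₀ L hL
  rw [hQ, Fintype.card_fin] at this
  exact (cnt_mono fun G hG => hG.2).trans this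

lemma cnt_pairDef_le (q n t k r : ℕ) :
    cnt (fun G : SimpleGraph (Fin n) => Cls G ∧ ∃ Q : Finset (Fin n), Q.card = 2 * t ∧
      PairDef t k r Q G) ≤
      (n : ℝ) ^ (2 * t) * (2 ^ (2 * t) ^ 2 * numCls (n - 2 * t) * ((2 ^ (2 * t) * 2 ^ n) *
        ((2 * ballBound q t k) ^ n *
        2 ^ ((t * (n - 2 * t) : ℕ) - (r * (t / 2 : ℕ) : ℝ) / 50)))) := by
  have hb := ballBound_pos q t k
  refine cnt_agree_le (fun Q G => PairDef t k r Q G) (by positivity) fun Q G₀ hQ _ _ => ?_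
  have := cnt_pairDef_fibre_le (k := k) (r := r) q Q hQ G₀
  rwa [Fintype.card_fin] at this

/-! ### Direct counts for graphs that split into two partite pieces -/

section DirectCounts
variable {V : Type*}

lemma ParFree.exists_rep {G : SimpleGraph V} {U : Finset V} (h : ParFree G U) :
    ∃ (f : V → V) (b : Prop), ∀ u ∈ U, ∀ v ∈ U, u ≠ v → (G.Adj u v ↔ (b ↔ f u = f v)) := by
  rcases h with h | h
  · obtain ⟨f, -, hf⟩ := h.exists_repFun (Finset.empty_subset U) (Or.inl (by simp))
    exact ⟨f, True, fun u hu v hv huv => by rw [hf u hu v hv]; tauto⟩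
  · obtain ⟨f, -, hf⟩ := h.exists_repFun (Finset.empty_subset U) (Or.inl (by simp))
    refine ⟨f, False, fun u hu v hv huv => ?_⟩
    have := hf u hu v hv
    rw [SimpleGraph.compl_adj] at this
    tauto

lemma cnt_cross (U₁ U₂ : Finset V) :
    cnt (fun _ : U₁ → U₂ → Prop => True) = 2 ^ ((U₁.card * U₂.card : ℕ) : ℝ) := by
  rw [cnt_true, Nat.card_eq_fintype_card, Fintype.card_fun, Fintype.card_fun, Fintype.card_prop,
    Fintype.card_coe, Fintype.card_coe, Real.rpow_natCast, ← pow_mul, mul_comm]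
  push_cast; rfl

variable [Fintype V]

lemma cnt_direct_le (w : ℕ) (X : ∀ U₁ U₂ : Finset V, (U₁ → U₂ → Prop) → Prop) {K : ℝ}
    (hX : ∀ U₁ U₂, Disjoint U₁ U₂ → cnt (X U₁ U₂) ≤ K) :
    cnt (fun G : SimpleGraph V => ∃ U₁ U₂ : Finset V, Disjoint U₁ U₂ ∧ (U₁ ∪ U₂)ᶜ.card ≤ w ∧
      ParFree G U₁ ∧ ParFree G U₂ ∧ X U₁ U₂ fun a b => G.Adj a b) ≤
    ((2 ^ Fintype.card V * 2 ^ Fintype.card V) * (((Fintype.card V : ℝ) ^ Fintype.card V * 2) *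
      ((Fintype.card V : ℝ) ^ Fintype.card V * 2))) * (2 ^ (w * Fintype.card V) * K) := by
  have hK : 0 ≤ K := (cnt_nonneg _).trans (hX ∅ ∅ (by simp))
  refine cnt_exists_le (fun i : (Finset V × Finset V) × ((V → V) × Prop) × ((V → V) × Prop) =>
      Disjoint i.1.1 i.1.2 ∧ (i.1.1 ∪ i.1.2)ᶜ.card ≤ w)
    (fun i G => (∀ u ∈ i.1.1, ∀ v ∈ i.1.1, u ≠ v →
      (G.Adj u v ↔ (i.2.1.2 ↔ i.2.1.1 u = i.2.1.1 v))) ∧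
      (∀ u ∈ i.1.2, ∀ v ∈ i.1.2, u ≠ v → (G.Adj u v ↔ (i.2.2.2 ↔ i.2.2.1 u = i.2.2.1 v))) ∧
      X i.1.1 i.1.2 fun a b => G.Adj a b) (by positivity) ?_ ?_ ?_
  · refine (cnt_le_card _).trans (le_of_eq ?_)
    rw [Nat.card_eq_fintype_card]
    simp only [Fintype.card_prod, Fintype.card_fun, Fintype.card_prop, Fintype.card_finset]
    push_cast
    rfl
  · rintro G ⟨U₁, U₂, hd, hw, h1, h2, hx⟩
    obtain ⟨f₁, b₁, h1⟩ := h1.exists_rep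
    obtain ⟨f₂, b₂, h2⟩ := h2.exists_rep
    exact ⟨((U₁, U₂), ((f₁, b₁), (f₂, b₂))), ⟨hd, hw⟩, h1, h2, hx⟩
  · rintro ⟨⟨U₁, U₂⟩, ⟨f₁, b₁⟩, ⟨f₂, b₂⟩⟩ ⟨hd, hw⟩
    simp only at hd hw
    set W := (U₁ ∪ U₂)ᶜ with hW
    refine (cnt_inj_le (q := fun x : (W → V → Prop) × (U₁ → U₂ → Prop) => True ∧ X U₁ U₂ x.2)
      (fun G => (fun w v => G.Adj w v, fun a b => G.Adj a b)) (fun G hG => ⟨trivial, hG.2.2⟩)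
        ?_).trans ?_
    · rintro G G' ⟨h1, h2, -⟩ ⟨h1', h2', -⟩ h
      simp only [Prod.mk.injEq] at h
      have hWr : ∀ w, w ∉ U₁ → w ∉ U₂ → ∀ v, (G.Adj w v ↔ G'.Adj w v) := fun w hw1 hw2 v =>
        iff_of_eq (congrFun (congrFun h.1 ⟨w, by simp [hW, hw1, hw2]⟩) v)
      have hcr : ∀ a ∈ U₁, ∀ b ∈ U₂, (G.Adj a b ↔ G'.Adj a b) := fun a ha b hb =>
        iff_of_eq (congrFun (congrFun h.2 ⟨a, ha⟩) ⟨b, hb⟩)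
      ext u v
      rcases eq_or_ne u v with rfl | huv
      · simp
      by_cases hu1 : u ∈ U₁ <;> by_cases hu2 : u ∈ U₂ <;> by_cases hv1 : v ∈ U₁ <;>
        by_cases hv2 : v ∈ U₂
      all_goals first
        | exact hWr u hu1 hu2 v
        | (rw [G.adj_comm, G'.adj_comm]; exact hWr v hv1 hv2 u)
        | exact hcr u hu1 v hv2
        | (rw [G.adj_comm, G'.adj_comm]; exact hcr v hv1 u hu2)
        | (rw [h1 u hu1 v hv1 huv, h1' u hu1 v hv1 huv])
        | (rw [h2 u hu2 v hv2 huv, h2' u hu2 v hv2 huv])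
    · rw [cnt_prod (fun _ => True) (X U₁ U₂)]
      refine mul_le_mul ?_ (hX _ _ hd) (cnt_nonneg _) (by positivity)
      rw [cnt_true, Nat.card_eq_fintype_card]
      simp only [Fintype.card_fun, Fintype.card_prop, Fintype.card_coe]
      push_cast
      rw [← pow_mul, mul_comm]
      exact pow_le_pow_right₀ (by norm_num) (Nat.mul_le_mul_right _ hw)

lemma card_add_card_le {U₁ U₂ : Finset V} (hd : Disjoint U₁ U₂) :
    (U₁.card : ℝ) + U₂.card ≤ Fintype.card V := by
  rw [← Nat.cast_add, ← Finset.card_union_of_disjoint hd]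
  exact_mod_cast Finset.card_le_univ _

lemma card_mul_card_le {U₁ U₂ : Finset V} (hd : Disjoint U₁ U₂) :
    ((U₁.card * U₂.card : ℕ) : ℝ) ≤ (Fintype.card V : ℝ) ^ 2 / 4 := by
  have := card_add_card_le hd
  push_cast
  nlinarith [sq_nonneg ((U₁.card : ℝ) - U₂.card), Nat.cast_nonneg (α := ℝ) U₁.card,
    Nat.cast_nonneg (α := ℝ) U₂.card, Nat.cast_nonneg (α := ℝ) (Fintype.card V)]

lemma cnt_size_le (e : ℕ) {U₁ U₂ : Finset V} (hd : Disjoint U₁ U₂) :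
    cnt (fun _ : U₁ → U₂ → Prop => Fintype.card V + 2 * e < 2 * U₁.card) ≤
      2 ^ ((Fintype.card V : ℝ) ^ 2 / 4 - (e : ℝ) ^ 2) := by
  by_cases h : Fintype.card V + 2 * e < 2 * U₁.card
  · refine (cnt_mono fun _ _ => trivial).trans ((cnt_cross U₁ U₂).le.trans ?_)
    refine Real.rpow_le_rpow_of_exponent_le (by norm_num) ?_
    have h1 := card_add_card_le hd
    have h2 : (Fintype.card V : ℝ) + 2 * e < 2 * U₁.card := by exact_mod_cast h
    push_cast
    have h3 : (U₁.card : ℝ) * U₂.card ≤ U₁.card * (Fintype.card V - U₁.card) :=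
      mul_le_mul_of_nonneg_left (by linarith) (Nat.cast_nonneg _)
    nlinarith [Nat.cast_nonneg (α := ℝ) e]
  · refine (le_of_eq ?_).trans (by positivity : (0 : ℝ) ≤ _)
    simp [cnt, h]

/-- A bipartite pattern avoiding some small pattern on a large grid. -/
def AvoidGrid (a b r : ℕ) {ι κ : Type*} (g : ι → κ → Prop) : Prop :=
  ∃ (e : Fin r × Fin a → ι) (f : Fin r × Fin b → κ) (σ : Fin a → Fin b → Prop),
    Function.Injective e ∧ Function.Injective f ∧
      ∀ i j, ¬ ∀ k l, (g (e (i, k)) (f (j, l)) ↔ σ k l)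

lemma cnt_avoidGrid_le {a b r : ℕ} (hab : a * b ≤ 6) (hV : 1 ≤ Fintype.card V) {U₁ U₂ : Finset V}
    (hd : Disjoint U₁ U₂) :
    cnt (fun g : U₁ → U₂ → Prop => AvoidGrid a b r g) ≤
      (((Fintype.card V : ℝ) ^ (r * a) * (Fintype.card V : ℝ) ^ (r * b)) * 2 ^ (a * b)) *
        2 ^ ((Fintype.card V : ℝ) ^ 2 / 4 - (r : ℝ) ^ 2 / 50) := by
  refine cnt_exists_le (fun x : ((Fin r × Fin a → U₁) × (Fin r × Fin b → U₂)) ×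
      (Fin a → Fin b → Prop) => Function.Injective x.1.1 ∧ Function.Injective x.1.2)
    (fun x g => ∀ i j, ¬ ∀ k l, (g (x.1.1 (i, k)) (x.1.2 (j, l)) ↔ x.2 k l)) (by positivity)
    ?_ ?_ ?_
  · refine (cnt_le_card _).trans ?_
    rw [Nat.card_eq_fintype_card]
    simp only [Fintype.card_prod, Fintype.card_fun, Fintype.card_prop, Fintype.card_fin,
      Fintype.card_coe]
    push_cast
    rw [← pow_mul, mul_comm b a]
    gcongr <;> exact Finset.card_le_univ _
  · rintro g ⟨e, f, σ, he, hf, h⟩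
    exact ⟨((e, f), σ), ⟨he, hf⟩, h⟩
  · rintro ⟨⟨e, f⟩, σ⟩ ⟨he, hf⟩
    refine (cnt_avoid_grid hab e he f hf σ).trans ?_
    refine Real.rpow_le_rpow_of_exponent_le (by norm_num) ?_
    rw [Fintype.card_coe, Fintype.card_coe]
    nlinarith [card_mul_card_le hd]

lemma cnt_large_le : cnt (fun S : Finset V => 3 * Fintype.card V < 5 * S.card) ≤
    2 ^ ((49 / 50 : ℝ) * Fintype.card V) := by
  set m := Fintype.card V with hm
  have h1 : cnt (fun S : Finset V => 3 * m < 5 * S.card) ≤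
      cnt (fun S : Finset V => S.card ≤ 2 * m / 5) := by
    refine cnt_inj_le (fun S => Sᶜ) (fun S hS => ?_) fun S T _ _ h => compl_injective h
    have := Finset.card_compl S
    rw [this, ← hm]
    omega
  have h2 := cnt_small_le_pow (V := V) (2 / 3) (by norm_num) (by norm_num) (2 * m / 5)
  set c := cnt (fun S : Finset V => S.card ≤ 2 * m / 5)
  have hc : 0 ≤ c := cnt_nonneg _
  rw [← hm] at h2
  have h3 : c ≤ (5 / 3) ^ m * (3 / 2) ^ (2 * m / 5) := by
    have e : (3 / 2 : ℝ) ^ (2 * m / 5) * (2 / 3) ^ (2 * m / 5) = 1 := by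
      rw [← mul_pow]; norm_num
    calc c = c * (2 / 3) ^ (2 * m / 5) * (3 / 2) ^ (2 * m / 5) := by
          rw [mul_assoc, mul_comm ((2 / 3 : ℝ) ^ _), e, mul_one]
      _ ≤ _ := by
        refine mul_le_mul_of_nonneg_right (h2.trans (le_of_eq ?_)) (by positivity)
        norm_num
  refine h1.trans ?_
  refine le_of_pow_le_pow_left₀ (n := 50) (by norm_num) (by positivity) ?_
  calc c ^ 50 ≤ ((5 / 3) ^ m * (3 / 2) ^ (2 * m / 5)) ^ 50 := pow_le_pow_left₀ hc h3 _
    _ = ((5 / 3 : ℝ) ^ 50) ^ m * (3 / 2) ^ (2 * m / 5 * 50) := by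
        rw [mul_pow, ← pow_mul, ← pow_mul, ← pow_mul, mul_comm m]
    _ ≤ ((5 / 3 : ℝ) ^ 50) ^ m * (3 / 2) ^ (20 * m) :=
        mul_le_mul_of_nonneg_left (pow_le_pow_right₀ (by norm_num) (by omega)) (by positivity)
    _ = ((5 / 3 : ℝ) ^ 50 * (3 / 2) ^ 20) ^ m := by rw [mul_pow, pow_mul (3 / 2 : ℝ)]
    _ ≤ (2 ^ 49) ^ m := pow_le_pow_left₀ (by positivity) (by norm_num) _
    _ = _ := by
        rw [← Real.rpow_natCast (2 ^ ((49 / 50 : ℝ) * m)) 50, ← Real.rpow_mul (by norm_num),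
          ← pow_mul,
          ← Real.rpow_natCast]
        congr 1
        push_cast
        ring

lemma cnt_degree_le {U₁ U₂ : Finset V} (hd : Disjoint U₁ U₂) :
    cnt (fun g : U₁ → U₂ → Prop => ∀ b,
      3 * U₁.card < 5 * (Finset.univ.filter fun a => g a b).card) ≤
      2 ^ ((49 / 50 : ℝ) * ((Fintype.card V : ℝ) ^ 2 / 4)) := by
  have h1 : cnt (fun g : U₁ → U₂ → Prop => ∀ b,
      3 * U₁.card < 5 * (Finset.univ.filter fun a => g a b).card) ≤
      cnt (fun h : U₂ → Finset U₁ => ∀ b, 3 * Fintype.card U₁ < 5 * (h b).card) := by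
    refine cnt_inj_le (fun g b => Finset.univ.filter fun a => g a b)
      (fun g hg b => by rw [Fintype.card_coe]; exact hg b) ?_
    intro g g' _ _ h
    funext a b
    have := Finset.ext_iff.1 (congrFun h b) a
    simpa using this
  refine h1.trans ((cnt_pi_le _ fun _ => cnt_large_le).trans ?_)
  rw [Fintype.card_coe, Fintype.card_coe, ← Real.rpow_natCast, ← Real.rpow_mul (by norm_num)]
  refine Real.rpow_le_rpow_of_exponent_le (by norm_num) ?_
  have := card_mul_card_le hd
  push_cast at this
  linarith

end DirectCounts

/-! ### Reduction to a clique together with a disjoint union of cliques -/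

section Structure
variable {V : Type*}

lemma ParFree.compl {G : SimpleGraph V} {U : Finset V} (h : ParFree G U) : ParFree Gᶜ U := by
  rcases h with h | h
  · exact Or.inr (by rwa [compl_compl])
  · exact Or.inl h

lemma homog_of_p3Free {G : SimpleGraph V} {U : Finset V} (h1 : P3Free G U) (h2 : P3Free Gᶜ U) :
    Homog G U := by
  by_contra hcon
  simp only [Homog, SimpleGraph.IsClique, Set.Pairwise, not_or, Finset.mem_coe] at hcon
  push Not at hcon
  obtain ⟨⟨x, hx, y, hy, hxy, hn⟩, p, hp, q, hq, hpq, hn'⟩ := hcon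
  have hpq' : G.Adj p q := by
    rw [SimpleGraph.compl_adj] at hn'; tauto
  have co : ∀ a ∈ U, ∀ b ∈ U, ∀ c ∈ U, a ≠ b → b ≠ c → G.Adj a c → G.Adj a b ∨ G.Adj b c := by
    intro a ha b hb c hc hab hbc hac
    by_contra h
    rw [not_or] at h
    refine h2 a ha b hb c hc ⟨?_, ?_, hac.ne, ?_⟩ <;> rw [SimpleGraph.compl_adj]
    · exact ⟨hab, h.1⟩
    · exact ⟨hbc, h.2⟩
    · exact fun h => h.2 hac
  have all : ∀ z ∈ U, z ≠ p → G.Adj p z := by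
    intro z hz hzp
    rcases eq_or_ne z q with rfl | hzq
    · exact hpq'
    rcases co p hp z hz q hq hzp.symm hzq hpq' with h | h
    · exact h
    · exact h1.adj hp hq hz hpq' h.symm hzp.symm
  rcases eq_or_ne x p with rfl | hxp
  · exact hn (all y hy hxy.symm)
  rcases eq_or_ne y p with rfl | hyp
  · exact hn (all x hx hxy).symm
  · exact hn (h1.adj hx hp hy (all x hx hxp).symm (all y hy hyp) hxy)

lemma not_pack_of_gen {G : SimpleGraph V} {U₁ U₂ : Finset V} {r : ℕ} (hf : C5Free G)
    (hg : Gen G U₁ U₂ 2 3 r) (he : Pack U₁ 2 (fun t => G.Adj (t 0) (t 1)) r) :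
    ¬ Pack U₂ 3 (fun t => IsP3 G (t 0) (t 1) (t 2)) r := by
  intro hp
  obtain ⟨s, t, hs, ht, -, -, -, -, h⟩ := hg.symm.exists_pattern hp he pathPattern
  exact hs.c5_of_pattern ht h hf

lemma pack_adj_of_clique {G : SimpleGraph V} {U Z : Finset V} {r : ℕ}
    (hc : G.IsClique ((U \ Z : Finset V) : Set V)) (hr : r * 2 ≤ (U \ Z).card) :
    Pack U 2 (fun t => G.Adj (t 0) (t 1)) r :=
  (pack_of_card hr).imp Finset.sdiff_subset fun t ht hm _ => hc (hm 0) (hm 1) (ht.ne (by simp))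

lemma pack_compl {G : SimpleGraph V} {U : Finset V} {r : ℕ}
    (h : Pack U 2 (fun t => ¬ G.Adj (t 0) (t 1)) r) : Pack U 2 (fun t => Gᶜ.Adj (t 0) (t 1)) r :=
  h.imp le_rfl fun t ht _ hn => (SimpleGraph.compl_adj _ _ _).2 ⟨ht.ne (by simp), hn⟩

lemma avoidGrid_of_not_gen {G : SimpleGraph V} {U₁ U₂ : Finset V} {a b r : ℕ}
    (h : ¬ Gen G U₁ U₂ a b r) : AvoidGrid a b r fun (x : U₁) (y : U₂) => G.Adj x y := by
  simp only [Gen] at h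
  push Not at h
  obtain ⟨e, f, he, hf, heU, hfU, σ, h⟩ := h
  refine ⟨fun x => ⟨e x, heU x⟩, fun x => ⟨f x, hfU x⟩, σ,
    fun x y hxy => he (congrArg Subtype.val hxy),
    fun x y hxy => hf (congrArg Subtype.val hxy), fun i j hij => ?_⟩
  obtain ⟨k, l, hkl⟩ := h i j
  have := hij k l
  simp only at this
  tauto

variable [Fintype V]

/-- `U₁` is a clique, `U₂` a disjoint union of cliques, in generic position. -/
structure Str (G : SimpleGraph V) (U₁ U₂ : Finset V) (w r : ℕ) : Prop where
  disj : Disjoint U₁ U₂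
  clique : G.IsClique (U₁ : Set V)
  p3Free : P3Free G U₂
  gen : Gen G U₁ U₂ 2 2 r
  rest : (U₁ ∪ U₂)ᶜ.card ≤ w

def AnyStr (G : SimpleGraph V) (w r : ℕ) : Prop := ∃ U₁ U₂, Str G U₁ U₂ w r

lemma card_compl_union_sdiff_le (U₁ U₂ Z₁ Z₂ : Finset V) {w a b : ℕ} (hw : (U₁ ∪ U₂)ᶜ.card ≤ w)
    (h1 : Z₁.card ≤ a) (h2 : Z₂.card ≤ b) : ((U₁ \ Z₁) ∪ (U₂ \ Z₂))ᶜ.card ≤ w + a + b := by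
  have hs : ((U₁ \ Z₁) ∪ (U₂ \ Z₂))ᶜ ⊆ (U₁ ∪ U₂)ᶜ ∪ Z₁ ∪ Z₂ := by
    intro v hv
    simp only [Finset.mem_compl, Finset.mem_union, Finset.mem_sdiff] at hv ⊢
    tauto
  have h3 := Finset.card_le_card hs
  have h4 := Finset.card_union_le ((U₁ ∪ U₂)ᶜ ∪ Z₁) Z₂
  have h5 := Finset.card_union_le (U₁ ∪ U₂)ᶜ Z₁
  omega

lemma Str.of_trim {G : SimpleGraph V} {U₁ U₂ Z₁ Z₂ : Finset V} {w r a b : ℕ}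
    (hd : Disjoint U₁ U₂) (hw : (U₁ ∪ U₂)ᶜ.card ≤ w) (hg : Gen G U₁ U₂ 2 2 r)
    (h1 : Z₁.card ≤ a) (h2 : Z₂.card ≤ b) (hab : a + b ≤ 9 * r)
    (hc : G.IsClique ((U₁ \ Z₁ : Finset V) : Set V)) (hp : P3Free G (U₂ \ Z₂)) :
    AnyStr G (w + 9 * r) r :=
  ⟨_, _, hd.mono Finset.sdiff_subset Finset.sdiff_subset, hc, hp,
    hg.mono Finset.sdiff_subset Finset.sdiff_subset,
    (card_compl_union_sdiff_le _ _ _ _ hw h1 h2).trans (by omega)⟩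

theorem exists_str {G : SimpleGraph V} (hf : C5Free G) {U₁ U₂ : Finset V} {w r : ℕ}
    (hd : Disjoint U₁ U₂) (hw : (U₁ ∪ U₂)ᶜ.card ≤ w) (h22 : Gen G U₁ U₂ 2 2 r)
    (h23 : Gen G U₁ U₂ 2 3 r) (h32 : Gen G U₁ U₂ 3 2 r) (hU₁ : 10 * r < U₁.card)
    (hU₂ : 10 * r < U₂.card) : AnyStr G (w + 9 * r) r ∨ AnyStr Gᶜ (w + 9 * r) r := by
  have hw' : (U₂ ∪ U₁)ᶜ.card ≤ w := by rwa [Finset.union_comm]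
  have trim : ∀ (G : SimpleGraph V), C5Free G → Gen G U₁ U₂ 2 3 r →
      Pack U₁ 2 (fun t => G.Adj (t 0) (t 1)) r →
      ∃ Z ⊆ U₂, Z.card ≤ 3 * r ∧ P3Free G (U₂ \ Z) := fun G hf hg he =>
    P3Free.of_not_pack (not_pack_of_gen hf hg he)
  by_cases he : Pack U₁ 2 (fun t => G.Adj (t 0) (t 1)) r
  · obtain ⟨Z₂, hZ₂U, hZ₂, hp⟩ := trim G hf h23 he
    by_cases hn : Pack U₁ 2 (fun t => ¬ G.Adj (t 0) (t 1)) r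
    · obtain ⟨Z₂', hZ₂'U, hZ₂', hp'⟩ := trim Gᶜ hf.compl (h23.compl hd) (pack_compl hn)
      have hcard : (Z₂ ∪ Z₂').card ≤ 6 * r := (Finset.card_union_le _ _).trans (by omega)
      have hsd := Finset.le_card_sdiff (Z₂ ∪ Z₂') U₂
      have hh : Homog G (U₂ \ (Z₂ ∪ Z₂')) := homog_of_p3Free (hp.mono (by grind))
          (hp'.mono (by grind))
      rcases hh with hh | hh
      · obtain ⟨Z₁, -, hZ₁, hp₁⟩ := P3Free.of_not_pack (not_pack_of_gen hf h32.symm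
          (pack_adj_of_clique hh (by omega)))
        exact Or.inl (Str.of_trim hd.symm hw' h22.symm hcard hZ₁ (by omega) hh hp₁)
      · obtain ⟨Z₁, -, hZ₁, hp₁⟩ := P3Free.of_not_pack (not_pack_of_gen hf.compl
          (h32.compl hd).symm (pack_adj_of_clique hh (by omega)))
        exact Or.inr (Str.of_trim hd.symm hw' (h22.compl hd).symm hcard hZ₁ (by omega) hh hp₁)
    · obtain ⟨Z₁, -, hZ₁, hc⟩ := clique_of_not_pack hn
      exact Or.inl (Str.of_trim hd hw h22 hZ₁ hZ₂ (by omega) hc hp)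
  · obtain ⟨Z₁, -, hZ₁, hc⟩ := stable_of_not_pack he
    have hsd := Finset.le_card_sdiff Z₁ U₁
    obtain ⟨Z₂, -, hZ₂, hp⟩ := trim Gᶜ hf.compl (h23.compl hd) (pack_adj_of_clique hc (by omega))
    exact Or.inr (Str.of_trim hd hw (h22.compl hd) hZ₁ hZ₂ (by omega) hc hp)

/-! ### The exceptional events and their counts -/

def GenBad (w r : ℕ) (G : SimpleGraph V) : Prop :=
  ∃ U₁ U₂ : Finset V, Disjoint U₁ U₂ ∧ (U₁ ∪ U₂)ᶜ.card ≤ w ∧ ParFree G U₁ ∧ ParFree G U₂ ∧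
    ¬ (Gen G U₁ U₂ 2 2 r ∧ Gen G U₁ U₂ 2 3 r ∧ Gen G U₁ U₂ 3 2 r)

def SizeBad (w e : ℕ) (G : SimpleGraph V) : Prop :=
  ∃ U₁ U₂ : Finset V, Disjoint U₁ U₂ ∧ (U₁ ∪ U₂)ᶜ.card ≤ w ∧ ParFree G U₁ ∧ ParFree G U₂ ∧
    Fintype.card V + 2 * e < 2 * U₁.card

def DegBad (w : ℕ) (G : SimpleGraph V) : Prop :=
  ∃ U₁ U₂ : Finset V, Disjoint U₁ U₂ ∧ (U₁ ∪ U₂)ᶜ.card ≤ w ∧ ParFree G U₁ ∧ ParFree G U₂ ∧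
    ∀ b ∈ U₂, 3 * U₁.card < 5 * (nb G b U₁).card

def directBound (n w : ℕ) : ℝ :=
  ((2 ^ n * 2 ^ n) * (((n : ℝ) ^ n * 2) * ((n : ℝ) ^ n * 2))) * 2 ^ (w * n)

lemma directBound_nonneg (n w : ℕ) : 0 ≤ directBound n w := by unfold directBound; positivity

lemma cnt_not_gen_le (w : ℕ) {a b r : ℕ} (hab : a * b ≤ 6) (ha : a ≤ 3) (hb : b ≤ 3)
    (hV : 1 ≤ Fintype.card V) :
    cnt (fun G : SimpleGraph V => ∃ U₁ U₂ : Finset V, Disjoint U₁ U₂ ∧ (U₁ ∪ U₂)ᶜ.card ≤ w ∧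
      ParFree G U₁ ∧ ParFree G U₂ ∧ ¬ Gen G U₁ U₂ a b r) ≤
    directBound (Fintype.card V) w * ((((Fintype.card V : ℝ) ^ (r * 3) *
      (Fintype.card V : ℝ) ^ (r * 3)) * 2 ^ 6) *
        2 ^ ((Fintype.card V : ℝ) ^ 2 / 4 - (r : ℝ) ^ 2 / 50)) := by
  have hV' : (1 : ℝ) ≤ Fintype.card V := by exact_mod_cast hV
  have h := cnt_direct_le (V := V) w (fun U₁ U₂ g => AvoidGrid a b r g)
    (fun U₁ U₂ hd => cnt_avoidGrid_le hab hV hd)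
  rw [← mul_assoc] at h
  refine (cnt_mono ?_).trans (h.trans ?_)
  · rintro G ⟨U₁, U₂, hd, hw, h1, h2, hg⟩
    exact ⟨U₁, U₂, hd, hw, h1, h2, avoidGrid_of_not_gen hg⟩
  · have e1 := pow_le_pow_right₀ hV' (Nat.mul_le_mul_left r ha)
    have e2 := pow_le_pow_right₀ hV' (Nat.mul_le_mul_left r hb)
    have e3 := pow_le_pow_right₀ (one_le_two (α := ℝ)) hab
    refine mul_le_mul_of_nonneg_left ?_ (directBound_nonneg _ _)
    gcongr

lemma cnt_genBad_le (w r : ℕ) (hV : 1 ≤ Fintype.card V) :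
    cnt (fun G : SimpleGraph V => GenBad w r G) ≤
    3 * (directBound (Fintype.card V) w * ((((Fintype.card V : ℝ) ^ (r * 3) *
      (Fintype.card V : ℝ) ^ (r * 3)) * 2 ^ 6) *
        2 ^ ((Fintype.card V : ℝ) ^ 2 / 4 - (r : ℝ) ^ 2 / 50))) := by
  have h1 := cnt_not_gen_le (V := V) w (a := 2) (b := 2) (r := r) (by norm_num) (by norm_num)
      (by norm_num) hV
  have h2 := cnt_not_gen_le (V := V) w (a := 2) (b := 3) (r := r) (by norm_num) (by norm_num)
      (by norm_num) hV
  have h3 := cnt_not_gen_le (V := V) w (a := 3) (b := 2) (r := r) (by norm_num) (by norm_num)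
      (by norm_num) hV
  have h4 : cnt (fun G : SimpleGraph V => GenBad w r G) ≤ _ :=
    (cnt_mono ?_).trans ((cnt_or_le _ _).trans
      (add_le_add h1 ((cnt_or_le _ _).trans (add_le_add h2 h3))))
  · linarith
  · rintro G ⟨U₁, U₂, hd, hw, h1, h2, hg⟩
    by_cases g22 : Gen G U₁ U₂ 2 2 r
    · by_cases g23 : Gen G U₁ U₂ 2 3 r
      · exact Or.inr (Or.inr ⟨U₁, U₂, hd, hw, h1, h2, fun g => hg ⟨g22, g23, g⟩⟩)
      · exact Or.inr (Or.inl ⟨U₁, U₂, hd, hw, h1, h2, g23⟩)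
    · exact Or.inl ⟨U₁, U₂, hd, hw, h1, h2, g22⟩

lemma cnt_sizeBad_le (w e : ℕ) :
    cnt (fun G : SimpleGraph V => SizeBad w e G) ≤
      directBound (Fintype.card V) w * 2 ^ ((Fintype.card V : ℝ) ^ 2 / 4 - (e : ℝ) ^ 2) := by
  have h := cnt_direct_le (V := V) w (fun U₁ U₂ g => Fintype.card V + 2 * e < 2 * U₁.card)
    (fun U₁ U₂ hd => cnt_size_le e hd)
  rwa [← mul_assoc] at h

lemma cnt_degBad_le (w : ℕ) :
    cnt (fun G : SimpleGraph V => DegBad w G) ≤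
      directBound (Fintype.card V) w * 2 ^ ((49 / 50 : ℝ) * ((Fintype.card V : ℝ) ^ 2 / 4)) := by
  have h := cnt_direct_le (V := V) w (fun U₁ U₂ g => ∀ b,
      3 * U₁.card < 5 * (Finset.univ.filter fun a => g a b).card) (fun U₁ U₂ hd => cnt_degree_le hd)
  rw [← mul_assoc] at h
  refine (cnt_mono ?_).trans h
  rintro G ⟨U₁, U₂, hd, hw, h1, h2, hg⟩
  refine ⟨U₁, U₂, hd, hw, h1, h2, fun b => (hg b b.2).trans_le (Nat.mul_le_mul_left _ ?_)⟩
  rw [← Finset.card_map (Function.Embedding.subtype _)]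
  refine Finset.card_le_card fun v hv => ?_
  obtain ⟨hv1, hv2⟩ := mem_nb.1 hv
  exact Finset.mem_map.2 ⟨⟨v, hv1⟩, Finset.mem_filter.2 ⟨Finset.mem_univ _, hv2.symm⟩, rfl⟩

end Structure

/-! ### Defects relative to a clique and a disjoint union of cliques -/

section Core
variable {V : Type*} [Fintype V]

/-- `Str` with both sides of size at most `|V| / 2 + e`. -/
structure SStr (w r e : ℕ) (G : SimpleGraph V) (A B : Finset V) : Prop extends Str G A B w r where
  left : 2 * A.card ≤ Fintype.card V + 2 * e
  right : 2 * B.card ≤ Fintype.card V + 2 * e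

lemma SStr.card_le {w r e : ℕ} {G : SimpleGraph V} {A B : Finset V} (h : SStr w r e G A B) :
    Fintype.card V ≤ A.card + B.card + w := by
  have h1 := h.rest
  rw [Finset.card_compl, Finset.card_union_of_disjoint h.disj] at h1
  omega

lemma SStr.congr {w r e : ℕ} {G G' : SimpleGraph V} {A B : Finset V} (h : SStr w r e G A B)
    (hG : ∀ u ∈ A ∪ B, ∀ v ∈ A ∪ B, (G.Adj u v ↔ G'.Adj u v)) : SStr w r e G' A B where
  disj := h.disj
  clique := fun u hu v hv huv => (hG u (Finset.mem_union_left _ hu) v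
    (Finset.mem_union_left _ hv)).1 (h.clique hu hv huv)
  p3Free := fun x hx y hy z hz hp => by
    have hx := Finset.mem_union_right A hx
    have hy := Finset.mem_union_right A hy
    have hz := Finset.mem_union_right A hz
    refine h.p3Free x ‹_› y ‹_› z ‹_› ?_
    simpa only [IsP3, hG x hx y hy, hG y hy z hz, hG x hx z hz] using hp
  gen := fun e f he hf heA hfB σ => by
    obtain ⟨i, j, hij⟩ := h.gen e f he hf heA hfB σ
    exact ⟨i, j, fun k l => (hG _ (Finset.mem_union_left _ (heA _)) _
      (Finset.mem_union_right _ (hfB _))).symm.trans (hij k l)⟩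
  rest := h.rest
  left := h.left
  right := h.right

lemma SStr.sdiff {w r e : ℕ} {G : SimpleGraph V} {A B : Finset V} (h : SStr w r e G A B)
    (Q : Finset V) : SStr (w + Q.card) r e G (A \ Q) (B \ Q) where
  disj := h.disj.mono Finset.sdiff_subset Finset.sdiff_subset
  clique := h.clique.subset (Finset.coe_subset.2 Finset.sdiff_subset)
  p3Free := h.p3Free.mono Finset.sdiff_subset
  gen := h.gen.mono Finset.sdiff_subset Finset.sdiff_subset
  rest := by
    have : ((A \ Q) ∪ (B \ Q))ᶜ ⊆ (A ∪ B)ᶜ ∪ Q := by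
      intro v
      simp only [Finset.mem_compl, Finset.mem_union, Finset.mem_sdiff]
      tauto
    exact (Finset.card_le_card this).trans ((Finset.card_union_le _ _).trans
      (Nat.add_le_add_right h.rest _))
  left := (Nat.mul_le_mul_left 2 (Finset.card_le_card Finset.sdiff_subset)).trans h.left
  right := (Nat.mul_le_mul_left 2 (Finset.card_le_card Finset.sdiff_subset)).trans h.right

/-- `A` itself, or a part of `B`. -/
def cell (G : SimpleGraph V) (A B : Finset V) : Option V → Finset V
  | none => A
  | some z => B.filter fun y => y = z ∨ G.Adj z y

lemma SStr.near_cell {w r e : ℕ} {G : SimpleGraph V} {A B A' B' : Finset V}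
    (h : SStr w r e G A B) (h' : SStr w r e G A' B') :
    ∃ i, (symmDiff A' (cell G A B i)).card ≤ 4 * r + 3 * w + 2 * e := by
  have hn := h'.card_le
  have hB' := h'.right
  have key : ∀ X : Finset V, 2 * X.card ≤ Fintype.card V + 2 * e → (A' \ X).card ≤ 2 * r + w →
      (symmDiff A' X).card ≤ 4 * r + 3 * w + 2 * e := by
    intro X hX hAX
    have h1 := Finset.card_sdiff_add_card_inter A' X
    have h2 := Finset.card_sdiff_add_card_inter X A'
    rw [Finset.inter_comm] at h2
    have h3 : (symmDiff A' X).card ≤ (A' \ X).card + (X \ A').card := by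
      rw [symmDiff_def]; exact Finset.card_union_le _ _
    omega
  have hrest := h.rest
  by_cases hA : 2 * r ≤ (A' ∩ A).card
  · refine ⟨none, key A h.left ?_⟩
    have hB : (A' ∩ B).card < 2 * r := by
      by_contra hB
      obtain ⟨s, t, -, -, hs, ht, -, -, hst⟩ := (h.gen.mono Finset.inter_subset_right
        Finset.inter_subset_right).exists_pattern (pack_of_card (by omega : r * 2 ≤ (A' ∩ A).card))
        (pack_of_card (by omega : r * 2 ≤ (A' ∩ B).card)) (fun _ _ => False)
      have hs := Finset.mem_inter.1 (hs 0)
      have ht := Finset.mem_inter.1 (ht 0)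
      exact (hst 0 0).1 (h'.clique hs.1 ht.1 fun he => Finset.disjoint_left.1 h.disj hs.2
        (he ▸ ht.2))
    have hs : A' \ A ⊆ (A' ∩ B) ∪ (A ∪ B)ᶜ := by
      intro v
      simp only [Finset.mem_compl, Finset.mem_union, Finset.mem_sdiff, Finset.mem_inter]
      tauto
    have := (Finset.card_le_card hs).trans (Finset.card_union_le _ _)
    omega
  · push Not at hA
    by_cases hB : (A' ∩ B) = ∅
    · refine ⟨none, key A h.left ?_⟩
      have hs : A' \ A ⊆ (A' ∩ B) ∪ (A ∪ B)ᶜ := by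
        intro v
        simp only [Finset.mem_compl, Finset.mem_union, Finset.mem_sdiff, Finset.mem_inter]
        tauto
      have := (Finset.card_le_card hs).trans (Finset.card_union_le _ _)
      rw [hB, Finset.card_empty] at this
      omega
    · obtain ⟨z, hz⟩ := Finset.nonempty_iff_ne_empty.2 hB
      obtain ⟨hzA, hzB⟩ := Finset.mem_inter.1 hz
      refine ⟨some z, key _ ?_ ?_⟩
      · exact (Nat.mul_le_mul_left 2 (Finset.card_le_card (Finset.filter_subset _ _))).trans h.right
      · have hs : A' \ cell G A B (some z) ⊆ (A' ∩ A) ∪ (A ∪ B)ᶜ := by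
          intro v
          simp only [Finset.mem_compl, Finset.mem_union, Finset.mem_sdiff, Finset.mem_inter, cell,
            Finset.mem_filter]
          rintro ⟨hv, hv'⟩
          have : v ≠ z → G.Adj z v := fun hne => h'.clique hzA hv hne.symm
          tauto
        have := (Finset.card_le_card hs).trans (Finset.card_union_le _ _)
        omega

/-- Bound for the number of pairs with `SStr`. -/
def strBound (q n w r e : ℕ) : ℝ :=
  (n + 1) * (ballBound q n (4 * r + 3 * w + 2 * e) * ballBound q n w)

lemma strBound_nonneg (q n w r e : ℕ) : 0 ≤ strBound q n w r e := by
  have h1 := ballBound_pos q n (4 * r + 3 * w + 2 * e)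
  have h2 := ballBound_pos q n w
  unfold strBound; positivity

lemma cnt_sStr_le (q w r e : ℕ) (G : SimpleGraph V) :
    cnt (fun x : Finset V × Finset V => SStr w r e G x.1 x.2) ≤
      strBound q (Fintype.card V) w r e := by
  have b1 := ballBound_pos q (Fintype.card V) (4 * r + 3 * w + 2 * e)
  have b2 := ballBound_pos q (Fintype.card V) w
  by_cases hex : ∃ A B, SStr w r e G A B
  · obtain ⟨A, B, h⟩ := hex
    refine cnt_exists_le (fun _ : Option V => True)
      (fun i x => (symmDiff x.1 (cell G A B i)).card ≤ 4 * r + 3 * w + 2 * e ∧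
        (symmDiff x.2 x.1ᶜ).card ≤ w) (by positivity) ?_ ?_ ?_
    · refine (cnt_le_card _).trans ?_
      simp
    · rintro ⟨A', B'⟩ h'
      obtain ⟨i, hi⟩ := h.near_cell h'
      refine ⟨i, trivial, hi, (Finset.card_le_card ?_).trans h'.rest⟩
      intro v
      have := @Finset.disjoint_left _ A' B'
      have := (this.1 h'.disj) (a := v)
      simp only [Finset.mem_symmDiff, Finset.mem_compl, Finset.mem_union]
      tauto
    · intro i _
      have e := cnt_prod (fun X : Finset V => (symmDiff X (cell G A B i)).card ≤
          4 * r + 3 * w + 2 * e)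
        (fun Y : Finset V => Y.card ≤ w)
      refine le_trans ?_ ((le_of_eq e).trans (mul_le_mul (cnt_ball_le q _ _) (cnt_small_le q w)
        (cnt_nonneg _) b1.le))
      refine cnt_inj_le (fun x => (x.1, symmDiff x.2 x.1ᶜ)) (fun x hx => hx) ?_
      rintro ⟨X, Y⟩ ⟨X', Y'⟩ - - hxy
      simp only [Prod.mk.injEq] at hxy
      obtain ⟨rfl, h2⟩ := hxy
      rw [symmDiff_left_injective _ h2]
  · have : (fun x : Finset V × Finset V => SStr w r e G x.1 x.2) = fun _ => False := by
      funext x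
      exact eq_false fun hx => hex ⟨_, _, hx⟩
    rw [this, cnt]
    simp only [Set.ofPred_false, Set.ncard_empty, Nat.cast_zero]
    exact strBound_nonneg _ _ _ _ _

/-- The vertices of `Q` have traces of type `F` off `sel A B`, and their traces on `sel A B`
jointly satisfy `X`. -/
def CoreDef (w r e k : ℕ) (sel : Finset V → Finset V → Finset V)
    (F : SimpleGraph V → Finset V → Finset V → Finset V → Prop)
    (X : SimpleGraph V → ∀ S : Finset V, (Fin k → S → Prop) → Prop) (Q : Finset V)
    (G : SimpleGraph V) : Prop :=
  ∃ A B, SStr w r e G A B ∧ Disjoint Q (A ∪ B) ∧ ∃ s : Fin k → V, Function.Injective s ∧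
    (∀ v, v ∈ Q ↔ ∃ i, s i = v) ∧ (∀ i, F G A B (nb G (s i) (sel A B)ᶜ)) ∧
    X G (sel A B) fun i v => G.Adj (s i) v

lemma cnt_pi_reindex_le {k : ℕ} {ι κ : Type*} [Fintype ι] [Fintype κ] (hι : Fintype.card ι = k)
    (X : (Fin k → κ → Prop) → Prop) :
    cnt (fun g : ι → κ → Prop => ∃ s : Fin k → ι, Function.Injective s ∧ X fun i v => g (s i) v) ≤
      (k : ℝ) ^ k * cnt X := by
  refine cnt_exists_le (fun s : Fin k → ι => Function.Injective s)
    (fun s g => X fun i v => g (s i) v) (cnt_nonneg _) ?_ (fun g hg => hg) ?_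
  · refine (cnt_le_card _).trans ?_
    simp [hι]
  · intro s hs
    have hsurj : Function.Surjective s :=
      ((Fintype.bijective_iff_injective_and_card s).2 ⟨hs, by simp [hι]⟩).2
    refine cnt_inj_le (fun g i v => g (s i) v) (fun _ h => h) ?_
    intro g g' _ _ h
    funext x
    obtain ⟨i, rfl⟩ := hsurj x
    exact congrFun h i

lemma cnt_coreDef_fibre_le (q w r e k : ℕ) (sel : Finset V → Finset V → Finset V)
    (hsel : ∀ A B, sel A B ⊆ A ∪ B)
    (F : SimpleGraph V → Finset V → Finset V → Finset V → Prop)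
    (X : SimpleGraph V → ∀ S : Finset V, (Fin k → S → Prop) → Prop)
    (hFc : ∀ (G G' : SimpleGraph V) A B S, (∀ u ∈ A ∪ B, ∀ v ∈ A ∪ B, (G.Adj u v ↔ G'.Adj u v)) →
      F G A B S → F G' A B S)
    (hXc : ∀ (G G' : SimpleGraph V) S g, (∀ u ∈ S, ∀ v ∈ S, (G.Adj u v ↔ G'.Adj u v)) →
      X G S g → X G' S g) {M M' : ℝ} (hM : 0 ≤ M) (hM' : 0 ≤ M')
    (hF : ∀ G A B, SStr w r e G A B → cnt (fun S => S ⊆ (sel A B)ᶜ ∧ F G A B S) ≤ M)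
    (hX : ∀ G A B, SStr w r e G A B → cnt (X G (sel A B)) ≤ M')
    (Q : Finset V) (hQ : Q.card = k) (G₀ : SimpleGraph V) :
    cnt (fun G => Cls G ∧ CoreDef w r e k sel F X Q G ∧ Agree Q G₀ G) ≤
      strBound q (Fintype.card V) w r e * (M ^ k * ((k : ℝ) ^ k * M')) := by
  refine cnt_exists_le (fun x : Finset V × Finset V => SStr w r e G₀ x.1 x.2)
    (fun x G => Agree Q G₀ G ∧ (∀ u ∈ Q, nb G u (sel x.1 x.2)ᶜ ⊆ (sel x.1 x.2)ᶜ ∧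
      F G₀ x.1 x.2 (nb G u (sel x.1 x.2)ᶜ)) ∧
      ∃ s : Fin k → Q, Function.Injective s ∧ X G₀ (sel x.1 x.2) fun i v => G.Adj (s i) v)
    (by positivity) (cnt_sStr_le q w r e G₀) ?_ ?_
  · rintro G ⟨-, ⟨A, B, h, hd, s, hs, hsQ, hF', hX'⟩, hag⟩
    have hag' : ∀ u ∈ A ∪ B, ∀ v ∈ A ∪ B, (G.Adj u v ↔ G₀.Adj u v) := fun u hu v hv => by
      have hu := Finset.disjoint_right.1 hd hu
      have hv := Finset.disjoint_right.1 hd hv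
      exact (hag u v (by simp only [hu, hv])).symm
    refine ⟨(A, B), h.congr hag', hag, fun u hu => ⟨nb_subset _ _ _, ?_⟩,
      fun i => ⟨s i, (hsQ _).2 ⟨i, rfl⟩⟩, fun i j hij => hs (Subtype.mk.inj hij), ?_⟩
    · obtain ⟨i, rfl⟩ := (hsQ u).1 hu
      exact hFc _ _ _ _ _ hag' (hF' i)
    · exact hXc G G₀ _ _ (fun u hu v hv => hag' u (hsel _ _ hu) v (hsel _ _ hv)) hX'
  · rintro ⟨A, B⟩ h
    have h1 := cnt_fibre_le Q (sel A B)ᶜ (sel A B) (fun v _ => by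
      by_cases hv : v ∈ sel A B
      · exact Or.inr hv
      · exact Or.inl (Finset.mem_compl.2 hv)) G₀ (fun S => S ⊆ (sel A B)ᶜ ∧ F G₀ A B S)
      (fun g => ∃ s : Fin k → Q, Function.Injective s ∧ X G₀ (sel A B) fun i v => g (s i) v)
    rw [hQ] at h1
    refine h1.trans (mul_le_mul (pow_le_pow_left₀ (cnt_nonneg _) (hF _ _ _ h) k) ?_ (cnt_nonneg _)
      (by positivity))
    exact (cnt_pi_reindex_le (by simpa using hQ) _).trans
      (mul_le_mul_of_nonneg_left (hX _ _ _ h) (by positivity))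

end Core

section TraceCounts
variable {V : Type*}

/-- Up to `k` exceptions, `S ∩ B` is empty or a part of `B`. -/
def PartLike (G : SimpleGraph V) (B : Finset V) (k : ℕ) (S : Finset V) : Prop :=
  ∃ Z : Finset V, Z.card ≤ k ∧
    ∀ a ∈ S, a ∈ B → a ∉ Z → ∀ b ∈ B, b ∉ Z → (b ∈ S ↔ b = a ∨ G.Adj a b)

lemma PartLike.congr {G G' : SimpleGraph V} {B S : Finset V} {k : ℕ} (h : PartLike G B k S)
    (hG : ∀ u ∈ B, ∀ v ∈ B, (G.Adj u v ↔ G'.Adj u v)) : PartLike G' B k S := by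
  obtain ⟨Z, hZ, h⟩ := h
  exact ⟨Z, hZ, fun a ha haB haZ b hb hbZ => by rw [← hG a haB b hb]; exact h a ha haB haZ b hb hbZ⟩

lemma PartLike.mono {G : SimpleGraph V} {B B' S S' : Finset V} {k : ℕ} (h : PartLike G B k S)
    (hB : B' ⊆ B) (hS : ∀ v ∈ B', (v ∈ S' ↔ v ∈ S)) : PartLike G B' k S' := by
  obtain ⟨Z, hZ, h⟩ := h
  refine ⟨Z, hZ, fun a ha haB haZ b hb hbZ => ?_⟩
  rw [hS b hb]
  exact h a ((hS a haB).1 ha) (hB haB) haZ b (hB hb) hbZ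

/-- The pairs with prescribed adjacency in `S` avoid a fixed pattern towards three vertices. -/
def AvoidPairs (b : Prop) (p : ℕ) (G : SimpleGraph V) (S : Finset V)
    (g : Fin 3 → S → Prop) : Prop :=
  Pack S 2 (fun t => (b ↔ G.Adj (t 0) (t 1))) p ∧
    ∀ t : Fin 2 → S, Function.Injective t → (b ↔ G.Adj (t 0) (t 1)) →
      ¬ ∀ k l, (g k (t l) ↔ (b ↔ pathPattern k l))

lemma AvoidPairs.congr {b : Prop} {p : ℕ} {G G' : SimpleGraph V} {S : Finset V}
    {g : Fin 3 → S → Prop} (h : AvoidPairs b p G S g)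
    (hG : ∀ u ∈ S, ∀ v ∈ S, (G.Adj u v ↔ G'.Adj u v)) : AvoidPairs b p G' S g := by
  refine ⟨h.1.imp le_rfl fun t _ ht hb => ?_, fun t ht hb => h.2 t ht ?_⟩
  · rwa [← hG _ (ht 0) _ (ht 1)]
  · rwa [hG _ (t 0).2 _ (t 1).2]

lemma cnt_avoidPairs_le (b : Prop) (p : ℕ) (G : SimpleGraph V) (S : Finset V) :
    cnt (AvoidPairs b p G S) ≤ 2 ^ ((3 * S.card : ℝ) - p / 50) := by
  by_cases hp : Pack S 2 (fun t => (b ↔ G.Adj (t 0) (t 1))) p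
  · obtain ⟨f, hf, hfS, hE⟩ := hp
    have h := cnt_avoid_grid (ι := Fin 3) (κ := S) (a := 3) (b := 2) (r := 1) (p := p) (by norm_num)
      (fun x => x.2) (fun x y hxy => Prod.ext (Subsingleton.elim _ _) hxy)
      (fun x => ⟨f x, hfS x⟩) (fun x y hxy => hf (Subtype.mk.inj hxy))
      (fun k l => (b ↔ pathPattern k l))
    refine (cnt_mono fun g hg => ?_).trans (h.trans (le_of_eq ?_))
    · intro i j
      exact hg.2 (fun l => ⟨f (j, l), hfS _⟩)
        (fun l l' hl => (Prod.mk.inj (hf (Subtype.mk.inj hl))).2) (hE j)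
    · rw [Fintype.card_fin, Fintype.card_coe]
      push_cast
      ring_nf
  · have : AvoidPairs b p G S = fun _ => False := by
      funext g
      exact eq_false fun hg => hp hg.1
    rw [this, cnt]
    simp only [Set.ofPred_false, Set.ncard_empty, Nat.cast_zero]
    positivity

/-- Two traces whose union is small. -/
def SmallUnion (u : ℕ) (S : Finset V) (g : Fin 2 → S → Prop) : Prop :=
  (Finset.univ.filter fun v => g 0 v ∨ g 1 v).card ≤ u

lemma cnt_smallUnion_le (u : ℕ) (S : Finset V) : cnt (SmallUnion u S) ≤ 2 ^ S.card * 3 ^ u := by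
  refine cnt_exists_le (fun U : Finset S => U.card ≤ u)
    (fun U g => ∀ v, (g 0 v ∨ g 1 v) ↔ v ∈ U) (by positivity) ?_ ?_ ?_
  · refine (cnt_mono fun _ _ => trivial).trans ?_
    rw [cnt_finset, Fintype.card_coe]
  · intro g hg
    exact ⟨_, hg, fun v => by simp⟩
  · intro U hU
    have h1 : cnt (fun x : Prop × Prop => x.1 ∨ x.2) ≤ 3 := by
      have : {x : Prop × Prop | x.1 ∨ x.2} ⊆ {(True, True), (True, False), (False, True)} := by
        rintro ⟨x, y⟩ h
        by_cases hx : x <;> by_cases hy : y <;> simp_all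
      have := (Set.ncard_le_ncard this (Set.toFinite _)).trans (Set.ncard_insert_le _ _)
      have h2 := Set.ncard_insert_le (α := Prop × Prop) (True, False) {(False, True)}
      rw [Set.ncard_singleton] at h2
      unfold cnt
      exact_mod_cast this.trans (Nat.add_le_add_right h2 1)
    have h2 : cnt (fun g : Fin 2 → S → Prop => ∀ v, (g 0 v ∨ g 1 v) ↔ v ∈ U) ≤
        cnt (fun g : U → Prop × Prop => ∀ v, (g v).1 ∨ (g v).2) := by
      refine cnt_inj_le (fun g v => (g 0 v.1, g 1 v.1)) (fun g hg v => (hg v).2 v.2) ?_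
      intro g g' hg hg' h
      have h0 : ∀ v, g 0 v = g' 0 v ∧ g 1 v = g' 1 v := fun v => by
        by_cases hv : v ∈ U
        · exact Prod.mk.inj (congrFun h ⟨v, hv⟩)
        · have h3 := not_or.1 (mt (hg v).1 hv)
          have h4 := not_or.1 (mt (hg' v).1 hv)
          simp [h3, h4]
      funext i v
      fin_cases i
      · exact (h0 v).1
      · exact (h0 v).2
    refine h2.trans ((cnt_pi_le _ fun _ => h1).trans ?_)
    rw [Fintype.card_coe]
    exact pow_le_pow_right₀ (by norm_num) hU

lemma exists_image {k : ℕ} (s : Fin k → V) (hs : Function.Injective s) :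
    ∃ Q : Finset V, Q.card = k ∧ ∀ v, v ∈ Q ↔ ∃ i, s i = v :=
  ⟨Finset.univ.image s, by simp [Finset.card_image_of_injective _ hs], fun v => by simp⟩

lemma avoidPairs_of_isP3 {b : Prop} {p : ℕ} {G : SimpleGraph V} (hf : C5Free G) {S : Finset V}
    (hp : Pack S 2 (fun t => (b ↔ G.Adj (t 0) (t 1))) p) {s : Fin 3 → V} (hs : ∀ i, s i ∉ S)
    (h : IsP3 (if b then G else Gᶜ) (s 0) (s 1) (s 2)) :
    AvoidPairs b p G S fun i v => G.Adj (s i) v := by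
  refine ⟨hp, fun t ht htb hst => ?_⟩
  have ht' : ((t 0 : S) : V) ≠ t 1 := fun h => absurd (ht (Subtype.ext h)) (by simp)
  by_cases hb : b
  · simp only [hb, if_true, true_iff] at h htb hst
    exact IsP3.c5_of_pattern (G := G) (t := fun l => ((t l : S) : V)) h htb hst hf
  · simp only [hb, if_false, false_iff] at h htb hst
    refine IsP3.c5_of_pattern (G := Gᶜ) (t := fun l => ((t l : S) : V)) h
      ((SimpleGraph.compl_adj _ _ _).2 ⟨ht', htb⟩) (fun k l => ?_) hf.compl
    have : s k ≠ t l := fun h => hs k (h ▸ (t l).2)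
    rw [SimpleGraph.compl_adj, hst, not_not]
    simp [this]

variable [Fintype V]

lemma SStr.card_compl_sdiff_left {w r e : ℕ} {G : SimpleGraph V} {A B : Finset V}
    (h : SStr w r e G A B) : (Aᶜ \ B).card ≤ w := by
  have : Aᶜ \ B = (A ∪ B)ᶜ := by ext; simp
  exact this ▸ h.rest

lemma SStr.card_compl_sdiff_right {w r e : ℕ} {G : SimpleGraph V} {A B : Finset V}
    (h : SStr w r e G A B) : (Bᶜ \ A).card ≤ w := by
  have : Bᶜ \ A = (A ∪ B)ᶜ := by ext; simp [and_comm]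
  exact this ▸ h.rest

def nearBound (q n w k : ℕ) : ℝ := 2 ^ w * ((n + 2) * ballBound q n k)

lemma nearBound_nonneg (q n w k : ℕ) : 0 ≤ nearBound q n w k := by
  have := ballBound_pos q n k
  unfold nearBound; positivity

lemma cnt_nearConst_off_le (q k : ℕ) {w r e : ℕ} {G : SimpleGraph V} {A B : Finset V}
    (h : SStr w r e G A B) :
    cnt (fun S => S ⊆ Bᶜ ∧ NearConst A S k) ≤ nearBound q (Fintype.card V) w k := by
  have hb := ballBound_pos q (Fintype.card V) k
  refine (cnt_nearConst_le q k A Bᶜ).trans ?_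
  unfold nearBound
  have := h.card_compl_sdiff_right
  gcongr
  · norm_num
  · linarith [Nat.cast_nonneg (α := ℝ) (Fintype.card V)]

lemma cnt_partLike_off_le (q k : ℕ) {w r e : ℕ} {G : SimpleGraph V} {A B : Finset V}
    (h : SStr w r e G A B) :
    cnt (fun S => S ⊆ Aᶜ ∧ PartLike G B k S) ≤ nearBound q (Fintype.card V) w k := by
  have hb := ballBound_pos q (Fintype.card V) k
  have h1 : cnt (fun S : Finset V => S ⊆ B ∧ PartLike G B k S) ≤
      ((Fintype.card V : ℝ) + 2) * ballBound q (Fintype.card V) k := by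
    refine cnt_exists_le (fun _ : Option V => True)
      (fun i S => (symmDiff S (cell G ∅ B i)).card ≤ k) hb.le ?_ ?_ fun i _ => cnt_ball_le q k _
    · refine (cnt_le_card _).trans ?_
      simp
    · rintro S ⟨hS, Z, hZ, hp⟩
      by_cases hSZ : S ⊆ Z
      · refine ⟨none, trivial, (Finset.card_le_card ?_).trans hZ⟩
        intro v
        have := @hSZ v
        simp only [Finset.mem_symmDiff, cell, Finset.notMem_empty]
        tauto
      · obtain ⟨a, haS, haZ⟩ := Finset.not_subset.1 hSZ
        refine ⟨some a, trivial, (Finset.card_le_card ?_).trans hZ⟩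
        intro v
        have h1 := @hS v
        have h2 := hp a haS (hS haS) haZ v
        simp only [Finset.mem_symmDiff, cell, Finset.mem_filter]
        tauto
  have h0 : cnt (fun S : Finset V => S ⊆ Aᶜ ∧ PartLike G B k S) ≤
      cnt (fun x : Finset V × Finset V => x.1 ⊆ Aᶜ \ B ∧ (x.2 ⊆ B ∧ PartLike G B k x.2)) := by
    refine cnt_inj_le (fun S => (S \ B, S ∩ B)) ?_ ?_
    · rintro S ⟨hS, hn⟩
      exact ⟨Finset.sdiff_subset_sdiff hS le_rfl, Finset.inter_subset_right,
        hn.mono le_rfl fun v hv => by simp [hv]⟩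
    · intro S S' _ _ h
      simp only [Prod.mk.injEq] at h
      rw [← Finset.sdiff_union_inter S B, h.1, h.2, Finset.sdiff_union_inter]
  rw [cnt_prod (fun x : Finset V => x ⊆ Aᶜ \ B) (fun x => x ⊆ B ∧ PartLike G B k x),
    cnt_powerset] at h0
  refine h0.trans (mul_le_mul ?_ h1 (cnt_nonneg _) (by positivity))
  exact pow_le_pow_right₀ (by norm_num) h.card_compl_sdiff_left

lemma cnt_avoidPairs_size_le {b : Prop} {p e : ℕ} {G : SimpleGraph V} {S : Finset V}
    (hS : 2 * S.card ≤ Fintype.card V + 2 * e) :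
    cnt (AvoidPairs b p G S) ≤ 2 ^ (3 * ((Fintype.card V : ℝ) / 2 + e) - p / 50) := by
  have hS : (2 : ℝ) * S.card ≤ Fintype.card V + 2 * e := by exact_mod_cast hS
  refine (cnt_avoidPairs_le b p G S).trans (Real.rpow_le_rpow_of_exponent_le (by norm_num) ?_)
  linarith

lemma cnt_smallUnion_size_le {u e : ℕ} {S : Finset V}
    (hS : 2 * S.card ≤ Fintype.card V + 2 * e) :
    cnt (SmallUnion u S) ≤ 2 ^ ((Fintype.card V : ℝ) / 2 + e) * 3 ^ u := by
  have hS : (2 : ℝ) * S.card ≤ Fintype.card V + 2 * e := by exact_mod_cast hS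
  refine (cnt_smallUnion_le u S).trans (mul_le_mul_of_nonneg_right ?_ (by positivity))
  rw [← Real.rpow_natCast]
  exact Real.rpow_le_rpow_of_exponent_le (by norm_num) (by linarith)

/-! ### The three kinds of defects -/

def TripleLeft (b : Prop) (w r e k p : ℕ) (G : SimpleGraph V) : Prop :=
  ∃ A B, SStr w r e G A B ∧ Pack B 2 (fun t => (b ↔ G.Adj (t 0) (t 1))) p ∧
    ∃ s : Fin 3 → V, Function.Injective s ∧ (∀ i, NearConst A (nb G (s i) A) k) ∧
      IsP3 (if b then G else Gᶜ) (s 0) (s 1) (s 2)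

def TripleRight (w r e k p : ℕ) (G : SimpleGraph V) : Prop :=
  ∃ A B, SStr w r e G A B ∧ Pack A 2 (fun t => (True ↔ G.Adj (t 0) (t 1))) p ∧
    ∃ s : Fin 3 → V, Function.Injective s ∧ (∀ i, PartLike G B k (nb G (s i) B)) ∧
      IsP3 G (s 0) (s 1) (s 2)

def PairRight (w r e k u : ℕ) (G : SimpleGraph V) : Prop :=
  ∃ A B, SStr w r e G A B ∧ ∃ s : Fin 2 → V, Function.Injective s ∧
    (∀ i, PartLike G B k (nb G (s i) B)) ∧ (nb G (s 0) A ∪ nb G (s 1) A).card ≤ u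

lemma TripleLeft.core {b : Prop} {w r e k p : ℕ} {G : SimpleGraph V} (hf : C5Free G)
    (h : TripleLeft b w r e k p G) :
    ∃ Q : Finset V, Q.card = 3 ∧ CoreDef (w + 3) r e 3 (fun _ B => B)
      (fun _ A _ S => NearConst A S k) (AvoidPairs b (p - 3)) Q G := by
  obtain ⟨A, B, hAB, hp, s, hs, hn, h3⟩ := h
  obtain ⟨Q, hQ, hsQ⟩ := exists_image s hs
  have hsB : ∀ i, s i ∉ B \ Q := fun i hi => (Finset.mem_sdiff.1 hi).2 ((hsQ _).2 ⟨i, rfl⟩)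
  refine ⟨Q, hQ, A \ Q, B \ Q, hQ ▸ hAB.sdiff Q, ?_, s, hs, hsQ, fun i => ?_,
    avoidPairs_of_isP3 hf (hQ ▸ hp.sub) hsB h3⟩
  · rw [Finset.disjoint_left]
    intro v
    simp only [Finset.mem_union, Finset.mem_sdiff]
    tauto
  · have hd := @Finset.disjoint_left _ A B
    rcases hn i with h | h
    · refine Or.inl ((Finset.card_le_card ?_).trans h)
      intro v
      simp only [Finset.mem_inter, mem_nb, Finset.mem_sdiff]
      tauto
    · refine Or.inr ((Finset.card_le_card ?_).trans h)
      intro v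
      have := (hd.1 hAB.disj) (a := v)
      simp only [mem_nb, Finset.mem_sdiff, Finset.mem_compl]
      tauto

lemma PartLike.core {G : SimpleGraph V} {A B Q : Finset V} {k : ℕ} {x : V} (hd : Disjoint A B)
    (h : PartLike G B k (nb G x B)) : PartLike G (B \ Q) k (nb G x (A \ Q)ᶜ) := by
  refine h.mono Finset.sdiff_subset fun v hv => ?_
  have hv := Finset.mem_sdiff.1 hv
  have := Finset.disjoint_right.1 hd hv.1
  simp only [mem_nb, Finset.mem_sdiff, Finset.mem_compl]
  tauto

lemma TripleRight.core {w r e k p : ℕ} {G : SimpleGraph V} (hf : C5Free G)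
    (h : TripleRight w r e k p G) :
    ∃ Q : Finset V, Q.card = 3 ∧ CoreDef (w + 3) r e 3 (fun A _ => A)
      (fun G _ B S => PartLike G B k S) (AvoidPairs True (p - 3)) Q G := by
  obtain ⟨A, B, hAB, hp, s, hs, hn, h3⟩ := h
  obtain ⟨Q, hQ, hsQ⟩ := exists_image s hs
  have hsA : ∀ i, s i ∉ A \ Q := fun i hi => (Finset.mem_sdiff.1 hi).2 ((hsQ _).2 ⟨i, rfl⟩)
  refine ⟨Q, hQ, A \ Q, B \ Q, hQ ▸ hAB.sdiff Q, ?_, s, hs, hsQ, fun i => (hn i).core hAB.disj,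
    avoidPairs_of_isP3 hf (hQ ▸ hp.sub) hsA (by simpa using h3)⟩
  rw [Finset.disjoint_left]
  intro v
  simp only [Finset.mem_union, Finset.mem_sdiff]
  tauto

lemma PairRight.core {w r e k u : ℕ} {G : SimpleGraph V} (h : PairRight w r e k u G) :
    ∃ Q : Finset V, Q.card = 2 ∧ CoreDef (w + 2) r e 2 (fun A _ => A)
      (fun G _ B S => PartLike G B k S) (fun _ S g => SmallUnion u S g) Q G := by
  obtain ⟨A, B, hAB, s, hs, hn, hu⟩ := h
  obtain ⟨Q, hQ, hsQ⟩ := exists_image s hs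
  refine ⟨Q, hQ, A \ Q, B \ Q, hQ ▸ hAB.sdiff Q, ?_, s, hs, hsQ, fun i => (hn i).core hAB.disj, ?_⟩
  · rw [Finset.disjoint_left]
    intro v
    simp only [Finset.mem_union, Finset.mem_sdiff]
    tauto
  · simp only [SmallUnion]
    rw [← Finset.card_map (Function.Embedding.subtype _)]
    refine (Finset.card_le_card fun v hv => ?_).trans hu
    obtain ⟨⟨x, hx⟩, hx', rfl⟩ := Finset.mem_map.1 hv
    have hx' := (Finset.mem_filter.1 hx').2
    have := (Finset.mem_sdiff.1 hx).1
    simp only [Finset.mem_union, mem_nb, Function.Embedding.subtype_apply]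
    tauto

lemma cnt_core_tripleLeft_le (q w r e k : ℕ) (b : Prop) (p : ℕ)
    (Q : Finset V) (hQ : Q.card = 3) (G₀ : SimpleGraph V) :
    cnt (fun G => Cls G ∧ CoreDef (w + 3) r e 3 (fun _ B => B)
      (fun _ A _ S => NearConst A S k) (AvoidPairs b p) Q G ∧ Agree Q G₀ G) ≤
      strBound q (Fintype.card V) (w + 3) r e * (nearBound q (Fintype.card V) (w + 3) k ^ 3 *
        ((3 : ℕ) ^ 3 * 2 ^ (3 * ((Fintype.card V : ℝ) / 2 + e) - p / 50))) :=
  cnt_coreDef_fibre_le q (w + 3) r e 3 (fun _ B => B) (fun _ _ => Finset.subset_union_right)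
    (fun _ A _ S => NearConst A S k) (AvoidPairs b p)
    (fun _ _ _ _ _ _ h => h)
    (fun _ _ _ _ hG h => h.congr hG) (nearBound_nonneg q _ (w + 3) k) (by positivity)
    (fun G A B h => cnt_nearConst_off_le q k h)
      (fun G A B h => cnt_avoidPairs_size_le h.right) Q hQ G₀

lemma cnt_core_tripleRight_le (q w r e k : ℕ) (p : ℕ)
    (Q : Finset V) (hQ : Q.card = 3) (G₀ : SimpleGraph V) :
    cnt (fun G => Cls G ∧ CoreDef (w + 3) r e 3 (fun A _ => A)
      (fun G _ B S => PartLike G B k S) (AvoidPairs True p) Q G ∧ Agree Q G₀ G) ≤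
      strBound q (Fintype.card V) (w + 3) r e * (nearBound q (Fintype.card V) (w + 3) k ^ 3 *
        ((3 : ℕ) ^ 3 * 2 ^ (3 * ((Fintype.card V : ℝ) / 2 + e) - p / 50))) :=
  cnt_coreDef_fibre_le q (w + 3) r e 3 (fun A _ => A) (fun _ _ => Finset.subset_union_left)
    (fun G _ B S => PartLike G B k S) (AvoidPairs True p)
    (fun G G' A B S hG h => h.congr fun u hu v hv =>
      hG u (Finset.mem_union_right _ hu) v (Finset.mem_union_right _ hv))
    (fun _ _ _ _ hG h => h.congr hG) (nearBound_nonneg q _ (w + 3) k) (by positivity)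
    (fun G A B h => cnt_partLike_off_le q k h)
      (fun G A B h => cnt_avoidPairs_size_le h.left) Q hQ G₀

lemma cnt_core_pairRight_le (q w r e k : ℕ) (u : ℕ)
    (Q : Finset V) (hQ : Q.card = 2) (G₀ : SimpleGraph V) :
    cnt (fun G => Cls G ∧ CoreDef (w + 2) r e 2 (fun A _ => A)
      (fun G _ B S => PartLike G B k S) (fun _ S g => SmallUnion u S g) Q G ∧ Agree Q G₀ G) ≤
      strBound q (Fintype.card V) (w + 2) r e * (nearBound q (Fintype.card V) (w + 2) k ^ 2 *
        ((2 : ℕ) ^ 2 * (2 ^ ((Fintype.card V : ℝ) / 2 + e) * 3 ^ u))) :=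
  cnt_coreDef_fibre_le q (w + 2) r e 2 (fun A _ => A) (fun _ _ => Finset.subset_union_left)
    (fun G _ B S => PartLike G B k S) (fun _ S g => SmallUnion u S g)
    (fun G G' A B S hG h => h.congr fun u hu v hv =>
      hG u (Finset.mem_union_right _ hu) v (Finset.mem_union_right _ hv))
    (fun _ _ _ _ _ h => h) (nearBound_nonneg q _ (w + 2) k) (by positivity)
    (fun G A B h => cnt_partLike_off_le q k h)
      (fun G A B h => cnt_smallUnion_size_le h.left) Q hQ G₀

end TraceCounts

def coreBound (q n w r e κ k : ℕ) (M N : ℝ) : ℝ :=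
  (n : ℝ) ^ k * (2 ^ k ^ 2 * N * (strBound q n (w + k) r e *
    (nearBound q n (w + k) κ ^ k * ((k : ℕ) ^ k * M))))

lemma cnt_tripleLeft_le (q n : ℕ) (b : Prop) (w r e k p : ℕ) :
    cnt (fun G : SimpleGraph (Fin n) => Cls G ∧ TripleLeft b w r e k p G) ≤
      coreBound q n w r e k 3 (2 ^ (3 * ((n : ℝ) / 2 + e) - (p - 3 : ℕ) / 50))
        (numCls (n - 3)) := by
  refine (cnt_mono fun G hG => ⟨hG.1, hG.2.core hG.1.1⟩).trans (cnt_agree_le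
    (fun Q G => CoreDef (w + 3) r e 3 (fun _ B => B) (fun _ A _ S => NearConst A S k)
      (AvoidPairs b (p - 3)) Q G) ?_ fun Q G₀ hQ _ _ => ?_)
  · have := strBound_nonneg q n (w + 3) r e
    have := nearBound_nonneg q n (w + 3) k
    positivity
  · have := cnt_core_tripleLeft_le q w r e k b (p - 3) Q hQ G₀
    rwa [Fintype.card_fin] at this

lemma cnt_tripleRight_le (q n w r e k p : ℕ) :
    cnt (fun G : SimpleGraph (Fin n) => Cls G ∧ TripleRight w r e k p G) ≤
      coreBound q n w r e k 3 (2 ^ (3 * ((n : ℝ) / 2 + e) - (p - 3 : ℕ) / 50))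
        (numCls (n - 3)) := by
  refine (cnt_mono fun G hG => ⟨hG.1, hG.2.core hG.1.1⟩).trans (cnt_agree_le
    (fun Q G => CoreDef (w + 3) r e 3 (fun A _ => A) (fun G _ B S => PartLike G B k S)
      (AvoidPairs True (p - 3)) Q G) ?_ fun Q G₀ hQ _ _ => ?_)
  · have := strBound_nonneg q n (w + 3) r e
    have := nearBound_nonneg q n (w + 3) k
    positivity
  · have := cnt_core_tripleRight_le q w r e k (p - 3) Q hQ G₀
    rwa [Fintype.card_fin] at this

lemma cnt_pairRight_le (q n w r e k u : ℕ) :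
    cnt (fun G : SimpleGraph (Fin n) => Cls G ∧ PairRight w r e k u G) ≤
      coreBound q n w r e k 2 (2 ^ ((n : ℝ) / 2 + e) * 3 ^ u) (numCls (n - 2)) := by
  refine (cnt_mono fun G hG => ⟨hG.1, hG.2.core⟩).trans (cnt_agree_le
    (fun Q G => CoreDef (w + 2) r e 2 (fun A _ => A) (fun G _ B S => PartLike G B k S)
      (fun _ S g => SmallUnion u S g) Q G) ?_ fun Q G₀ hQ _ _ => ?_)
  · have := strBound_nonneg q n (w + 2) r e
    have := nearBound_nonneg q n (w + 2) k
    positivity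
  · have := cnt_core_pairRight_le q w r e k u Q hQ G₀
    rwa [Fintype.card_fin] at this

section HomogeneousSets
variable {V : Type*}

lemma ParFree.exists_repFun {G : SimpleGraph V} {T U : Finset V} (h : ParFree G T) (hU : U ⊆ T)
    (hh : Homog G U) : ∃ (f : V → V) (b : Prop), RepFun T U f ∧
      ∀ u ∈ T, ∀ v ∈ T, u ≠ v → (G.Adj u v ↔ (b ↔ f u = f v)) := by
  rcases h with h | h
  · obtain ⟨f, hf, hG⟩ := h.exists_repFun hU hh
    exact ⟨f, True, hf, fun u hu v hv huv => by rw [hG u hu v hv]; tauto⟩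
  · obtain ⟨f, hf, hG⟩ := h.exists_repFun hU hh.compl
    refine ⟨f, False, hf, fun u hu v hv huv => ?_⟩
    have := hG u hu v hv
    rw [SimpleGraph.compl_adj] at this
    tauto

variable [Fintype V]

/-- Apart from a near-clique side `T`, the graph is a union of cliques with a large
homogeneous set. -/
def HomBad (w e z : ℕ) (G : SimpleGraph V) : Prop :=
  ∃ T U Z : Finset V, (U ⊆ T ∧ (T \ U).card ≤ w ∧ Z ⊆ Tᶜ ∧ z ≤ Z.card ∧
    2 * Tᶜ.card ≤ Fintype.card V + 2 * e) ∧
    G.IsClique (U : Set V) ∧ ParFree G T ∧ P3Free G Tᶜ ∧ Homog G Z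

def homBound (n w e z : ℕ) : ℝ :=
  (2 ^ n * (2 ^ n * 2 ^ n)) * (((2 * (n : ℝ) ^ (w + 1)) *
    (2 * (2 * (n : ℝ) ^ ((n + 2 * e) / 2 - z + 1)))) *
    2 ^ ((n : ℝ) ^ 2 / 4))

lemma cnt_homBad_fibre_le {w e z : ℕ} {T U Z : Finset V} (hV : 1 ≤ Fintype.card V) (hU : U ⊆ T)
    (hw : (T \ U).card ≤ w) (hZ : Z ⊆ Tᶜ) (hz : z ≤ Z.card)
    (he : 2 * Tᶜ.card ≤ Fintype.card V + 2 * e) :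
    cnt (fun G : SimpleGraph V => G.IsClique (U : Set V) ∧ ParFree G T ∧ P3Free G Tᶜ ∧ Homog G Z) ≤
      ((2 * (Fintype.card V : ℝ) ^ (w + 1)) *
        (2 * (2 * (Fintype.card V : ℝ) ^ ((Fintype.card V + 2 * e) / 2 - z + 1)))) *
        2 ^ ((Fintype.card V : ℝ) ^ 2 / 4) := by
  have hV' : (1 : ℝ) ≤ Fintype.card V := by exact_mod_cast hV
  have : Nonempty V := Fintype.card_pos_iff.1 hV
  refine cnt_exists_le (fun i : (V → V) × Prop × (V → V) =>
      RepFun T U i.1 ∧ (True ∧ RepFun Tᶜ Z i.2.2))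
    (fun i G => (∀ u ∈ T, ∀ v ∈ T, u ≠ v → (G.Adj u v ↔ (i.2.1 ↔ i.1 u = i.1 v))) ∧
      ∀ u ∈ Tᶜ, ∀ v ∈ Tᶜ, (G.Adj u v ↔ u ≠ v ∧ i.2.2 u = i.2.2 v)) (by positivity) ?_ ?_ ?_
  · rw [cnt_prod (RepFun T U) (fun x : Prop × (V → V) => True ∧ RepFun Tᶜ Z x.2),
      cnt_prod (fun _ : Prop => True) (RepFun Tᶜ Z), cnt_true, Nat.card_eq_fintype_card,
      Fintype.card_prop]
    refine mul_le_mul ?_ (mul_le_mul (by norm_num) ?_ (cnt_nonneg _) (by norm_num))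
      (mul_nonneg (by positivity) (cnt_nonneg _)) (by positivity)
    · refine (cnt_repFun_le T U hU).trans ?_
      rw [Finset.card_sdiff_of_subset hU] at hw
      gcongr
    · refine (cnt_repFun_le Tᶜ Z hZ).trans ?_
      gcongr
      omega
  · rintro G ⟨h1, h2, h3, h4⟩
    obtain ⟨f, b, hf, hG⟩ := h2.exists_repFun hU (Or.inl h1)
    obtain ⟨f', hf', hG'⟩ := h3.exists_repFun hZ h4
    exact ⟨(f, b, f'), ⟨hf, trivial, hf'⟩, hG, hG'⟩
  · rintro ⟨f, b, f'⟩ -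
    refine (cnt_inj_le (q := fun _ : T → (Tᶜ : Finset V) → Prop => True)
      (fun G => fun a b => G.Adj a b) (fun _ _ => trivial) ?_).trans ?_
    · rintro G G' ⟨h1, h2⟩ ⟨h1', h2'⟩ h
      have hcr : ∀ a ∈ T, ∀ b ∉ T, (G.Adj a b ↔ G'.Adj a b) := fun a ha b hb =>
        iff_of_eq (congrFun (congrFun h ⟨a, ha⟩) ⟨b, Finset.mem_compl.2 hb⟩)
      ext u v
      by_cases hu : u ∈ T <;> by_cases hv : v ∈ T
      · by_cases huv : u = v
        · simp [huv]
        · rw [h1 u hu v hv huv, h1' u hu v hv huv]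
      · exact hcr u hu v hv
      · rw [G.adj_comm, G'.adj_comm]
        exact hcr v hv u hu
      · rw [h2 u (Finset.mem_compl.2 hu) v (Finset.mem_compl.2 hv),
          h2' u (Finset.mem_compl.2 hu) v (Finset.mem_compl.2 hv)]
    · rw [cnt_cross]
      exact Real.rpow_le_rpow_of_exponent_le (by norm_num) (card_mul_card_le disjoint_compl_right)

lemma cnt_homBad_le (w e z : ℕ) (hV : 1 ≤ Fintype.card V) :
    cnt (fun G : SimpleGraph V => HomBad w e z G) ≤ homBound (Fintype.card V) w e z := by
  refine cnt_exists_le (fun i : Finset V × Finset V × Finset V => i.2.1 ⊆ i.1 ∧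
    (i.1 \ i.2.1).card ≤ w ∧
      i.2.2 ⊆ i.1ᶜ ∧ z ≤ i.2.2.card ∧ 2 * (i.1ᶜ).card ≤ Fintype.card V + 2 * e)
    (fun i G => G.IsClique (i.2.1 : Set V) ∧ ParFree G i.1 ∧ P3Free G i.1ᶜ ∧ Homog G i.2.2)
    (by positivity) ?_ ?_ ?_
  · refine (cnt_le_card _).trans (le_of_eq ?_)
    rw [Nat.card_eq_fintype_card]
    simp only [Fintype.card_prod, Fintype.card_finset]
    push_cast
    rfl
  · rintro G ⟨T, U, Z, h, h'⟩
    exact ⟨(T, U, Z), h, h'⟩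
  · rintro ⟨T, U, Z⟩ ⟨h1, h2, h3, h4, h5⟩
    exact cnt_homBad_fibre_le hV h1 h2 h3 h4 h5

end HomogeneousSets

section Attachment
variable {V : Type*} {G : SimpleGraph V} {A B : Finset V} {r : ℕ}

lemma not_pack_split (hf : C5Free G) (hc : G.IsClique (A : Set V)) (hg : Gen G A B 2 2 r) {x : V}
    (hxA : x ∉ A) (h : ¬ NearConst A (nb G x A) (2 * r)) :
    ¬ Pack B 2 (fun t => G.Adj x (t 0) ∧ ¬ G.Adj x (t 1) ∧ G.Adj (t 0) (t 1)) r := by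
  intro hP
  simp only [NearConst, not_or, not_le] at h
  have hA : Pack A 2 (fun t => G.Adj x (t 0) ∧ ¬ G.Adj x (t 1)) r := by
    refine (pack_pair (P := A ∩ nb G x A) (N := A \ nb G x A) (r := r)
      (Finset.disjoint_left.2 fun v => ?_) (by omega) (by omega)).imp ?_ ?_
    · simp only [Finset.mem_inter, Finset.mem_sdiff]; tauto
    · intro v; simp only [Finset.mem_inter, Finset.mem_sdiff, Finset.mem_union]; tauto
    · simp only [Finset.mem_inter, Finset.mem_sdiff, mem_nb]
      tauto
  obtain ⟨s, t, hs, ht, hsA, -, hsi, -, hst⟩ := hg.exists_pattern hA hP fun k l => k = 1 ∧ l = 1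
  have hs01 : G.Adj (s 0) (s 1) := hc (hsA 0) (hsA 1) (hsi.ne (by decide))
  have hxs : x ≠ s 1 := fun h => hxA (h ▸ hsA 1)
  exact hf _ _ _ _ _ (IsP3.c5 (G := G) (x := x) (y := s 0) (z := s 1) (p := t 1) (q := t 0)
    ⟨hs.1, hs01, hxs, hs.2⟩ ht.2.2.symm ((hst 1 1).2 ⟨rfl, rfl⟩) ht.1 ht.2.1
    (fun h => by simpa using (hst 0 1).1 h) (fun h => by simpa using (hst 0 0).1 h)
    (fun h => by simpa using (hst 1 0).1 h))

lemma not_pack_nonadj (hf : C5Free G) (hc : G.IsClique (A : Set V)) (hg : Gen G A B 2 2 r) {x : V}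
    (h : ¬ NearConst A (nb G x A) (2 * r)) :
    ¬ Pack B 2 (fun t => G.Adj x (t 0) ∧ G.Adj x (t 1) ∧ ¬ G.Adj (t 0) (t 1)) r := by
  intro hP
  simp only [NearConst, not_or, not_le] at h
  have hA : Pack A 2 (fun t => ¬ G.Adj x (t 0) ∧ ¬ G.Adj x (t 1)) r := by
    refine (pack_of_card (U := A \ nb G x A) (k := 2) (r := r) (by omega)).imp
      Finset.sdiff_subset fun t _ ht _ => ?_
    have h0 := ht 0
    have h1 := ht 1
    simp only [Finset.mem_sdiff, mem_nb] at h0 h1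
    tauto
  obtain ⟨s, t, hs, ht, hsA, -, hsi, hti, hst⟩ := hg.exists_pattern hA hP fun k l => (k : ℕ) = l
  have hs01 : G.Adj (s 0) (s 1) := hc (hsA 0) (hsA 1) (hsi.ne (by decide))
  exact hf _ _ _ _ _ (IsP3.c5 (G := G) (x := t 0) (y := x) (z := t 1) (p := s 1) (q := s 0)
    ⟨ht.1.symm, ht.2.1, hti.ne (by decide), ht.2.2⟩ hs01.symm ((hst 1 1).2 rfl).symm
    ((hst 0 0).2 rfl).symm
    (fun h => by simpa using (hst 1 0).1 h.symm) hs.2 hs.1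
    (fun h => by simpa using (hst 0 1).1 h.symm))

lemma partLike_of_not_nearConst (hf : C5Free G) (hc : G.IsClique (A : Set V))
    (hg : Gen G A B 2 2 r) {x : V} (hxA : x ∉ A)
    (h : ¬ NearConst A (nb G x A) (2 * r)) : PartLike G B (4 * r) (nb G x B) := by
  obtain ⟨Z₁, -, hZ₁, h₁⟩ := exists_of_not_pack (not_pack_split hf hc hg hxA h)
  obtain ⟨Z₂, -, hZ₂, h₂⟩ := exists_of_not_pack (not_pack_nonadj hf hc hg h)
  refine ⟨Z₁ ∪ Z₂, (Finset.card_union_le _ _).trans (by omega), fun a ha haB haZ b hb hbZ => ?_⟩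
  have ha' := (mem_nb.1 ha).2
  simp only [Finset.mem_union, not_or] at haZ hbZ
  by_cases hab : b = a
  · exact iff_of_true (hab ▸ ha) (Or.inl hab)
  have hinj : Function.Injective ![a, b] := by
    rw [← List.nodup_ofFn]
    simpa using Ne.symm hab
  have h₁ := h₁ ![a, b] hinj (by simp [Fin.forall_fin_two, haB, hb, haZ, hbZ])
  have h₂ := h₂ ![a, b] hinj (by simp [Fin.forall_fin_two, haB, hb, haZ, hbZ])
  simp only [Matrix.cons_val_zero, Matrix.cons_val_one] at h₁ h₂
  rw [mem_nb]
  tauto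

lemma P3Free.partLike (h : P3Free G B) {x : V} (hx : x ∈ B) {k : ℕ} (hk : 1 ≤ k) :
    PartLike G B k (nb G x B) := by
  refine ⟨{x}, by simpa using hk, fun a ha haB haZ b hb hbZ => ?_⟩
  simp only [Finset.mem_singleton] at haZ hbZ
  have hxa := (mem_nb.1 ha).2
  rw [mem_nb]
  constructor
  · rintro ⟨-, hxb⟩
    by_cases hab : b = a
    · exact Or.inl hab
    · exact Or.inr (h.adj haB hx hb hxa.symm hxb (Ne.symm hab))
  · rintro (rfl | hab)
    · exact ⟨hb, hxa⟩
    · exact ⟨hb, h.adj hx haB hb hxa hab (Ne.symm hbZ)⟩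

lemma nearConst_of_clique (hc : G.IsClique (A : Set V)) {x : V} (hx : x ∈ A) {k : ℕ} (hk : 1 ≤ k) :
    NearConst A (nb G x A) k := by
  right
  refine (Finset.card_le_card (t := {x}) fun v hv => ?_).trans (by simpa using hk)
  simp only [Finset.mem_sdiff, mem_nb, Finset.mem_singleton] at hv ⊢
  by_contra hvx
  exact hv.2 ⟨hv.1, hc hx hv.1 (Ne.symm hvx)⟩

end Attachment

section Connectivity
variable {V : Type*} {G : SimpleGraph V}

/-- Reachability in the graph with the vertices in `S` deleted. -/
def ReachOff (G : SimpleGraph V) (S : Finset V) (a v : V) : Prop :=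
  ∃ (ha : a ∈ ((S : Set V)ᶜ)) (hv : v ∈ ((S : Set V)ᶜ)), (G.induce ((S : Set V)ᶜ)).Reachable
    ⟨a, ha⟩ ⟨v, hv⟩

lemma ReachOff.refl {S : Finset V} {a : V} (ha : a ∉ S) : ReachOff G S a a :=
  ⟨by simpa using ha, by simpa using ha, SimpleGraph.Reachable.refl _⟩

lemma ReachOff.adj {S : Finset V} {a v y : V} (h : ReachOff G S a v) (hv : y ∉ S)
    (hvy : G.Adj v y) : ReachOff G S a y := by
  obtain ⟨ha, hv', h⟩ := h
  exact ⟨ha, by simpa using hv, h.trans (SimpleGraph.Adj.reachable (by simpa using hvy))⟩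

lemma connected_of_reachOff {S : Finset V} {a : V} (ha : a ∉ S)
    (h : ∀ v ∉ S, ReachOff G S a v) : (G.induce ((S : Set V)ᶜ)).Connected := by
  rw [SimpleGraph.connected_iff_exists_forall_reachable]
  refine ⟨⟨a, by simpa using ha⟩, fun ⟨v, hv⟩ => ?_⟩
  exact (h v (by simpa using hv)).2.2

variable [Fintype V]

/-- A unipolar arrangement with central clique `T`, close to `A` and `B`, with small parts and
with large joint neighbourhoods. -/
structure Fine (w u z : ℕ) (G : SimpleGraph V) (T A B : Finset V) : Prop where
  left : A ⊆ T
  left_rest : (T \ A).card ≤ w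
  right : B ⊆ Tᶜ
  right_rest : (Tᶜ \ B).card ≤ w
  clique : G.IsClique (T : Set V)
  p3Free : P3Free G Tᶜ
  homog : ∀ Z ⊆ Tᶜ, Homog G Z → Z.card < z
  joint : ∀ x ∉ T, ∀ y ∉ T, x ≠ y → u < (nb G x A ∪ nb G y A).card

theorem exists_fine {w r e p p' u z : ℕ} {G : SimpleGraph V} {A B : Finset V} (hf : C5Free G)
    (h : SStr w r e G A B) (hr : 1 ≤ r) (hL : ∀ b, ¬ TripleLeft b w r e (2 * r) p G)
    (hR : ¬ TripleRight w r e (4 * r) p' G) (hP : ¬ PairRight w r e (4 * r) u G)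
    (hH : ¬ HomBad w (e + w) z G) (hA : 2 ≤ A.card) (hA' : p' * 2 ≤ A.card)
    (hB : 2 * p + z ≤ B.card) (hB' : 4 * p + 2 ≤ B.card) : ∃ T, Fine w u z G T A B := by
  set T : Finset V := Finset.univ.filter fun x => x ∉ B ∧ NearConst A (nb G x A) (2 * r) with hT
  have mem_T : ∀ x, x ∈ T ↔ x ∉ B ∧ NearConst A (nb G x A) (2 * r) := fun x => by simp [hT]
  have hAT : A ⊆ T := fun x hx => (mem_T x).2 ⟨Finset.disjoint_left.1 h.disj hx,
    nearConst_of_clique h.clique hx (by omega)⟩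
  have hBT : B ⊆ Tᶜ := fun x hx => Finset.mem_compl.2 fun hx' => ((mem_T x).1 hx').1 hx
  have hTA : (T \ A).card ≤ w := (Finset.card_le_card fun v hv => by
    simp only [Finset.mem_sdiff, mem_T, Finset.mem_compl, Finset.mem_union] at hv ⊢;
      tauto).trans h.rest
  have hxA : ∀ x ∉ T, x ∉ B → ¬ NearConst A (nb G x A) (2 * r) := fun x hx hxB hn =>
    hx ((mem_T x).2 ⟨hxB, hn⟩)
  have hTB : (Tᶜ \ B).card ≤ w := (Finset.card_le_card fun v hv => by
    simp only [Finset.mem_sdiff, Finset.mem_compl, Finset.mem_union] at hv ⊢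
    exact fun h' => h'.elim (fun h' => hv.1 (hAT h')) hv.2).trans h.rest
  have hpart : ∀ x ∉ T, PartLike G B (4 * r) (nb G x B) := fun x hx => by
    by_cases hxB : x ∈ B
    · exact h.p3Free.partLike hxB (by omega)
    · exact partLike_of_not_nearConst hf h.clique h.gen (fun h' => hx (hAT h')) (hxA x hx hxB)
  have hinj3 : ∀ {H : SimpleGraph V} {x y v : V}, IsP3 H x y v → Function.Injective ![x, y, v] := by
    intro H x y v hxyv
    rw [← List.nodup_ofFn]
    have := hxyv.ne
    simp [this]
  have hp3 : P3Free G Tᶜ := fun x hx y hy v hv hxyv => hR ⟨A, B, h,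
    (pack_of_card hA').imp le_rfl fun t ht hm _ =>
      iff_of_true trivial (h.clique (hm 0) (hm 1) (ht.ne (by decide))),
    ![x, y, v], hinj3 hxyv, by
      simp only [Finset.mem_compl] at hx hy hv
      simp [Fin.forall_fin_succ, hpart, hx, hy, hv], hxyv⟩
  have hTL : ∀ b, Pack B 2 (fun t => (b ↔ G.Adj (t 0) (t 1))) p → P3Free (if b then G else Gᶜ) T :=
    fun b hp x hx y hy v hv hxyv => hL b ⟨A, B, h, hp, ![x, y, v], hinj3 hxyv, by
      rw [mem_T] at hx hy hv
      simp [Fin.forall_fin_succ, hx, hy, hv], hxyv⟩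
  have hst : ¬ Pack B 2 (fun t => (True ↔ G.Adj (t 0) (t 1))) p → ∃ Z ⊆ B, Z.card ≤ 2 * p ∧
      Gᶜ.IsClique ((B \ Z : Finset V) : Set V) := fun hp =>
    stable_of_not_pack (by simpa using hp)
  have hcl : ¬ Pack B 2 (fun t => (False ↔ G.Adj (t 0) (t 1))) p → ∃ Z ⊆ B, Z.card ≤ 2 * p ∧
      G.IsClique ((B \ Z : Finset V) : Set V) := fun hp =>
    clique_of_not_pack (by simpa using hp)
  have hcard : ∀ Z : Finset V, Z.card ≤ 2 * p → z ≤ (B \ Z).card := fun Z hZ => by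
    have := Finset.le_card_sdiff Z B
    omega
  have hhom : ParFree G T → ∀ Z ⊆ Tᶜ, Homog G Z → Z.card < z := fun hpar Z hZ hh => by
    by_contra! hz
    have h1 := h.right
    have h2 : Tᶜ.card ≤ B.card + w := by
      have := Finset.card_sdiff_add_card_eq_card hBT
      omega
    exact hH ⟨T, A, Z, ⟨hAT, hTA, hZ, hz, by omega⟩, h.clique, hpar, hp3, hh⟩
  have hpar : ParFree G T := by
    by_cases hp : Pack B 2 (fun t => (True ↔ G.Adj (t 0) (t 1))) p
    · exact Or.inl (by simpa using hTL True hp)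
    by_cases hn : Pack B 2 (fun t => (False ↔ G.Adj (t 0) (t 1))) p
    · exact Or.inr (by simpa using hTL False hn)
    obtain ⟨Z₁, -, hZ₁, h1⟩ := hst hp
    obtain ⟨Z₂, -, hZ₂, h2⟩ := hcl hn
    have h3 : 1 < (B \ (Z₁ ∪ Z₂)).card := by
      have h4 := Finset.le_card_sdiff (Z₁ ∪ Z₂) B
      have h5 := Finset.card_union_le Z₁ Z₂
      omega
    obtain ⟨x, hx, y, hy, hxy⟩ := Finset.one_lt_card.1 h3
    simp only [Finset.mem_sdiff, Finset.mem_union, not_or] at hx hy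
    have h4 := h1 (x := x) (by simp [hx]) (y := y) (by simp [hy]) hxy
    have h5 := h2 (x := x) (by simp [hx]) (y := y) (by simp [hy]) hxy
    exact absurd h5 ((SimpleGraph.compl_adj _ _ _).1 h4).2
  have h1 : P3Free G T := by
    by_contra hcon
    obtain ⟨Z, -, hZ, h1⟩ := hst fun hp => hcon (by simpa using hTL True hp)
    exact absurd (hcard Z hZ) (not_le.2 (hhom hpar _ (Finset.sdiff_subset.trans hBT) (Or.inr h1)))
  have h2 : P3Free Gᶜ T := by
    by_contra hcon
    obtain ⟨Z, -, hZ, h1⟩ := hcl fun hp => hcon (by simpa using hTL False hp)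
    exact absurd (hcard Z hZ) (not_le.2 (hhom hpar _ (Finset.sdiff_subset.trans hBT) (Or.inl h1)))
  refine ⟨T, hAT, hTA, hBT, hTB, (homog_of_p3Free h1 h2).resolve_right fun hc => ?_, hp3, hhom hpar,
    fun x hx y hy hxy => ?_⟩
  · obtain ⟨x, hx, y, hy, hxy⟩ := Finset.one_lt_card.1 hA
    have h3 := hc (hAT hx) (hAT hy) hxy
    exact ((SimpleGraph.compl_adj _ _ _).1 h3).2 (h.clique hx hy hxy)
  · by_contra! hu
    exact hP ⟨A, B, h, ![x, y], by rw [← List.nodup_ofFn]; simpa using hxy, by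
      simp [Fin.forall_fin_two, hpart, hx, hy], hu⟩

variable {w u z : ℕ} {T A B : Finset V}

lemma Fine.isUnipolar (h : Fine w u z G T A B) : IsUnipolar G := by
  refine ⟨T, isUnipolarArrangement_iff.2 ⟨h.clique, fun x y v hx hy hv hxy hyv hxv => ?_⟩⟩
  exact h.p3Free.adj (Finset.mem_compl.2 hx) (Finset.mem_compl.2 hy) (Finset.mem_compl.2 hv)
    hxy hyv hxv

/-- Deleting fewer vertices than the minimum degree leaves a connected graph. -/
def Conn (G : SimpleGraph V) : Prop :=
  ∀ S : Finset V, S.card < G.minDegree → (G.induce ((S : Set V)ᶜ)).Connected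

lemma lt_card_nb {G : SimpleGraph V} {S : Finset V} (h : S.card < G.minDegree) (v : V) :
    S.card < (nb G v Finset.univ).card := by
  have h1 := h.trans_le (G.minDegree_le_degree v)
  rw [← SimpleGraph.card_neighborFinset_eq_degree] at h1
  refine h1.trans_eq (congrArg Finset.card ?_)
  ext y
  simp [mem_nb]

lemma exists_nb {G : SimpleGraph V} {S : Finset V} (h : S.card < G.minDegree) (v : V) :
    ∃ y ∉ S, G.Adj v y := by
  obtain ⟨y, hy, hyS⟩ := Finset.exists_mem_notMem_of_card_lt_card (lt_card_nb h v)
  exact ⟨y, hyS, (mem_nb.1 hy).2⟩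

lemma Fine.conn (h : Fine w u z G T A B) {b : V} (hb : b ∈ B)
    (hdeg : 5 * (nb G b A).card ≤ 3 * A.card)
    (hu : 3 * A.card + 5 * (w + z) ≤ 5 * u) (hA : u < A.card) : Conn G := by
  intro S hS
  have hbT := h.right hb
  have h1 : (nb G b Finset.univ).card ≤ (nb G b A).card + (T \ A).card + (nb G b Tᶜ).card := by
    have h2 := Finset.card_union_le (nb G b A ∪ T \ A) (nb G b Tᶜ)
    have h3 := Finset.card_union_le (nb G b A) (T \ A)
    refine (Finset.card_le_card (t := nb G b A ∪ T \ A ∪ nb G b Tᶜ) fun v hv => ?_).trans (by omega)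
    simp only [mem_nb, Finset.mem_union, Finset.mem_sdiff, Finset.mem_compl] at hv ⊢
    tauto
  have h2 : (nb G b Tᶜ).card < z := h.homog _ (nb_subset _ _ _) (Or.inl fun x hx y hy hxy => by
    simp only [Finset.mem_coe, mem_nb] at hx hy
    exact h.p3Free.adj hx.1 hbT hy.1 hx.2.symm hy.2 hxy)
  have h3 := h.left_rest
  have h4 := lt_card_nb hS b
  have hSu : S.card < u := by omega
  obtain ⟨a, ha, haS⟩ := Finset.exists_mem_notMem_of_card_lt_card (hSu.trans hA)
  have hTr : ∀ v ∈ T, v ∉ S → ReachOff G S a v := fun v hv hvS => by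
    by_cases hav : a = v
    · exact hav ▸ ReachOff.refl haS
    · exact (ReachOff.refl haS).adj hvS (h.clique (h.left ha) hv hav)
  refine connected_of_reachOff haS fun v hvS => ?_
  by_cases hv : v ∈ T
  · exact hTr v hv hvS
  obtain ⟨y, hyS, hvy⟩ := exists_nb hS v
  by_cases hy : y ∈ T
  · exact (hTr y hy hyS).adj hvS hvy.symm
  obtain ⟨c, hc, hcS⟩ := Finset.exists_mem_notMem_of_card_lt_card
      (hSu.trans (h.joint v hv y hy hvy.ne))
  rcases Finset.mem_union.1 hc with hc | hc <;> rw [mem_nb] at hc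
  · exact (hTr c (h.left hc.1) hcS).adj hvS hc.2.symm
  · exact ((hTr c (h.left hc.1) hcS).adj hyS hc.2.symm).adj hvS hvy.symm

lemma Fine.conn_compl (h : Fine w u z G T A B) {a : V} (ha : a ∈ A)
    (hdeg : 5 * (nb Gᶜ a B).card ≤ 3 * B.card) (hu : 3 * B.card + 5 * w ≤ 5 * u)
    (hB : u + z ≤ B.card) : Conn Gᶜ := by
  intro S hS
  have h1 : (nb Gᶜ a Finset.univ).card ≤ (nb Gᶜ a B).card + (Tᶜ \ B).card := by
    refine (Finset.card_le_card (t := nb Gᶜ a B ∪ Tᶜ \ B) fun v hv => ?_).trans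
      (Finset.card_union_le _ _)
    simp only [mem_nb, Finset.mem_union, Finset.mem_sdiff, Finset.mem_compl] at hv ⊢
    have : v ∉ T := fun hvT => ((SimpleGraph.compl_adj _ _ _).1 hv.2).2
      (h.clique (h.left ha) hvT hv.2.ne)
    tauto
  have h3 := h.right_rest
  have h4 := lt_card_nb hS a
  have hBS : z ≤ (B \ S).card := by
    have := Finset.le_card_sdiff S B
    omega
  have hnc : ¬ G.IsClique ((B \ S : Finset V) : Set V) := fun hc =>
    absurd hBS (not_le.2 (h.homog _ (Finset.sdiff_subset.trans h.right) (Or.inl hc)))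
  simp only [SimpleGraph.IsClique, Set.Pairwise, Finset.mem_coe] at hnc
  push Not at hnc
  obtain ⟨b, hb, b', hb', hbb, hnb⟩ := hnc
  rw [Finset.mem_sdiff] at hb hb'
  have hbb' : Gᶜ.Adj b b' := (SimpleGraph.compl_adj _ _ _).2 ⟨hbb, hnb⟩
  have hr' : ReachOff Gᶜ S b b' := (ReachOff.refl hb.2).adj hb'.2 hbb'
  have hTr : ∀ v ∉ T, v ∉ S → ReachOff Gᶜ S b v := fun v hv hvS => by
    by_cases hbv : b = v
    · exact hbv ▸ ReachOff.refl hb.2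
    by_cases hbv' : b' = v
    · exact hbv' ▸ hr'
    by_cases hadj : G.Adj b v
    · refine hr'.adj hvS ((SimpleGraph.compl_adj _ _ _).2 ⟨hbv', fun hadj' => hnb ?_⟩)
      exact h.p3Free.adj (h.right hb.1) (Finset.mem_compl.2 hv) (h.right hb'.1) hadj hadj'.symm hbb
    · exact (ReachOff.refl hb.2).adj hvS ((SimpleGraph.compl_adj _ _ _).2 ⟨hbv, hadj⟩)
  refine connected_of_reachOff hb.2 fun v hvS => ?_
  by_cases hv : v ∈ T
  · obtain ⟨y, hyS, hvy⟩ := exists_nb hS v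
    have hy : y ∉ T := fun hy => ((SimpleGraph.compl_adj _ _ _).1 hvy).2 (h.clique hv hy hvy.ne)
    exact (hTr y hy hyS).adj hvS hvy.symm
  · exact hTr v hv hvS

end Connectivity

section Deterministic
variable {V : Type*}

lemma parFree_of_isClique {G : SimpleGraph V} {U : Finset V} (h : G.IsClique (U : Set V)) :
    ParFree G U :=
  Or.inl fun _ hx _ _ _ hz hp => hp.2.2.2 (h hx hz hp.2.2.1)

variable [Fintype V]

/-- The numerical parameters of the exceptional events. -/
structure Scale where
  m : ℕ
  t : ℕ
  s : ℕ
  r₀ : ℕ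
  w₀ : ℕ
  r : ℕ
  w : ℕ
  e : ℕ
  p : ℕ
  p' : ℕ
  u : ℕ
  z : ℕ

/-- The relations between the parameters used for graphs on `n` vertices. -/
structure Scale.Fits (P : Scale) (n : ℕ) : Prop where
  one_le_m : 1 ≤ P.m
  m_sq : P.m ^ 2 ≤ n
  w₀_ge : 2 * P.t + 6 * P.r₀ ≤ P.w₀
  w_ge : P.w₀ + 9 * P.r ≤ P.w
  one_le_r : 1 ≤ P.r
  w_le : 100000 * P.w ≤ n
  e_le : 100000 * P.e ≤ n
  p_le : 10 * P.p ≤ n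
  p'_le : 5 * P.p' ≤ n
  u_ge : 304 * n ≤ 1000 * P.u
  u_le : 1000 * P.u ≤ 310 * n
  z_le : 1000 * P.z ≤ n

def Exceptional (P : Scale) (G : SimpleGraph V) : Prop :=
  (∃ Q : Finset V, Q.card = P.m ∧ FewTraces ((P.m + 1) ^ (P.t + P.t ^ 2)) Q G) ∨
  (∃ Q : Finset V, Q.card = 2 * P.t ∧ PairDef P.t (2 * P.s) P.r₀ Q G) ∨
  GenBad P.w₀ P.r G ∨ SizeBad P.w P.e G ∨ DegBad P.w G ∨
  TripleLeft True P.w P.r P.e (2 * P.r) P.p G ∨ TripleLeft False P.w P.r P.e (2 * P.r) P.p G ∨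
  TripleRight P.w P.r P.e (4 * P.r) P.p' G ∨ PairRight P.w P.r P.e (4 * P.r) P.u G ∨
  HomBad P.w (P.e + P.w) P.z G

lemma two_mul_card_le_of_not_sizeBad {G : SimpleGraph V} {w e : ℕ} (h : ¬ SizeBad w e G)
    {U₁ U₂ : Finset V} (hd : Disjoint U₁ U₂) (hw : (U₁ ∪ U₂)ᶜ.card ≤ w) (h1 : ParFree G U₁)
    (h2 : ParFree G U₂) :
    2 * U₁.card ≤ Fintype.card V + 2 * e ∧ 2 * U₂.card ≤ Fintype.card V + 2 * e ∧
      Fintype.card V ≤ U₁.card + U₂.card + w := by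
  have hcard : Fintype.card V ≤ U₁.card + U₂.card + w := by
    rw [Finset.card_compl, Finset.card_union_of_disjoint hd] at hw
    omega
  refine ⟨?_, ?_, hcard⟩ <;> by_contra! hlt
  · exact h ⟨U₁, U₂, hd, hw, h1, h2, hlt⟩
  · exact h ⟨U₂, U₁, hd.symm, by rwa [Finset.union_comm], h2, h1, hlt⟩

lemma exists_degree_le {G : SimpleGraph V} {w : ℕ} (h : ¬ DegBad w G)
    {U₁ U₂ : Finset V} (hd : Disjoint U₁ U₂) (hw : (U₁ ∪ U₂)ᶜ.card ≤ w) (h1 : ParFree G U₁)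
    (h2 : ParFree G U₂) : ∃ b ∈ U₂, 5 * (nb G b U₁).card ≤ 3 * U₁.card := by
  by_contra! hcon
  exact h ⟨U₁, U₂, hd, hw, h1, h2, hcon⟩

lemma Str.conn {P : Scale} {G : SimpleGraph V} {A B : Finset V} (hP : P.Fits (Fintype.card V))
    (hf : C5Free G) (h : Str G A B P.w P.r) (hG : ¬ Exceptional P G) (hG' : ¬ Exceptional P Gᶜ) :
    IsUnipolar G ∧ Conn G ∧ Conn Gᶜ := by
  simp only [Exceptional, not_or] at hG hG'
  obtain ⟨-, -, -, hS, hD, hL, hL', hR, hPR, hH⟩ := hG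
  have hA := parFree_of_isClique h.clique
  have hB : ParFree G B := Or.inl h.p3Free
  obtain ⟨hAc, hBc, hAB⟩ := two_mul_card_le_of_not_sizeBad hS h.disj h.rest hA hB
  obtain ⟨-, -, -, hw₁, hr, hw, he, hp, hp', hu, hu', hz⟩ := hP
  obtain ⟨T, hT⟩ := exists_fine hf ⟨h, hAc, hBc⟩ hr
    (fun b => by by_cases hb : b <;> simp only [hb] <;> assumption) hR hPR hH
    (by omega) (by omega) (by omega) (by omega)
  obtain ⟨b, hb, hb'⟩ := exists_degree_le hD h.disj h.rest hA hB
  obtain ⟨a, ha, ha'⟩ := exists_degree_le hG'.2.2.2.2.1 h.disj.symm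
    (by rw [Finset.union_comm]; exact h.rest) hB.compl hA.compl
  exact ⟨hT.isUnipolar, hT.conn hb hb' (by omega) (by omega),
    hT.conn_compl ha ha' (by omega) (by omega)⟩

theorem conn_of_not_exceptional {P : Scale} {G : SimpleGraph V} (hP : P.Fits (Fintype.card V))
    {H : Fin P.t → Fin (P.t ^ 2) → Prop} (hH : Generic P.s H) (hc : Cls G)
    (hG : ¬ Exceptional P G) (hG' : ¬ Exceptional P Gᶜ) :
    (IsUnipolar G ∨ IsUnipolar Gᶜ) ∧ Conn G := by
  have hG₀ := hG
  have hG₁ := hG'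
  simp only [Exceptional, not_or] at hG hG'
  obtain ⟨hT, hQ, hgen, hS, -⟩ := hG
  obtain ⟨-, hQ', -⟩ := hG'
  obtain ⟨U₁, U₂, hd, h1, h2, hU⟩ := exists_parts hc hH hP.one_le_m hP.m_sq
    (fun Q hQm _ => by
      by_contra! hlt
      exact hT ⟨Q, hQm, hlt⟩)
    (fun Q hQt => ⟨fun h => hQ ⟨Q, hQt, h⟩, fun h => hQ' ⟨Q, hQt, h⟩⟩)
  obtain ⟨-, -, hw₀, hw₁, hr, hw, he, -⟩ := id hP
  have hU' := hU.trans hw₀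
  have hgen : Gen G U₁ U₂ 2 2 P.r ∧ Gen G U₁ U₂ 2 3 P.r ∧ Gen G U₁ U₂ 3 2 P.r := by
    by_contra hcon
    exact hgen ⟨U₁, U₂, hd, hU', h1, h2, hcon⟩
  have hc1 := two_mul_card_le_of_not_sizeBad hS hd (hU'.trans (by omega)) h1 h2
  have key : ∀ {K : SimpleGraph V}, AnyStr K (P.w₀ + 9 * P.r) P.r → ∃ A B, Str K A B P.w P.r :=
    fun ⟨A, B, h⟩ => ⟨A, B, h.disj, h.clique, h.p3Free, h.gen, h.rest.trans hw₁⟩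
  rcases exists_str hc.1 hd hU' hgen.1 hgen.2.1 hgen.2.2 (by omega) (by omega) with h | h
  · obtain ⟨A, B, h⟩ := key h
    obtain ⟨h3, h4, -⟩ := h.conn hP hc.1 hG₀ hG₁
    exact ⟨Or.inl h3, h4⟩
  · obtain ⟨A, B, h⟩ := key h
    obtain ⟨h3, -, h4⟩ := h.conn hP hc.1.compl hG₁ (by rwa [compl_compl])
    exact ⟨Or.inr h3, by rwa [compl_compl] at h4⟩

end Deterministic

/-! ### Logarithmic form of the bounds -/

section LogBounds

lemma mul_le_two_rpow {x y a b : ℝ} (hy : 0 ≤ y) (hx : x ≤ 2 ^ a) (hyb : y ≤ 2 ^ b) :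
    x * y ≤ 2 ^ (a + b) := by
  rw [Real.rpow_add (by norm_num)]
  exact mul_le_mul hx hyb hy (by positivity)

lemma pow_le_two_rpow {x a : ℝ} (hx : 0 ≤ x) (h : x ≤ 2 ^ a) (k : ℕ) : x ^ k ≤ 2 ^ (a * k) := by
  rw [Real.rpow_mul (by norm_num), Real.rpow_natCast]
  exact pow_le_pow_left₀ hx h k

lemma two_pow_le_two_rpow (k : ℕ) : (2 : ℝ) ^ k ≤ 2 ^ (k : ℝ) := (Real.rpow_natCast 2 k).ge

lemma three_le_two_rpow : (3 : ℝ) ≤ 2 ^ (8 / 5 : ℝ) := by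
  have h : ((3 : ℝ) ^ 5) ^ (1 / 5 : ℝ) ≤ ((2 : ℝ) ^ 8) ^ (1 / 5 : ℝ) :=
    Real.rpow_le_rpow (by norm_num) (by norm_num) (by norm_num)
  rw [← Real.rpow_natCast, ← Real.rpow_natCast, ← Real.rpow_mul (by norm_num),
    ← Real.rpow_mul (by norm_num)] at h
  norm_num at h
  exact h

/-- The binary logarithm. -/
def lg (n : ℕ) : ℝ := Real.logb 2 n

lemma two_rpow_lg {n : ℕ} (hn : 1 ≤ n) : (2 : ℝ) ^ lg n = n :=
  Real.rpow_logb (by norm_num) (by norm_num) (by exact_mod_cast hn)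

lemma lg_nonneg {n : ℕ} (hn : 1 ≤ n) : 0 ≤ lg n :=
  Real.logb_nonneg (by norm_num) (by exact_mod_cast hn)

lemma natCast_pow_le_two_rpow {n : ℕ} (hn : 1 ≤ n) (k : ℕ) : (n : ℝ) ^ k ≤ 2 ^ (lg n * k) :=
  pow_le_two_rpow (Nat.cast_nonneg n) (two_rpow_lg hn).ge k

lemma natCast_add_le_two_rpow {n : ℕ} (hn : 1 ≤ n) : (n : ℝ) + 2 ≤ 2 ^ (lg n + 2) := by
  have : (1 : ℝ) ≤ n := by exact_mod_cast hn
  rw [Real.rpow_add (by norm_num), two_rpow_lg hn]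
  norm_num
  linarith

lemma directBound_le {n : ℕ} (hn : 1 ≤ n) (w : ℕ) :
    directBound n w ≤ 2 ^ (2 * n + 2 * lg n * n + 2 + w * n) := by
  have h1 : (n : ℝ) ^ n * 2 ≤ 2 ^ (lg n * n + 1) :=
    mul_le_two_rpow (by norm_num) (natCast_pow_le_two_rpow hn n) (by norm_num)
  have h2 := two_pow_le_two_rpow n
  have h3 : (2 : ℝ) ^ (w * n) ≤ 2 ^ ((w : ℝ) * n) := by exact_mod_cast two_pow_le_two_rpow (w * n)
  refine (mul_le_two_rpow (by positivity) (mul_le_two_rpow (by positivity)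
    (mul_le_two_rpow (by positivity) h2 h2) (mul_le_two_rpow (by positivity) h1 h1)) h3).trans
    (Real.rpow_le_rpow_of_exponent_le (by norm_num) (le_of_eq ?_))
  ring

lemma strBound_le {n : ℕ} (hn : 1 ≤ n) (q w r e : ℕ) :
    strBound q n w r e ≤ 2 ^ (lg n + 2 + 4 * n / 2 ^ q + q * (4 * r + 4 * w + 2 * e)) := by
  have h1 : (n : ℝ) + 1 ≤ 2 ^ (lg n + 2) := le_trans (by linarith) (natCast_add_le_two_rpow hn)
  have h2 := ballBound_pos q n w
  have h3 := ballBound_pos q n (4 * r + 3 * w + 2 * e)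
  refine (mul_le_two_rpow (by positivity) h1 (mul_le_two_rpow h2.le le_rfl le_rfl)).trans
    (Real.rpow_le_rpow_of_exponent_le (by norm_num) (le_of_eq ?_))
  push_cast
  ring

lemma nearBound_le {n : ℕ} (hn : 1 ≤ n) (q w k : ℕ) :
    nearBound q n w k ≤ 2 ^ (w + lg n + 2 + 2 * n / 2 ^ q + q * k) := by
  have h2 := ballBound_pos q n k
  refine (mul_le_two_rpow (by positivity) (two_pow_le_two_rpow w)
    (mul_le_two_rpow h2.le (natCast_add_le_two_rpow hn) le_rfl)).trans
    (Real.rpow_le_rpow_of_exponent_le (by norm_num) (le_of_eq ?_))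
  ring

lemma coreBound_le {n : ℕ} (hn : 1 ≤ n) (q w r e κ k : ℕ) (hk : k ≤ 3) {M N μ : ℝ} (hN : 0 ≤ N)
    (hM : 0 ≤ M) (hMμ : M ≤ 2 ^ μ) :
    coreBound q n w r e κ k M N ≤ N * 2 ^ (7 * lg n + 31 + 10 * n / 2 ^ q +
      q * (4 * r + 4 * w + 2 * e + 3 * κ + 12) + 3 * w + μ) := by
  have hk' : (k : ℝ) ≤ 3 := by exact_mod_cast hk
  have hl := lg_nonneg hn
  have hkk : ((k : ℕ) : ℝ) ^ k ≤ 2 ^ (5 : ℝ) := by interval_cases k <;> norm_num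
  have hk2 : (2 : ℝ) ^ k ^ 2 ≤ 2 ^ (9 : ℝ) := by interval_cases k <;> norm_num
  have h0 := strBound_nonneg q n (w + k) r e
  have h1 := nearBound_nonneg q n (w + k) κ
  have h := mul_le_two_rpow (by positivity) (natCast_pow_le_two_rpow hn k) (mul_le_two_rpow
    (by positivity) hk2 (mul_le_two_rpow (by positivity) (strBound_le hn q (w + k) r e)
    (mul_le_two_rpow (by positivity) (pow_le_two_rpow h1 (nearBound_le hn q (w + k) κ) k)
    (mul_le_two_rpow hM hkk hMμ))))
  have h2 : coreBound q n w r e κ k M N = N * ((n : ℝ) ^ k * (2 ^ k ^ 2 *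
      (strBound q n (w + k) r e * (nearBound q n (w + k) κ ^ k * (((k : ℕ) : ℝ) ^ k * M))))) := by
    unfold coreBound; ring
  rw [h2]
  refine mul_le_mul_of_nonneg_left (h.trans
    (Real.rpow_le_rpow_of_exponent_le (by norm_num) ?_)) hN
  have h3 : lg n * k ≤ lg n * 3 := by gcongr
  have h4 : (q : ℝ) * k ≤ q * 3 := by gcongr
  have h5 : (((w + k : ℕ) : ℝ) + lg n + 2 + 2 * n / 2 ^ q + q * κ) * k ≤
      ((w + 3) + lg n + 2 + 2 * n / 2 ^ q + q * κ) * 3 := by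
    push_cast
    gcongr
  have h6 : (2 * n / 2 ^ q : ℝ) * 5 = 10 * n / 2 ^ q := by ring
  have h7 : (2 * n / 2 ^ q : ℝ) * 2 = 4 * n / 2 ^ q := by ring
  push_cast at h5 ⊢
  linarith

lemma homBound_le {n : ℕ} (hn : 1 ≤ n) (w e z : ℕ) :
    homBound n w e z ≤ 2 ^ (3 * n + 3 + lg n * (w + 1 + ((n + 2 * e) / 2 - z + 1 : ℕ)) +
      (n : ℝ) ^ 2 / 4) := by
  have h1 := two_pow_le_two_rpow n
  have h2 : (2 : ℝ) ≤ 2 ^ (1 : ℝ) := by norm_num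
  refine (mul_le_two_rpow (by positivity) (mul_le_two_rpow (by positivity) h1
    (mul_le_two_rpow (by positivity) h1 h1)) (mul_le_two_rpow (by positivity)
    (mul_le_two_rpow (by positivity) (mul_le_two_rpow (by positivity) h2
      (natCast_pow_le_two_rpow hn _))
    (mul_le_two_rpow (by positivity) h2 (mul_le_two_rpow (by positivity) h2
      (natCast_pow_le_two_rpow hn _)))) le_rfl)).trans
    (Real.rpow_le_rpow_of_exponent_le (by norm_num) (le_of_eq ?_))
  push_cast
  ring

end LogBounds

/-! ### Asymptotics -/

section Asymptotics

lemma eventually_le_natCast (K : ℝ) : ∀ᶠ n : ℕ in atTop, K ≤ n :=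
  tendsto_natCast_atTop_atTop.eventually_ge_atTop K

lemma eventually_le_lg (K : ℝ) : ∀ᶠ n : ℕ in atTop, K ≤ lg n :=
  ((Real.tendsto_logb_atTop (by norm_num : (1 : ℝ) < 2)).comp
    tendsto_natCast_atTop_atTop).eventually_ge_atTop K

lemma eventually_lg_le {δ : ℝ} (hδ : 0 < δ) : ∀ᶠ n : ℕ in atTop, lg n ≤ δ * n := by
  have h2 : 0 < Real.log 2 := Real.log_pos (by norm_num)
  have h := (Real.isLittleO_log_id_atTop.comp_tendsto tendsto_natCast_atTop_atTop).def
    (c := δ * Real.log 2) (by positivity)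
  filter_upwards [h] with n hn
  simp only [Function.comp, id, Real.norm_eq_abs, Nat.abs_cast] at hn
  rw [lg, Real.logb, div_le_iff₀ h2]
  linarith [le_abs_self (Real.log n)]

lemma natCast_div_ge (n : ℕ) {d : ℕ} (hd : 0 < d) : (n : ℝ) / d - 1 ≤ (n / d : ℕ) := by
  have h : (0 : ℝ) < d := by exact_mod_cast hd
  have h1 : n < d * (n / d) + d := by
    have := Nat.div_add_mod n d
    have := Nat.mod_lt n hd
    omega
  have h2 : (n : ℝ) < d * (n / d : ℕ) + d := by exact_mod_cast h1
  rw [sub_le_iff_le_add, div_le_iff₀ h]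
  linarith

/-- The parameters used for graphs on `n` vertices. -/
def scale (m t s n : ℕ) : Scale where
  m := m
  t := t
  s := s
  r₀ := n / 2 ^ 108
  w₀ := n / 2 ^ 104
  r := n / 2 ^ 46
  w := n / 2 ^ 42
  e := n / 2 ^ 19
  p := n / 10
  p' := n / 5
  u := 61 * n / 200
  z := n / 1000

lemma scale_fits (m t s : ℕ) (hm : 1 ≤ m) : ∀ᶠ n in atTop, (scale m t s n).Fits n := by
  filter_upwards [eventually_ge_atTop (m ^ 2), eventually_ge_atTop (t * 2 ^ 120),
    eventually_ge_atTop (2 ^ 120)] with n h1 h2 h3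
  constructor <;> simp only [scale] <;> omega

/-- The number of ways to extend a smaller graph, at the rate of unipolar graphs. -/
def rate (n k : ℕ) : ℝ := numCls (n - k) * 2 ^ ((k : ℝ) * (n - k : ℕ) / 2)

def decay (n : ℕ) : ℝ := 2 ^ (-(n : ℝ) / 1000)

lemma numCls_nonneg (n : ℕ) : 0 ≤ numCls n := cnt_nonneg _

lemma le_decay_mul_rate {n k : ℕ} {x X : ℝ} (hx : x ≤ numCls (n - k) * 2 ^ X)
    (hX : X ≤ (k : ℝ) * (n - k : ℕ) / 2 - n / 1000) : x ≤ decay n * rate n k := by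
  have : decay n * rate n k = numCls (n - k) * 2 ^ ((k : ℝ) * (n - k : ℕ) / 2 - n / 1000) := by
    rw [decay, rate, sub_eq_add_neg, Real.rpow_add (by norm_num), neg_div]
    ring
  rw [this]
  exact hx.trans (mul_le_mul_of_nonneg_left
    (Real.rpow_le_rpow_of_exponent_le (by norm_num) hX) (numCls_nonneg _))

lemma two_rpow_le_numUni (n : ℕ) : 2 ^ ((n : ℝ) ^ 2 / 4 - 1) ≤ numUni n := by
  rcases Nat.eq_zero_or_pos n with rfl | hn
  · refine le_trans ?_ (one_le_numUni 0)
    exact Real.rpow_le_one_of_one_le_of_nonpos one_le_two (by norm_num)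
  have h := numUni_ge (n / 2) 1 (n - n / 2 - 1)
  have h1 : 1 + (n - n / 2 - 1) = n - n / 2 := by omega
  rw [h1, Nat.add_sub_cancel' (Nat.div_le_self n 2), Nat.cast_one, one_pow, one_mul] at h
  refine le_trans ?_ h
  rw [← Real.rpow_natCast (2 : ℝ) (n / 2 * (n - n / 2))]
  refine Real.rpow_le_rpow_of_exponent_le (by norm_num) ?_
  rw [Nat.cast_mul, Nat.cast_sub (Nat.div_le_self n 2)]
  have h2 := natCast_div_ge n (d := 2) (by norm_num)
  have h3 : ((n / 2 : ℕ) : ℝ) ≤ n / 2 := Nat.cast_div_le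
  push_cast at h2 h3 ⊢
  nlinarith

lemma le_decay_mul_numUni {n : ℕ} {x X : ℝ} (hx : x ≤ 2 ^ X)
    (hX : X ≤ (n : ℝ) ^ 2 / 4 - 1 - n / 1000) : x ≤ decay n * numUni n := by
  refine (hx.trans (Real.rpow_le_rpow_of_exponent_le (by norm_num) hX)).trans ?_
  have : (2 : ℝ) ^ ((n : ℝ) ^ 2 / 4 - 1 - n / 1000) = decay n * 2 ^ ((n : ℝ) ^ 2 / 4 - 1) := by
    rw [decay, ← Real.rpow_add (by norm_num)]
    ring_nf
  rw [this]
  exact mul_le_mul_of_nonneg_left (two_rpow_le_numUni n) (by unfold decay; positivity)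

lemma eventually_fewTraces (m t : ℕ) (hm : 1 ≤ m) (h : (m + 1) ^ (4 * (t + t ^ 2)) ≤ 2 ^ m) :
    ∀ᶠ n in atTop, cnt (fun G : SimpleGraph (Fin n) => Cls G ∧ ∃ Q : Finset (Fin n),
      Q.card = m ∧ FewTraces ((m + 1) ^ (t + t ^ 2)) Q G) ≤ decay n * rate n m := by
  have hL : (((m + 1) ^ (t + t ^ 2) : ℕ) : ℝ) ≤ 2 ^ ((m : ℝ) / 4) := by
    have h1 : ((((m + 1) ^ (t + t ^ 2) : ℕ) : ℝ)) ^ 4 ≤ 2 ^ m := by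
      rw [mul_comm, pow_mul] at h
      exact_mod_cast h
    have h2 : (2 : ℝ) ^ m = ((2 : ℝ) ^ ((m : ℝ) / 4)) ^ 4 := by
      rw [← Real.rpow_natCast _ 4, ← Real.rpow_mul (by norm_num), ← Real.rpow_natCast]
      congr 1
      push_cast
      ring
    rw [h2] at h1
    exact le_of_pow_le_pow_left₀ (by norm_num) (by positivity) h1
  filter_upwards [eventually_ge_atTop (m + 1),
    eventually_lg_le (show (0 : ℝ) < 1 / 100 by norm_num),
    eventually_le_natCast (100 * ((m : ℝ) ^ 2 * 2 + 2 ^ m))] with n hn hl hC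
  have hn1 : 1 ≤ n := by omega
  have hf := cnt_fewTraces_le (n := n) (m := m) (L := (m + 1) ^ (t + t ^ 2))
    (Nat.one_le_pow _ _ m.succ_pos)
  have hb : (n : ℝ) ^ m * (2 ^ m ^ 2 * (2 ^ 2 ^ m * (((m + 1) ^ (t + t ^ 2) : ℕ) : ℝ) ^ n)) ≤
      2 ^ (lg n * m + ((m ^ 2 : ℕ) + ((2 ^ m : ℕ) + (m : ℝ) / 4 * n))) :=
    mul_le_two_rpow (by positivity) (natCast_pow_le_two_rpow hn1 m)
      (mul_le_two_rpow (by positivity) (two_pow_le_two_rpow _)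
        (mul_le_two_rpow (by positivity) (two_pow_le_two_rpow _)
          (pow_le_two_rpow (Nat.cast_nonneg _) hL n)))
  refine le_decay_mul_rate (hf.trans ((le_of_eq (by ring)).trans
    (mul_le_mul_of_nonneg_left hb (numCls_nonneg _)))) ?_
  rw [Nat.cast_sub (by omega)]
  push_cast
  have h1 : (1 : ℝ) ≤ m := by exact_mod_cast hm
  have h2 : lg n * m ≤ 1 / 100 * n * m := mul_le_mul_of_nonneg_right hl (by linarith)
  have h3 : (n : ℝ) ≤ n * m := le_mul_of_one_le_right (Nat.cast_nonneg n) h1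
  nlinarith

end Asymptotics

section Asymptotics

lemma eventually_pairDef (m t s q : ℕ)
    (h : 4 + 2 * (t : ℝ) / 2 ^ q + 2 * q * s ≤ (t / 2 : ℕ) / (50 * 2 ^ 108)) :
    ∀ᶠ n in atTop, cnt (fun G : SimpleGraph (Fin n) => Cls G ∧ ∃ Q : Finset (Fin n),
      Q.card = 2 * t ∧ PairDef t (2 * s) (scale m t s n).r₀ Q G) ≤ decay n * rate n (2 * t) := by
  filter_upwards [eventually_ge_atTop (2 * t + 1),
    eventually_lg_le (show (0 : ℝ) < 1 / (4 * (t + 1)) by positivity),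
    eventually_le_natCast (4 * ((2 * t : ℝ) ^ 2 + 2 * t + (t / 2 : ℕ) / 50))] with n hn hl hC
  have hn1 : 1 ≤ n := by omega
  have hf := cnt_pairDef_le q n t (2 * s) (scale m t s n).r₀
  have hr : (n : ℝ) / 2 ^ 108 - 1 ≤ (scale m t s n).r₀ := by
    have := natCast_div_ge n (d := 2 ^ 108) (by norm_num)
    rw [Nat.cast_pow, Nat.cast_ofNat] at this
    exact this
  set r := (scale m t s n).r₀
  have hball : 2 * ballBound q t (2 * s) ≤ 2 ^ (1 + ((2 : ℝ) * t / 2 ^ q + q * (2 * s : ℕ))) :=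
    mul_le_two_rpow (ballBound_pos _ _ _).le (by norm_num) le_rfl
  have hb := mul_le_two_rpow (by have := ballBound_pos q t (2 * s); positivity)
    (natCast_pow_le_two_rpow hn1 (2 * t))
    (mul_le_two_rpow (by have := ballBound_pos q t (2 * s); positivity)
      (two_pow_le_two_rpow ((2 * t) ^ 2))
      (mul_le_two_rpow (by have := ballBound_pos q t (2 * s); positivity)
        (mul_le_two_rpow (by positivity) (two_pow_le_two_rpow (2 * t)) (two_pow_le_two_rpow n))
        (mul_le_two_rpow (by positivity)
          (pow_le_two_rpow (by have := ballBound_pos q t (2 * s); positivity) hball n)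
          (le_refl ((2 : ℝ) ^ ((t * (n - 2 * t) : ℕ) - (r * (t / 2 : ℕ) : ℝ) / 50))))))
  refine le_decay_mul_rate (hf.trans ((le_of_eq (by ring)).trans
    (mul_le_mul_of_nonneg_left hb (numCls_nonneg _)))) ?_
  have h1 : lg n * (2 * t) ≤ n / 2 := by
    refine (mul_le_mul_of_nonneg_right hl (by positivity)).trans ?_
    rw [div_mul_eq_mul_div, div_mul_eq_mul_div, div_le_div_iff₀ (by positivity) (by norm_num)]
    nlinarith [(Nat.cast_nonneg n : (0 : ℝ) ≤ n)]
  have h2 := mul_le_mul_of_nonneg_right hr (Nat.cast_nonneg (α := ℝ) (t / 2))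
  have h3 := mul_le_mul_of_nonneg_right h (Nat.cast_nonneg (α := ℝ) n)
  have h4 : (n : ℝ) / 2 ^ 108 * (t / 2 : ℕ) = 50 * ((t / 2 : ℕ) / (50 * 2 ^ 108) * n) := by
    field_simp
  push_cast [Nat.cast_sub (show 2 * t ≤ n by omega)] at h1 h2 h3 hC ⊢
  generalize 2 * (t : ℝ) / 2 ^ q = y at *
  nlinarith

lemma div_two_pow_le (n k : ℕ) : ((n / 2 ^ k : ℕ) : ℝ) ≤ n / 2 ^ k := by
  have := Nat.cast_div_le (α := ℝ) (m := n) (n := 2 ^ k)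
  push_cast at this
  exact this

lemma eventually_div_two_pow_ge (k : ℕ) :
    ∀ᶠ n : ℕ in atTop, (n : ℝ) / 2 ^ (k + 1) ≤ (n / 2 ^ k : ℕ) := by
  filter_upwards [eventually_le_natCast (2 ^ (k + 1))] with n hn
  have := natCast_div_ge n (d := 2 ^ k) (by positivity)
  have h1 : (n : ℝ) / 2 ^ k = 2 * (n / 2 ^ (k + 1)) := by rw [pow_succ]; field_simp
  have h2 : 1 ≤ (n : ℝ) / 2 ^ (k + 1) := (one_le_div (by positivity)).2 hn
  push_cast at this
  linarith

lemma eventually_genBad (m t s : ℕ) : ∀ᶠ n in atTop,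
    cnt (fun G : SimpleGraph (Fin n) => GenBad (scale m t s n).w₀ (scale m t s n).r G) ≤
      decay n * numUni n := by
  filter_upwards [eventually_ge_atTop 1, eventually_lg_le (show (0 : ℝ) < 1 / 2 ^ 110 by norm_num),
    eventually_div_two_pow_ge 46, eventually_le_natCast (2 ^ 120)] with n hn1 hl hr hC
  have hf := cnt_genBad_le (V := Fin n) (scale m t s n).w₀ (scale m t s n).r
    (by rwa [Fintype.card_fin])
  rw [Fintype.card_fin] at hf
  have hw := div_two_pow_le n 104
  have hr' := div_two_pow_le n 46
  simp only [scale] at hf ⊢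
  generalize n / 2 ^ 104 = w at *
  generalize n / 2 ^ 46 = r at *
  have hb := mul_le_two_rpow (x := 3) (by unfold directBound; positivity) three_le_two_rpow
    (mul_le_two_rpow (by positivity) (directBound_le hn1 w)
      (mul_le_two_rpow (by positivity) (mul_le_two_rpow (by positivity)
        (mul_le_two_rpow (by positivity) (natCast_pow_le_two_rpow hn1 (r * 3))
          (natCast_pow_le_two_rpow hn1 (r * 3))) (two_pow_le_two_rpow 6))
        (le_refl ((2 : ℝ) ^ ((n : ℝ) ^ 2 / 4 - (r : ℝ) ^ 2 / 50)))))
  refine le_decay_mul_numUni (hf.trans hb) ?_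
  have hn0 : (0 : ℝ) ≤ n := Nat.cast_nonneg n
  have hl0 := lg_nonneg hn1
  have h1 : lg n * n ≤ 1 / 2 ^ 110 * n * n := mul_le_mul_of_nonneg_right hl hn0
  have h2 : (w : ℝ) * n ≤ n / 2 ^ 104 * n := mul_le_mul_of_nonneg_right hw hn0
  have h3 : lg n * r ≤ 1 / 2 ^ 110 * n * (n / 2 ^ 46) :=
    mul_le_mul hl hr' (Nat.cast_nonneg r) (by positivity)
  have h4 : ((n : ℝ) / 2 ^ (46 + 1)) ^ 2 ≤ (r : ℝ) ^ 2 := pow_le_pow_left₀ (by positivity) hr 2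
  have h5 : (2 : ℝ) ^ 120 * n ≤ n * n := mul_le_mul_of_nonneg_right hC hn0
  have h6 : (2 : ℝ) ^ 120 * 1 ≤ n * n := by nlinarith
  have h7 : (n : ℝ) * 1 ≤ n * n := mul_le_mul_of_nonneg_left (by exact_mod_cast hn1) hn0
  push_cast
  linarith

end Asymptotics

section Asymptotics

lemma eventually_sizeBad (m t s : ℕ) : ∀ᶠ n in atTop,
    cnt (fun G : SimpleGraph (Fin n) => SizeBad (scale m t s n).w (scale m t s n).e G) ≤
      decay n * numUni n := by
  filter_upwards [eventually_ge_atTop 1, eventually_lg_le (show (0 : ℝ) < 1 / 2 ^ 50 by norm_num),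
    eventually_div_two_pow_ge 19, eventually_le_natCast (2 ^ 60)] with n hn1 hl he hC
  have hf := cnt_sizeBad_le (V := Fin n) (scale m t s n).w (scale m t s n).e
  rw [Fintype.card_fin] at hf
  have hw := div_two_pow_le n 42
  simp only [scale] at hf ⊢
  generalize n / 2 ^ 42 = w at *
  generalize n / 2 ^ 19 = e at *
  refine le_decay_mul_numUni
    (hf.trans (mul_le_two_rpow (by positivity) (directBound_le hn1 w) le_rfl)) ?_
  have hn0 : (0 : ℝ) ≤ n := Nat.cast_nonneg n
  have h1 : lg n * n ≤ 1 / 2 ^ 50 * n * n := mul_le_mul_of_nonneg_right hl hn0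
  have h2 : (w : ℝ) * n ≤ n / 2 ^ 42 * n := mul_le_mul_of_nonneg_right hw hn0
  have h4 : ((n : ℝ) / 2 ^ (19 + 1)) ^ 2 ≤ (e : ℝ) ^ 2 := pow_le_pow_left₀ (by positivity) he 2
  have h5 : (2 : ℝ) ^ 60 * n ≤ n * n := mul_le_mul_of_nonneg_right hC hn0
  have h7 : (1 : ℝ) ≤ n := by exact_mod_cast hn1
  linarith

lemma eventually_degBad (m t s : ℕ) : ∀ᶠ n in atTop,
    cnt (fun G : SimpleGraph (Fin n) => DegBad (scale m t s n).w G) ≤ decay n * numUni n := by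
  filter_upwards [eventually_ge_atTop 1, eventually_lg_le (show (0 : ℝ) < 1 / 2 ^ 50 by norm_num),
    eventually_le_natCast (2 ^ 60)] with n hn1 hl hC
  have hf := cnt_degBad_le (V := Fin n) (scale m t s n).w
  rw [Fintype.card_fin] at hf
  have hw := div_two_pow_le n 42
  simp only [scale] at hf ⊢
  generalize n / 2 ^ 42 = w at *
  refine le_decay_mul_numUni
    (hf.trans (mul_le_two_rpow (by positivity) (directBound_le hn1 w) le_rfl)) ?_
  have hn0 : (0 : ℝ) ≤ n := Nat.cast_nonneg n
  have h1 : lg n * n ≤ 1 / 2 ^ 50 * n * n := mul_le_mul_of_nonneg_right hl hn0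
  have h2 : (w : ℝ) * n ≤ n / 2 ^ 42 * n := mul_le_mul_of_nonneg_right hw hn0
  have h5 : (2 : ℝ) ^ 60 * n ≤ n * n := mul_le_mul_of_nonneg_right hC hn0
  have h7 : (1 : ℝ) ≤ n := by exact_mod_cast hn1
  linarith

/-- The part of the exponent in `coreBound_le` that does not depend on the constraint. -/
lemma eventually_core (m t s : ℕ) : ∀ᶠ n in atTop, ∀ κ : ℕ, κ ≤ 4 * (scale m t s n).r →
    7 * lg n + 31 + 10 * n / 2 ^ 16 + (16 : ℕ) * (4 * (scale m t s n).r + 4 * (scale m t s n).w +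
      2 * (scale m t s n).e + 3 * κ + 12) + 3 * (scale m t s n).w + 3 * (scale m t s n).e + 10 ≤
      (n : ℝ) / 4000 := by
  filter_upwards [eventually_lg_le (show (0 : ℝ) < 1 / 2 ^ 30 by norm_num),
    eventually_le_natCast (2 ^ 60)] with n hl hC κ hκ
  have hw := div_two_pow_le n 42
  have hr := div_two_pow_le n 46
  have he := div_two_pow_le n 19
  simp only [scale] at hκ ⊢
  generalize n / 2 ^ 42 = w at *
  generalize n / 2 ^ 46 = r at *
  generalize n / 2 ^ 19 = e at *
  have hκ' : (κ : ℝ) ≤ 4 * r := by exact_mod_cast hκ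
  push_cast
  linarith

lemma triple_le_decay {m t s n κ p : ℕ} {x : ℝ} (hn : 1 ≤ n) (hp : (n : ℝ) / 10 - 1 ≤ p)
    (hcore : 7 * lg n + 31 + 10 * n / 2 ^ 16 + (16 : ℕ) * (4 * (scale m t s n).r +
      4 * (scale m t s n).w + 2 * (scale m t s n).e + 3 * κ + 12) + 3 * (scale m t s n).w +
      3 * (scale m t s n).e + 10 ≤ (n : ℝ) / 4000)
    (hx : x ≤ coreBound 16 n (scale m t s n).w (scale m t s n).r (scale m t s n).e κ 3
      (2 ^ (3 * ((n : ℝ) / 2 + (scale m t s n).e) - (p - 3 : ℕ) / 50)) (numCls (n - 3))) :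
    x ≤ decay n * rate n 3 := by
  refine le_decay_mul_rate (hx.trans (coreBound_le hn _ _ _ _ _ _ le_rfl (numCls_nonneg _)
    (by positivity) le_rfl)) ?_
  have h1 : (p : ℝ) ≤ (p - 3 : ℕ) + 3 := by exact_mod_cast (by omega : p ≤ p - 3 + 3)
  have h2 : (n : ℝ) ≤ (n - 3 : ℕ) + 3 := by exact_mod_cast (by omega : n ≤ n - 3 + 3)
  push_cast at hcore ⊢
  linarith

lemma eventually_tripleLeft (m t s : ℕ) (b : Prop) : ∀ᶠ n in atTop,
    cnt (fun G : SimpleGraph (Fin n) => Cls G ∧ TripleLeft b (scale m t s n).w (scale m t s n).r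
      (scale m t s n).e (2 * (scale m t s n).r) (scale m t s n).p G) ≤ decay n * rate n 3 := by
  filter_upwards [eventually_ge_atTop 1, eventually_core m t s] with n hn hcore
  refine triple_le_decay hn ?_ (hcore _ (by omega)) (cnt_tripleLeft_le 16 n b _ _ _ _ _)
  exact_mod_cast natCast_div_ge n (d := 10) (by norm_num)

lemma eventually_tripleRight (m t s : ℕ) : ∀ᶠ n in atTop,
    cnt (fun G : SimpleGraph (Fin n) => Cls G ∧ TripleRight (scale m t s n).w (scale m t s n).r
      (scale m t s n).e (4 * (scale m t s n).r) (scale m t s n).p' G) ≤ decay n * rate n 3 := by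
  filter_upwards [eventually_ge_atTop 1, eventually_core m t s] with n hn hcore
  refine triple_le_decay hn ?_ (hcore _ (by omega)) (cnt_tripleRight_le 16 n _ _ _ _ _)
  refine le_trans ?_ (natCast_div_ge n (d := 5) (by norm_num))
  push_cast
  linarith [(Nat.cast_nonneg n : (0 : ℝ) ≤ n)]

lemma eventually_pairRight (m t s : ℕ) : ∀ᶠ n in atTop,
    cnt (fun G : SimpleGraph (Fin n) => Cls G ∧ PairRight (scale m t s n).w (scale m t s n).r
      (scale m t s n).e (4 * (scale m t s n).r) (scale m t s n).u G) ≤ decay n * rate n 2 := by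
  filter_upwards [eventually_ge_atTop 1, eventually_core m t s] with n hn hcore
  have hM : (2 : ℝ) ^ ((n : ℝ) / 2 + (scale m t s n).e) * 3 ^ (scale m t s n).u ≤
      2 ^ ((n : ℝ) / 2 + (scale m t s n).e + 8 / 5 * (scale m t s n).u) :=
    mul_le_two_rpow (by positivity) le_rfl (pow_le_two_rpow (by norm_num) three_le_two_rpow _)
  refine le_decay_mul_rate ((cnt_pairRight_le 16 n _ _ _ _ _).trans (coreBound_le hn _ _ _ _ _ _
    (by norm_num) (numCls_nonneg _) (by positivity) hM)) ?_
  have h2 : (n : ℝ) ≤ (n - 2 : ℕ) + 2 := by exact_mod_cast (by omega : n ≤ n - 2 + 2)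
  have h3 : ((scale m t s n).u : ℝ) ≤ 61 * n / 200 := by
    have := Nat.cast_div_le (α := ℝ) (m := 61 * n) (n := 200)
    push_cast at this
    exact this
  have hc := hcore _ le_rfl
  push_cast at hc ⊢
  linarith [(Nat.cast_nonneg (scale m t s n).e : (0 : ℝ) ≤ _)]

lemma eventually_homBad (m t s : ℕ) : ∀ᶠ n in atTop,
    cnt (fun G : SimpleGraph (Fin n) => HomBad (scale m t s n).w
      ((scale m t s n).e + (scale m t s n).w) (scale m t s n).z G) ≤ decay n * numUni n := by
  filter_upwards [eventually_ge_atTop 1, eventually_le_lg 20000,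
    eventually_lg_le (show (0 : ℝ) < 1 / 2 ^ 50 by norm_num), eventually_div_two_pow_ge 12,
    eventually_le_natCast (2 ^ 60)] with n hn hK hl hj hC
  have hf := cnt_homBad_le (V := Fin n) (scale m t s n).w ((scale m t s n).e + (scale m t s n).w)
    (scale m t s n).z (by rwa [Fintype.card_fin])
  rw [Fintype.card_fin] at hf
  replace hf := hf.trans (homBound_le hn _ _ _)
  have hw := div_two_pow_le n 42
  have he := div_two_pow_le n 19
  have hz : (n : ℝ) / 1000 - 1 ≤ (n / 1000 : ℕ) := by
    exact_mod_cast natCast_div_ge n (d := 1000) (by norm_num)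
  have hj' := div_two_pow_le n 12
  have hjn : n / 2 ^ 12 ≤ n - n / 2 := by omega
  have hY : ((n + 2 * (n / 2 ^ 19 + n / 2 ^ 42)) / 2 - n / 1000 + 1 : ℕ) + n / 1000 ≤
      n / 2 + (n / 2 ^ 19 + n / 2 ^ 42) + 2 := by omega
  simp only [scale] at hf ⊢
  generalize (n + 2 * (n / 2 ^ 19 + n / 2 ^ 42)) / 2 - n / 1000 + 1 = y at *
  generalize n / 2 ^ 42 = w at *
  generalize n / 2 ^ 19 = e at *
  generalize n / 1000 = z at *
  generalize n / 2 ^ 12 = j at *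
  have hu := numUni_ge (n / 2) j (n - n / 2 - j)
  rw [Nat.add_sub_cancel' hjn, Nat.add_sub_cancel' (Nat.div_le_self n 2)] at hu
  have h2 := natCast_div_ge n (d := 2) (by norm_num)
  have h3 : ((n / 2 : ℕ) : ℝ) ≤ n / 2 := Nat.cast_div_le
  have hnn : n / 2 ≤ n := Nat.div_le_self n 2
  generalize n / 2 = a at *
  push_cast at h2 h3
  have hY' : (y : ℝ) + z ≤ a + (e + w) + 2 := by exact_mod_cast hY
  have hj2 : (2 : ℝ) ^ (lg n - 13) ≤ j := by
    rw [Real.rpow_sub (by norm_num), two_rpow_lg hn]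
    refine le_trans (le_of_eq ?_) hj
    norm_num
  set q := n - a - j with hq
  have hqr : (q : ℝ) = n - a - j := by
    rw [hq, Nat.cast_sub hjn, Nat.cast_sub hnn]
  have hlow : (2 : ℝ) ^ ((lg n - 13) * q + (a * (n - a) : ℕ)) ≤ numUni n := by
    refine le_trans ?_ hu
    rw [Real.rpow_add (by norm_num), Real.rpow_natCast, Real.rpow_mul (by norm_num),
      Real.rpow_natCast]
    exact mul_le_mul_of_nonneg_right (pow_le_pow_left₀ (by positivity) hj2 q) (by positivity)
  refine hf.trans (le_trans ?_ (mul_le_mul_of_nonneg_left hlow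
    (show 0 ≤ decay n by unfold decay; positivity)))
  rw [decay, ← Real.rpow_add (by norm_num)]
  refine Real.rpow_le_rpow_of_exponent_le (by norm_num) ?_
  have ha : (n : ℝ) ^ 2 / 4 - 1 ≤ (a * (n - a) : ℕ) := by
    rw [Nat.cast_mul, Nat.cast_sub hnn]
    nlinarith
  have hn0 : (0 : ℝ) ≤ n := Nat.cast_nonneg n
  have h4 : lg n * (w + 1 + y - q) ≤ lg n * (-((n : ℝ) / 2000)) := by
    refine mul_le_mul_of_nonneg_left ?_ (by linarith)
    linarith
  have h5 : (20000 : ℝ) * (n / 2000) ≤ lg n * (n / 2000) :=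
    mul_le_mul_of_nonneg_right hK (by positivity)
  have h6 : (q : ℝ) ≤ n / 2 + 1 := by
    have := (Nat.cast_nonneg j : (0 : ℝ) ≤ j)
    linarith
  linarith

end Asymptotics

/-! ### Assembly -/

section Assembly

lemma exists_pow_le_two_pow (K : ℕ) : ∃ m : ℕ, 1 ≤ m ∧ (m + 1) ^ K ≤ 2 ^ m := by
  obtain ⟨n, hn, hl⟩ := ((eventually_ge_atTop 2).and
    (eventually_lg_le (show (0 : ℝ) < 1 / (2 * (K + 1)) by positivity))).exists
  obtain ⟨m, rfl⟩ : ∃ m, n = m + 1 := ⟨n - 1, by omega⟩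
  refine ⟨m, by omega, ?_⟩
  have h := natCast_pow_le_two_rpow (n := m + 1) (by omega) K
  have hm : (1 : ℝ) ≤ m := by exact_mod_cast (by omega : 1 ≤ m)
  have h1 : lg (m + 1) * K ≤ m := by
    refine (mul_le_mul_of_nonneg_right hl (Nat.cast_nonneg K)).trans ?_
    rw [div_mul_eq_mul_div, div_mul_eq_mul_div, div_le_iff₀ (by positivity)]
    push_cast
    nlinarith [mul_nonneg (sub_nonneg.2 hm) (Nat.cast_nonneg (α := ℝ) K)]
  have h2 := h.trans (Real.rpow_le_rpow_of_exponent_le (by norm_num) h1)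
  rw [Real.rpow_natCast] at h2
  exact_mod_cast h2

lemma cnt_and_or_le {α : Type*} (p q r : α → Prop) :
    cnt (fun x => p x ∧ (q x ∨ r x)) ≤ cnt (fun x => p x ∧ q x) + cnt fun x => p x ∧ r x := by
  simp only [and_or_left]
  exact cnt_or_le _ _

lemma cnt_and_le {α : Type*} [Finite α] (p q : α → Prop) : cnt (fun x => p x ∧ q x) ≤ cnt q :=
  cnt_mono fun _ h => h.2

lemma eventually_exceptional (m t s q : ℕ) (hm : 1 ≤ m)
    (hmt : (m + 1) ^ (4 * (t + t ^ 2)) ≤ 2 ^ m)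
    (hq : 4 + 2 * (t : ℝ) / 2 ^ q + 2 * q * s ≤ (t / 2 : ℕ) / (50 * 2 ^ 108)) :
    ∀ᶠ n in atTop, cnt (fun G : SimpleGraph (Fin n) => Cls G ∧ Exceptional (scale m t s n) G) ≤
      decay n * (rate n m + rate n (2 * t) + 3 * rate n 3 + rate n 2 + 4 * numUni n) := by
  filter_upwards [eventually_fewTraces m t hm hmt, eventually_pairDef m t s q hq,
    eventually_genBad m t s, eventually_sizeBad m t s, eventually_degBad m t s,
    eventually_tripleLeft m t s True, eventually_tripleLeft m t s False,
    eventually_tripleRight m t s, eventually_pairRight m t s, eventually_homBad m t s]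
    with n h1 h2 h3 h4 h5 h6 h7 h8 h9 h10
  have g3 := (cnt_and_le (fun G : SimpleGraph (Fin n) => Cls G) _).trans h3
  have g4 := (cnt_and_le (fun G : SimpleGraph (Fin n) => Cls G) _).trans h4
  have g5 := (cnt_and_le (fun G : SimpleGraph (Fin n) => Cls G) _).trans h5
  have g10 := (cnt_and_le (fun G : SimpleGraph (Fin n) => Cls G) _).trans h10
  unfold Exceptional
  refine ((cnt_and_or_le _ _ _).trans (add_le_add h1 <|
    (cnt_and_or_le _ _ _).trans <| add_le_add h2 <|
    (cnt_and_or_le _ _ _).trans <| add_le_add g3 <|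
    (cnt_and_or_le _ _ _).trans <| add_le_add g4 <|
    (cnt_and_or_le _ _ _).trans <| add_le_add g5 <|
    (cnt_and_or_le _ _ _).trans <| add_le_add h6 <|
    (cnt_and_or_le _ _ _).trans <| add_le_add h7 <|
    (cnt_and_or_le _ _ _).trans <| add_le_add h8 <|
    (cnt_and_or_le _ _ _).trans <| add_le_add h9 g10)).trans (le_of_eq ?_)
  ring

/-- The graphs of the class that are not generalised split graphs with connectivity equal to the
minimum degree. -/
def atypical (n : ℕ) : ℝ := cnt fun G : SimpleGraph (Fin n) =>
  Cls G ∧ ¬ ((IsUnipolar G ∨ IsUnipolar Gᶜ) ∧ Conn G)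

lemma exists_eventually_atypical : ∃ m t : ℕ, 1 ≤ m ∧ 1 ≤ t ∧ ∀ᶠ n in atTop, atypical n ≤
    2 * (decay n * (rate n m + rate n (2 * t) + 3 * rate n 3 + rate n 2 + 4 * numUni n)) := by
  obtain ⟨k, hk, hq⟩ : ∃ k : ℕ, 1 ≤ k ∧ 4 + 2 * ((2 ^ k : ℕ) : ℝ) / 2 ^ 120 +
      2 * (120 : ℕ) * (400 * k : ℕ) ≤ (2 ^ k / 2 : ℕ) / (50 * 2 ^ 108) :=
    ⟨200, by norm_num, by norm_num⟩
  obtain ⟨H, hH⟩ := exists_generic k hk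
  have ht : 1 ≤ 2 ^ k := Nat.one_le_two_pow
  generalize 2 ^ k = t at *
  obtain ⟨m, hm, hmt⟩ := exists_pow_le_two_pow (4 * (t + t ^ 2))
  refine ⟨m, t, hm, ht, ?_⟩
  filter_upwards [eventually_exceptional m t (400 * k) 120 hm hmt hq, scale_fits m t (400 * k) hm]
    with n hn hP
  have h1 : atypical n ≤ cnt fun G : SimpleGraph (Fin n) => Cls G ∧
      (Exceptional (scale m t (400 * k) n) G ∨ Exceptional (scale m t (400 * k) n) Gᶜ) := by
    refine cnt_mono fun G ⟨hc, hG⟩ => ⟨hc, ?_⟩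
    by_contra! hcon
    exact hG (conn_of_not_exceptional (by rwa [Fintype.card_fin]) hH hc hcon.1 hcon.2)
  have h2 : cnt (fun G : SimpleGraph (Fin n) => Cls G ∧ Exceptional (scale m t (400 * k) n) Gᶜ) ≤
      cnt (fun G : SimpleGraph (Fin n) => Cls G ∧ Exceptional (scale m t (400 * k) n) G) :=
    (cnt_mono fun G h => ⟨h.1.compl, h.2⟩).trans (cnt_compl _)
  have h3 := cnt_and_or_le (fun G : SimpleGraph (Fin n) => Cls G)
    (fun G => Exceptional (scale m t (400 * k) n) G)
    (fun G => Exceptional (scale m t (400 * k) n) Gᶜ)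
  linarith

lemma numCls_le_add_atypical (n : ℕ) : numCls n ≤ 2 * numUni n + atypical n := by
  have h : numCls n ≤ cnt fun G : SimpleGraph (Fin n) => (IsUnipolar G ∨ IsCoUnipolar G) ∨
      (Cls G ∧ ¬ ((IsUnipolar G ∨ IsUnipolar Gᶜ) ∧ Conn G)) := by
    refine cnt_mono fun G hG => ?_
    by_cases hg : (IsUnipolar G ∨ IsUnipolar Gᶜ) ∧ Conn G
    · exact Or.inl hg.1
    · exact Or.inr ⟨hG, hg⟩
  have h1 := h.trans (cnt_or_le _ _)
  have h2 := cnt_or_le (fun G : SimpleGraph (Fin n) => IsUnipolar G) fun G => IsCoUnipolar G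
  have h3 := cnt_coUnipolar_le n
  have h4 : numUni n = cnt fun G : SimpleGraph (Fin n) => IsUnipolar G := rfl
  have h5 : atypical n = cnt fun G : SimpleGraph (Fin n) =>
      Cls G ∧ ¬ ((IsUnipolar G ∨ IsUnipolar Gᶜ) ∧ Conn G) := rfl
  linarith

lemma rate_le {n k : ℕ} {K : ℝ} (hk : k ≤ n) (h : numCls (n - k) ≤ K * numUni (n - k))
    (hK : 0 ≤ K) : rate n k ≤ K * numUni n := by
  have h1 := numUni_add_ge (n - k) k
  rw [Nat.sub_add_cancel hk] at h1
  calc rate n k ≤ K * numUni (n - k) * 2 ^ ((k : ℝ) * (n - k : ℕ) / 2) :=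
        mul_le_mul_of_nonneg_right h (by positivity)
    _ = K * (2 ^ ((k : ℝ) * (n - k : ℕ) / 2) * numUni (n - k)) := by ring
    _ ≤ K * numUni n := mul_le_mul_of_nonneg_left h1 hK

lemma decay_nonneg (n : ℕ) : 0 ≤ decay n := by unfold decay; positivity

lemma eventually_mul_decay_le (K : ℝ) :
    ∀ᶠ n : ℕ in atTop, K * decay n ≤ 2 ^ (-(n : ℝ) / 2000) := by
  have h : Tendsto (fun n : ℕ => (n : ℝ) / 2000) atTop atTop :=
    tendsto_natCast_atTop_atTop.atTop_div_const (by norm_num)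
  filter_upwards [((tendsto_rpow_atTop_of_base_gt_one 2 (by norm_num)).comp
    h).eventually_ge_atTop K] with n hn
  calc K * decay n ≤ 2 ^ ((n : ℝ) / 2000) * decay n :=
        mul_le_mul_of_nonneg_right hn (decay_nonneg n)
    _ = 2 ^ (-(n : ℝ) / 2000) := by
        rw [decay, ← Real.rpow_add (by norm_num)]
        ring_nf

lemma numUni_nonneg (n : ℕ) : 0 ≤ numUni n := cnt_nonneg _

lemma atypical_le {m t n : ℕ} {K : ℝ} (hK : 0 ≤ K) (hn : m + 2 * t + 3 ≤ n)
    (h : atypical n ≤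
      2 * (decay n * (rate n m + rate n (2 * t) + 3 * rate n 3 + rate n 2 + 4 * numUni n)))
    (hrec : ∀ k, k ≤ n → 1 ≤ k → numCls (n - k) ≤ K * numUni (n - k)) (hm : 1 ≤ m) (ht : 1 ≤ t) :
    atypical n ≤ (12 * K + 8) * decay n * numUni n := by
  have hr : ∀ k, k ≤ n → 1 ≤ k → rate n k ≤ K * numUni n :=
    fun k hk hk' => rate_le hk (hrec k hk hk') hK
  have := hr m (by omega) hm
  have := hr (2 * t) (by omega) (by omega)
  have := hr 3 (by omega) (by norm_num)
  have := hr 2 (by omega) (by norm_num)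
  have h1 : decay n * (rate n m + rate n (2 * t) + 3 * rate n 3 + rate n 2 + 4 * numUni n) ≤
      decay n * (6 * (K * numUni n) + 4 * numUni n) :=
    mul_le_mul_of_nonneg_left (by linarith) (decay_nonneg n)
  linarith

/-- Up to a constant factor, the class consists of the generalised split graphs, and atypical graphs
are exponentially rare. -/
lemma eventually_atypical_le :
    ∀ᶠ n in atTop, atypical n ≤ 2 ^ (-(n : ℝ) / 2000) * numUni n := by
  obtain ⟨m, t, hm, ht, h⟩ := exists_eventually_atypical
  obtain ⟨n₁, hn₁⟩ := eventually_atTop.1 ((h.and (eventually_mul_decay_le 100)).and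
    (eventually_ge_atTop (m + 2 * t + 3)))
  set K := 3 + ∑ i ∈ Finset.range n₁, numCls i with hKdef
  have hK3 : 3 ≤ K := le_add_of_nonneg_right (Finset.sum_nonneg fun i _ => numCls_nonneg i)
  have hK : ∀ n, numCls n ≤ K * numUni n := by
    intro n
    induction n using Nat.strong_induction_on with
    | _ n ih =>
      rcases lt_or_ge n n₁ with hn | hn
      · have h1 : numCls n ≤ ∑ i ∈ Finset.range n₁, numCls i :=
          Finset.single_le_sum (fun i _ => numCls_nonneg i) (Finset.mem_range.2 hn)
        have h2 : K * 1 ≤ K * numUni n :=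
          mul_le_mul_of_nonneg_left (one_le_numUni n) (by linarith)
        linarith
      · obtain ⟨⟨h1, h2⟩, h3⟩ := hn₁ n hn
        have h4 := atypical_le (by linarith) h3 h1 (fun k hk hk' => ih _ (by omega)) hm ht
        have h5 : (2 : ℝ) ^ (-(n : ℝ) / 2000) ≤ 1 :=
          Real.rpow_le_one_of_one_le_of_nonpos one_le_two
            (by linarith [(Nat.cast_nonneg n : (0 : ℝ) ≤ n)])
        have h6 : (12 * K + 8) * decay n * numUni n ≤ (12 * K + 8) * (1 / 100) * numUni n :=
          mul_le_mul_of_nonneg_right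
            (mul_le_mul_of_nonneg_left (by linarith) (by linarith)) (numUni_nonneg n)
        have h7 : 3 * numUni n ≤ K * numUni n :=
          mul_le_mul_of_nonneg_right hK3 (numUni_nonneg n)
        linarith [numCls_le_add_atypical n, numUni_nonneg n]
  filter_upwards [h, eventually_ge_atTop (m + 2 * t + 3), eventually_mul_decay_le (12 * K + 8)]
    with n h1 h2 h3
  exact (atypical_le (by linarith) h2 h1 (fun k _ _ => hK _) hm ht).trans
    (mul_le_mul_of_nonneg_right h3 (numUni_nonneg n))

end Assembly

/-- Whp the connectivity of a uniformly random perfect graph on `{1,…,n}` equals its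
minimum degree: wvhp, for every vertex set `S` with `|S| < δ(P_n)`, deleting `S`
leaves a connected graph. -/
theorem connectivity_eq_minDegree :
    ∃ c : ℝ, 0 < c ∧ ∃ n₀ : ℕ, ∀ n : ℕ, n₀ ≤ n →
      1 - Real.exp (-(c * n)) ≤
        (Nat.card {G : SimpleGraph (Fin n) // IsPerfect G ∧
            ∀ S : Finset (Fin n), S.card < G.minDegree →
              (G.induce ((S : Set (Fin n))ᶜ)).Connected} : ℝ) /
          (perfectCount n : ℝ) := by
  obtain ⟨n₀, hn₀⟩ := eventually_atTop.1 eventually_atypical_le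
  refine ⟨Real.log 2 / 2000, div_pos (Real.log_pos one_lt_two) (by norm_num), n₀, fun n hn => ?_⟩
  have hat := hn₀ n hn
  have hexp : Real.exp (-(Real.log 2 / 2000 * n)) = 2 ^ (-(n : ℝ) / 2000) := by
    rw [Real.rpow_def_of_pos (by norm_num)]
    ring_nf
  have hpos : (0 : ℝ) < perfectCount n :=
    one_pos.trans_le ((one_le_numUni n).trans (numUni_le_perfectCount n))
  have hsplit : (perfectCount n : ℝ) ≤
      cnt (fun G : SimpleGraph (Fin n) => IsPerfect G ∧ Conn G) + atypical n := by
    refine le_trans (cnt_mono (p := fun G : SimpleGraph (Fin n) => IsPerfect G) fun G hG => ?_)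
      (cnt_or_le _ _)
    by_cases hc : Conn G
    · exact Or.inl ⟨hG, hc⟩
    · exact Or.inr ⟨hG.cls, fun h => hc h.2⟩
  rw [le_div_iff₀ hpos, hexp]
  have h1 : (2 : ℝ) ^ (-(n : ℝ) / 2000) * numUni n ≤ 2 ^ (-(n : ℝ) / 2000) * perfectCount n :=
    mul_le_mul_of_nonneg_left (numUni_le_perfectCount n) (by positivity)
  have h2 : cnt (fun G : SimpleGraph (Fin n) => IsPerfect G ∧ Conn G) ≤
      (Nat.card {G : SimpleGraph (Fin n) // IsPerfect G ∧
        ∀ S : Finset (Fin n), S.card < G.minDegree →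
          (G.induce ((S : Set (Fin n))ᶜ)).Connected} : ℝ) := le_of_eq (cnt_eq_card_subtype _)
  linarith
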